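/- Suppose c > 0 is such that the standard bubble U solves the equation pointwise with normalization κ (i.e. for every x the principal-value limit lim_{ε→0⁺} ∫_{|x−y|>ε} (U(x)−U(y))/|x−y|^{N+2s} dy exists and κ times it equals U(x)^p). Then the set of bounded continuous functions u : ℝ^N → ℝ which solve (−Δ)^s u = |u|^{p−1}u pointwise with normalization κ, have finite energy, are sign-changing (u takes both strictly positive and strictly negative values), and are non-radial (there is no f : ℝ → ℝ with u(x) = f(|x|) for all x), is infinite. -/

import Mathlib

open MeasureTheory Filter Real Finset

noncomputable section

/-- The standard bubble `U(y) = c (1/(1+|y|²))^{(N-2s)/2}`. -/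
def bubble (N : ℕ) (s c : ℝ) (y : EuclideanSpace ℝ (Fin N)) : ℝ :=
  c * (1 / (1 + ‖y‖ ^ 2)) ^ (((N : ℝ) - 2 * s) / 2)

/-- The principal-value truncated integral of the fractional Laplacian of `u` at `x`. -/
def pvInt (N : ℕ) (s : ℝ) (u : EuclideanSpace ℝ (Fin N) → ℝ)
    (x : EuclideanSpace ℝ (Fin N)) (ε : ℝ) : ℝ :=
  ∫ y in {y : EuclideanSpace ℝ (Fin N) | ε < ‖x - y‖},
    (u x - u y) / ‖x - y‖ ^ ((N : ℝ) + 2 * s)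

/-- `u` solves `(-Δ)^s u = |u|^{p-1} u` pointwise, with normalization constant `κ`:
for every `x` the principal-value limit exists and `κ` times it equals `|u(x)|^{p-1} u(x)`,
where `p = (N+2s)/(N-2s)`. -/
def SolvesPW (N : ℕ) (s κ : ℝ) (u : EuclideanSpace ℝ (Fin N) → ℝ) : Prop :=
  ∀ x : EuclideanSpace ℝ (Fin N), ∃ L : ℝ,
    Filter.Tendsto (pvInt N s u x) (nhdsWithin 0 (Set.Ioi 0)) (nhds L) ∧
    κ * L = |u x| ^ (((N : ℝ) + 2 * s) / ((N : ℝ) - 2 * s) - 1) * u x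

/-- `u` has finite energy: `∬ (u(x)-u(y))²/|x-y|^{N+2s} dx dy < ∞`. -/
def FiniteEnergy (N : ℕ) (s : ℝ) (u : EuclideanSpace ℝ (Fin N) → ℝ) : Prop :=
  (∫⁻ z : EuclideanSpace ℝ (Fin N) × EuclideanSpace ℝ (Fin N),
    ENNReal.ofReal ((u z.1 - u z.2) ^ 2 / ‖z.1 - z.2‖ ^ ((N : ℝ) + 2 * s))) < ⊤

/-- The odd power nonlinearity `t ↦ |t|^{p-1} t`. -/
def oddPow (p t : ℝ) : ℝ := |t| ^ (p - 1) * t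

lemma oddPow_continuous {p : ℝ} (hp : 1 < p) : Continuous (oddPow p) := by
  unfold oddPow
  exact (continuous_abs.rpow_const fun x => Or.inr (by linarith)).mul continuous_id

lemma abs_oddPow {p : ℝ} (hp : 1 < p) (t : ℝ) : |oddPow p t| = |t| ^ p := by
  unfold oddPow
  rw [abs_mul, abs_of_nonneg (Real.rpow_nonneg (abs_nonneg t) _)]
  rcases eq_or_ne t 0 with rfl | ht
  · simp [Real.zero_rpow (by linarith : p ≠ 0)]
  · have h := abs_pos.2 ht
    nth_rw 2 [← Real.rpow_one |t|]
    rw [← Real.rpow_add h]; congr 1; ring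

lemma oddPow_mul_self {p : ℝ} (hp : 1 < p) (t : ℝ) : oddPow p t * t = |t| ^ (p + 1) := by
  unfold oddPow
  rcases eq_or_ne t 0 with rfl | ht
  · simp [Real.zero_rpow (by linarith : p + 1 ≠ 0)]
  · have h := abs_pos.2 ht
    rw [mul_assoc, ← abs_mul_abs_self t, ← pow_two, ← Real.rpow_natCast, ← Real.rpow_add h]
    congr 1; push_cast; ring

lemma oddPow_smul {p : ℝ} {r : ℝ} (hr : 0 < r) (t : ℝ) :
    oddPow p (r * t) = r ^ p * oddPow p t := by
  unfold oddPow
  rw [abs_mul, abs_of_pos hr, Real.mul_rpow hr.le (abs_nonneg t)]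
  have : r ^ p = r ^ (p - 1) * r := by
    nth_rw 3 [← Real.rpow_one r]
    rw [← Real.rpow_add hr]; congr 1; ring
  rw [this]; ring

lemma oddPow_neg (p t : ℝ) : oddPow p (-t) = -oddPow p t := by
  unfold oddPow; rw [abs_neg]; ring

lemma oddPow_nonneg {p t : ℝ} (ht : 0 ≤ t) : 0 ≤ oddPow p t :=
  mul_nonneg (Real.rpow_nonneg (abs_nonneg _) _) ht

lemma oddPow_eq_zero {p t : ℝ} (h : oddPow p t = 0) : t = 0 := by
  by_contra ht
  exact (mul_ne_zero (Real.rpow_pos_of_pos (abs_pos.2 ht) _).ne' ht) h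

section Abstract

variable {X : Type*} [MetricSpace X] [CompactSpace X] [MeasurableSpace X] [BorelSpace X]

/-- The superposition operator `u ↦ |u|^{p-1} u` on continuous functions. -/
def oddPowMap (p : ℝ) (hp : 1 < p) (u : C(X, ℝ)) : C(X, ℝ) :=
  ⟨fun x => oddPow p (u x), (oddPow_continuous hp).comp u.continuous⟩

/-- The `L²` pairing of continuous functions. -/
def pairing (μ : Measure X) (u v : C(X, ℝ)) : ℝ := ∫ x, u x * v x ∂μ

/-- The `L^{p+1}` norm of a continuous function. -/
def lpSize (μ : Measure X) (p : ℝ) (u : C(X, ℝ)) : ℝ := (∫ x, |u x| ^ (p + 1) ∂μ) ^ (1 / (p + 1))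

variable {p : ℝ} (hp : 1 < p)

omit [CompactSpace X] [MeasurableSpace X] [BorelSpace X] in
lemma oddPowMap_continuous : Continuous (oddPowMap (X := X) p hp) :=
  ContinuousMap.continuous_postcomp ⟨oddPow p, oddPow_continuous hp⟩

variable (μ : Measure X) [IsFiniteMeasure μ]

lemma integrable_of_continuous {f : X → ℝ} (hf : Continuous f) : Integrable f μ :=
  hf.integrable_of_hasCompactSupport (HasCompactSupport.of_compactSpace f)

lemma continuous_integral_comp {g : ℝ → ℝ} (hg : Continuous g) :
    Continuous fun u : C(X, ℝ) => ∫ x, g (u x) ∂μ := by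
  have h1 : Continuous fun u : C(X, ℝ) => ∫ x, u x ∂μ := by
    refine (LinearMap.mkContinuous (⟨⟨fun u : C(X, ℝ) => ∫ x, u x ∂μ, ?_⟩, ?_⟩ : C(X, ℝ) →ₗ[ℝ] ℝ)
      (μ.real Set.univ) ?_).continuous
    · intro u v
      exact integral_add (integrable_of_continuous μ u.continuous)
        (integrable_of_continuous μ v.continuous)
    · intro r u
      exact integral_const_mul r _
    · intro u
      refine (norm_integral_le_of_norm_le_const (C := ‖u‖)
        (Eventually.of_forall fun x => u.norm_coe_le_norm x)).trans ?_
      rw [mul_comm]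
  exact h1.comp (ContinuousMap.continuous_postcomp ⟨g, hg⟩)

lemma continuous_pairing : Continuous fun w : C(X, ℝ) × C(X, ℝ) => pairing μ w.1 w.2 := by
  have := (continuous_integral_comp μ (g := id) continuous_id).comp
    (continuous_mul (M := C(X, ℝ)))
  exact this

lemma pairing_add_right (u v w : C(X, ℝ)) :
    pairing μ u (v + w) = pairing μ u v + pairing μ u w := by
  unfold pairing
  rw [← integral_add (integrable_of_continuous μ (by fun_prop))
    (integrable_of_continuous μ (by fun_prop))]
  congr 1; ext x; simp [mul_add]

omit [CompactSpace X] [BorelSpace X] [IsFiniteMeasure μ] in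
lemma pairing_comm (u v : C(X, ℝ)) : pairing μ u v = pairing μ v u := by
  unfold pairing; simp_rw [mul_comm]

omit [CompactSpace X] [BorelSpace X] [IsFiniteMeasure μ] in
lemma pairing_smul_right (r : ℝ) (u v : C(X, ℝ)) : pairing μ u (r • v) = r * pairing μ u v := by
  unfold pairing
  rw [← integral_const_mul]
  congr 1; ext x; simp; ring

omit [CompactSpace X] [BorelSpace X] [IsFiniteMeasure μ] in
lemma pairing_smul_left (r : ℝ) (u v : C(X, ℝ)) : pairing μ (r • u) v = r * pairing μ u v := by
  rw [pairing_comm, pairing_smul_right, pairing_comm]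

lemma pairing_add_left (u v w : C(X, ℝ)) : pairing μ (u + v) w = pairing μ u w + pairing μ v w := by
  rw [pairing_comm, pairing_add_right, pairing_comm μ w u, pairing_comm μ w v]

lemma pairing_sub_left (u v w : C(X, ℝ)) : pairing μ (u - v) w = pairing μ u w - pairing μ v w := by
  have : u - v = u + (-1 : ℝ) • v := by simp [sub_eq_add_neg]
  rw [this, pairing_add_left, pairing_smul_left]; ring

lemma pairing_sub_right (u v w : C(X, ℝ)) :
    pairing μ u (v - w) = pairing μ u v - pairing μ u w := by
  rw [pairing_comm, pairing_sub_left, pairing_comm μ v u, pairing_comm μ w u]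

include hp in
lemma lpSize_continuous : Continuous (lpSize μ p) := by
  unfold lpSize
  refine (continuous_integral_comp μ (g := fun t => |t| ^ (p + 1)) ?_).rpow_const
    fun u => Or.inr (by positivity)
  exact continuous_abs.rpow_const fun x => Or.inr (by linarith)

omit [CompactSpace X] [BorelSpace X] [IsFiniteMeasure μ] in
lemma lpSize_nonneg (u : C(X, ℝ)) : 0 ≤ lpSize μ p u :=
  Real.rpow_nonneg (integral_nonneg fun _ => Real.rpow_nonneg (abs_nonneg _) _) _

omit [CompactSpace X] [BorelSpace X] [IsFiniteMeasure μ] in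
include hp in
lemma lpSize_rpow (u : C(X, ℝ)) : lpSize μ p u ^ (p + 1) = ∫ x, |u x| ^ (p + 1) ∂μ := by
  unfold lpSize
  rw [← Real.rpow_mul (integral_nonneg fun x => Real.rpow_nonneg (abs_nonneg _) _),
    one_div_mul_cancel (by linarith), Real.rpow_one]

include hp in
lemma lpSize_pos [μ.IsOpenPosMeasure] {u : C(X, ℝ)} (hu : u ≠ 0) : 0 < lpSize μ p u := by
  refine Real.rpow_pos_of_pos ?_ _
  obtain ⟨x, hx⟩ : ∃ x, u x ≠ 0 := by
    by_contra! h; exact hu (ContinuousMap.ext h)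
  have hc : Continuous fun x => |u x| ^ (p + 1) :=
    (continuous_abs.comp u.continuous).rpow_const fun x => Or.inr (by linarith)
  exact hc.integral_pos_of_hasCompactSupport_nonneg_nonzero (HasCompactSupport.of_compactSpace _)
    (fun x => Real.rpow_nonneg (abs_nonneg _) _) (x := x)
    (Real.rpow_pos_of_pos (abs_pos.2 hx) _).ne'

lemma pairing_self_eq_zero [μ.IsOpenPosMeasure] {u : C(X, ℝ)} (h : pairing μ u u = 0) : u = 0 := by
  by_contra hu
  obtain ⟨x, hx⟩ : ∃ x, u x ≠ 0 := by
    by_contra! h; exact hu (ContinuousMap.ext h)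
  have hc : Continuous fun x => u x * u x := by fun_prop
  exact (hc.integral_pos_of_hasCompactSupport_nonneg_nonzero (μ := μ)
    (HasCompactSupport.of_compactSpace _)
    (fun x => mul_self_nonneg _) (x := x) (mul_self_ne_zero.2 hx)).ne' h

lemma lpSize_le (u : C(X, ℝ)) (hp : 1 < p) :
    lpSize μ p u ≤ ‖u‖ * (μ.real Set.univ) ^ (1 / (p + 1)) := by
  unfold lpSize
  have h1 : ∫ x, |u x| ^ (p + 1) ∂μ ≤ ‖u‖ ^ (p + 1) * μ.real Set.univ := by
    have : ∫ x, |u x| ^ (p + 1) ∂μ ≤ ∫ x, ‖u‖ ^ (p + 1) ∂μ := by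
      refine integral_mono (integrable_of_continuous μ ?_) (integrable_const _) fun x => ?_
      · exact (continuous_abs.comp u.continuous).rpow_const fun x => Or.inr (by linarith)
      · exact Real.rpow_le_rpow (abs_nonneg _) (u.norm_coe_le_norm x) (by linarith)
    refine this.trans (le_of_eq ?_)
    rw [integral_const, smul_eq_mul, mul_comm]
  refine (Real.rpow_le_rpow (integral_nonneg fun x => Real.rpow_nonneg (abs_nonneg _) _) h1
    (by positivity)).trans (le_of_eq ?_)
  rw [Real.mul_rpow (by positivity) (by positivity), ← Real.rpow_mul (norm_nonneg _),
    mul_one_div_cancel (by linarith), Real.rpow_one]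

omit [CompactSpace X] [BorelSpace X] [IsFiniteMeasure μ] in
lemma pairing_oddPow_self (u : C(X, ℝ)) :
    pairing μ (oddPowMap p hp u) u = lpSize μ p u ^ (p + 1) := by
  rw [lpSize_rpow hp]
  exact integral_congr_ae (Eventually.of_forall fun x => oddPow_mul_self hp _)

lemma pairing_oddPow_le (u v : C(X, ℝ)) :
    pairing μ (oddPowMap p hp u) v ≤ lpSize μ p u ^ p * lpSize μ p v := by
  have hpq : ((p + 1) / p).HolderConjugate (p + 1) := by
    rw [Real.holderConjugate_iff]
    refine ⟨by rw [lt_div_iff₀] <;> linarith, by field_simp⟩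
  have h1 : pairing μ (oddPowMap p hp u) v ≤ ∫ x, |oddPowMap p hp u x| * |v x| ∂μ := by
    refine integral_mono (integrable_of_continuous μ (by fun_prop))
      (integrable_of_continuous μ (by fun_prop)) fun x => ?_
    simpa [abs_mul] using le_abs_self (oddPowMap p hp u x * v x)
  have memLp : ∀ (f : C(X, ℝ)) (r : ENNReal), MemLp (fun x => |f x|) r μ := fun f r => by
    refine MemLp.of_bound (Continuous.aestronglyMeasurable (by fun_prop)) ‖f‖
      (Eventually.of_forall fun x => ?_)
    simpa using f.norm_coe_le_norm x
  refine h1.trans ((integral_mul_le_Lp_mul_Lq_of_nonneg hpq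
    (Eventually.of_forall fun x => abs_nonneg _) (Eventually.of_forall fun x => abs_nonneg _)
    (memLp _ _) (memLp _ _)).trans (le_of_eq ?_))
  have h2 : ∀ x, |oddPowMap p hp u x| ^ ((p + 1) / p) = |u x| ^ (p + 1) := fun x => by
    change |oddPow p (u x)| ^ _ = _
    rw [abs_oddPow hp, ← Real.rpow_mul (abs_nonneg _)]
    congr 1; field_simp
  simp_rw [h2]
  unfold lpSize
  rw [← Real.rpow_mul (integral_nonneg fun x => Real.rpow_nonneg (abs_nonneg _) _)]
  congr 2
  field_simp

end Abstract

section PowerIteration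

variable {X : Type*} [MetricSpace X] [CompactSpace X] [MeasurableSpace X] [BorelSpace X]
  {p : ℝ} (hp : 1 < p) (μ : Measure X) [IsFiniteMeasure μ] [μ.IsOpenPosMeasure]
  (K : C(X, ℝ) →L[ℝ] C(X, ℝ))

/-- The dual normalization `u ↦ |u|^{p-1}u / ‖u‖_{p+1}^p`. -/
def dualMap (u : C(X, ℝ)) : C(X, ℝ) := (lpSize μ p u ^ p)⁻¹ • oddPowMap p hp u

/-- One step of the nonlinear power iteration. -/
def powerStep (u : C(X, ℝ)) : C(X, ℝ) := K (dualMap hp μ u)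

/-- The value of the quadratic form of `K` at the dual normalization of `u`. -/
def dualEnergy (u : C(X, ℝ)) : ℝ := pairing μ (dualMap hp μ u) (powerStep hp μ K u)

lemma dualMap_continuousAt {u : C(X, ℝ)} (hu : u ≠ 0) : ContinuousAt (dualMap hp μ) u := by
  have h := lpSize_pos hp μ hu
  have h1 : ContinuousAt (fun u : C(X, ℝ) => (lpSize μ p u ^ p)⁻¹) u :=
    ((lpSize_continuous hp μ).continuousAt.rpow_const (Or.inl h.ne')).inv₀
      (Real.rpow_pos_of_pos h _).ne'
  exact h1.smul (oddPowMap_continuous hp).continuousAt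

lemma powerStep_continuousAt {u : C(X, ℝ)} (hu : u ≠ 0) : ContinuousAt (powerStep hp μ K) u :=
  K.continuous.continuousAt.comp (dualMap_continuousAt hp μ hu)

lemma dualEnergy_continuousAt {u : C(X, ℝ)} (hu : u ≠ 0) : ContinuousAt (dualEnergy hp μ K) u :=
  (continuous_pairing μ).continuousAt.comp
    ((dualMap_continuousAt hp μ hu).prodMk (powerStep_continuousAt hp μ K hu))

omit [CompactSpace X] [BorelSpace X] [IsFiniteMeasure μ] [μ.IsOpenPosMeasure] in
lemma powerStep_neg (u : C(X, ℝ)) [CompactSpace X] :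
    powerStep hp μ K (-u) = -powerStep hp μ K u := by
  have h1 : lpSize μ p (-u) = lpSize μ p u := by unfold lpSize; simp
  have h2 : oddPowMap p hp (-u) = -oddPowMap p hp u := by
    ext x; exact oddPow_neg p (u x)
  unfold powerStep dualMap
  rw [h1, h2, smul_neg, map_neg]

lemma dualMap_ne_zero {u : C(X, ℝ)} (hu : u ≠ 0) : dualMap hp μ u ≠ 0 := by
  have h := lpSize_pos hp μ hu
  intro h0
  refine hu ?_
  have h1 := (smul_eq_zero.1 h0).resolve_left (inv_ne_zero (Real.rpow_pos_of_pos h _).ne')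
  ext x
  exact oddPow_eq_zero (p := p) (congrArg (fun f : C(X, ℝ) => f x) h1)

lemma pairing_dualMap_self {u : C(X, ℝ)} (hu : u ≠ 0) :
    pairing μ (dualMap hp μ u) u = lpSize μ p u := by
  have h := lpSize_pos hp μ hu
  rw [dualMap, pairing_smul_left, pairing_oddPow_self, Real.rpow_add h, Real.rpow_one, ← mul_assoc,
    inv_mul_cancel₀ (Real.rpow_pos_of_pos h _).ne', one_mul]

lemma pairing_dualMap_le {u : C(X, ℝ)} (hu : u ≠ 0) (v : C(X, ℝ)) :
    pairing μ (dualMap hp μ u) v ≤ lpSize μ p v := by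
  have h := Real.rpow_pos_of_pos (lpSize_pos hp μ hu) p
  rw [dualMap, pairing_smul_left, inv_mul_le_iff₀ h]
  exact pairing_oddPow_le hp μ u v

variable {K}

section Form

variable (hsymm : ∀ u v, pairing μ u (K v) = pairing μ v (K u))
  (hpsd : ∀ u, 0 ≤ pairing μ u (K u)) (hinj : ∀ u, K u = 0 → u = 0)

omit [μ.IsOpenPosMeasure] in
include hsymm hpsd in
lemma pairing_sq_le (u v : C(X, ℝ)) :
    pairing μ u (K v) ^ 2 ≤ pairing μ u (K u) * pairing μ v (K v) := by
  have h : ∀ r : ℝ, 0 ≤ pairing μ v (K v) * (r * r) + (2 * pairing μ u (K v)) * r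
      + pairing μ u (K u) := by
    intro r
    have := hpsd (u + r • v)
    simp only [map_add, map_smul, pairing_add_left, pairing_add_right, pairing_smul_left,
      pairing_smul_right, hsymm v u] at this
    linarith
  have := discrim_le_zero h
  unfold discrim at this
  nlinarith

include hsymm hpsd hinj in
lemma form_pos {u : C(X, ℝ)} (hu : u ≠ 0) : 0 < pairing μ u (K u) := by
  refine lt_of_le_of_ne (hpsd u) fun h0 => hu (hinj u (pairing_self_eq_zero μ ?_))
  have := pairing_sq_le μ hsymm hpsd (K u) u
  rw [← h0, mul_zero] at this
  exact pow_eq_zero_iff (two_ne_zero) |>.1 (le_antisymm this (sq_nonneg _))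

include hinj in
lemma powerStep_ne_zero {u : C(X, ℝ)} (hu : u ≠ 0) : powerStep hp μ K u ≠ 0 := fun h =>
  dualMap_ne_zero hp μ hu (hinj _ h)

include hsymm hpsd hinj in
lemma dualEnergy_pos {u : C(X, ℝ)} (hu : u ≠ 0) : 0 < dualEnergy hp μ K u :=
  form_pos μ hsymm hpsd hinj (dualMap_ne_zero hp μ hu)

lemma dualEnergy_le_lpSize {u : C(X, ℝ)} (hu : u ≠ 0) :
    dualEnergy hp μ K u ≤ lpSize μ p (powerStep hp μ K u) :=
  pairing_dualMap_le hp μ hu _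

include hsymm hpsd hinj in
lemma lpSize_le_dualEnergy {u : C(X, ℝ)} (hu : u ≠ 0) :
    lpSize μ p (powerStep hp μ K u) ≤ dualEnergy hp μ K (powerStep hp μ K u) := by
  have h1 := pairing_sq_le μ hsymm hpsd (dualMap hp μ (powerStep hp μ K u)) (dualMap hp μ u)
  have h2 := pairing_dualMap_self hp μ (powerStep_ne_zero hp μ hinj hu)
  change _ ≤ dualEnergy hp μ K (powerStep hp μ K u) * dualEnergy hp μ K u at h1
  change pairing μ (dualMap hp μ (powerStep hp μ K u)) (K (dualMap hp μ u)) = _ at h2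
  rw [h2] at h1
  have h3 := dualEnergy_le_lpSize hp μ (K := K) hu
  have h4 := dualEnergy_pos hp μ hsymm hpsd hinj hu
  nlinarith [lpSize_pos hp μ (powerStep_ne_zero hp μ hinj hu)]

include hsymm in
lemma form_dualMap_sub {u : C(X, ℝ)} (hinj : ∀ u, K u = 0 → u = 0) (hu : u ≠ 0) :
    pairing μ (dualMap hp μ (powerStep hp μ K u) - dualMap hp μ u)
      (K (dualMap hp μ (powerStep hp μ K u) - dualMap hp μ u)) =
    dualEnergy hp μ K (powerStep hp μ K u) + dualEnergy hp μ K u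
      - 2 * lpSize μ p (powerStep hp μ K u) := by
  have h2 := pairing_dualMap_self hp μ (powerStep_ne_zero hp μ hinj hu)
  change pairing μ (dualMap hp μ (powerStep hp μ K u)) (K (dualMap hp μ u)) = _ at h2
  simp only [map_sub, pairing_sub_left, pairing_sub_right]
  rw [hsymm (dualMap hp μ u), h2]
  unfold dualEnergy powerStep
  ring

end Form

section NegPart

/-- The sup norm of the negative part. -/
def negSize (u : C(X, ℝ)) : ℝ := ‖(-u) ⊔ 0‖

omit [MeasurableSpace X] [BorelSpace X] in
lemma negSize_continuous : Continuous (negSize (X := X)) := by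
  have h : Continuous fun u : C(X, ℝ) => (-u) ⊔ 0 := by
    refine ContinuousMap.continuous_of_continuous_uncurry _ ?_
    exact ((continuous_eval (F := C(X, ℝ))).neg).max continuous_const
  exact h.norm

omit [MeasurableSpace X] [BorelSpace X] in
lemma neg_le_negSize (u : C(X, ℝ)) (x : X) : -u x ≤ negSize u :=
  (le_max_left (-u x) 0).trans
    ((le_abs_self _).trans (((-u) ⊔ 0 : C(X, ℝ)).norm_coe_le_norm x))

omit [MeasurableSpace X] [BorelSpace X] in
lemma negSize_le {u : C(X, ℝ)} {r : ℝ} (hr : 0 ≤ r) (h : ∀ x, -u x ≤ r) : negSize u ≤ r := by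
  refine (ContinuousMap.norm_le _ hr).2 fun x => ?_
  change |max (-u x) 0| ≤ r
  rw [abs_of_nonneg (le_max_right _ _)]
  exact max_le (h x) hr

omit [MeasurableSpace X] [BorelSpace X] in
lemma negSize_nonneg (u : C(X, ℝ)) : 0 ≤ negSize u := norm_nonneg _

omit [MeasurableSpace X] [BorelSpace X] in
lemma norm_le_negSize (u : C(X, ℝ)) : ‖u‖ ≤ negSize u + negSize (-u) := by
  refine (ContinuousMap.norm_le _ (add_nonneg (negSize_nonneg _) (negSize_nonneg _))).2 fun x => ?_
  have h1 := neg_le_negSize u x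
  have h2 := neg_le_negSize (-u) x
  simp only [ContinuousMap.neg_apply, neg_neg] at h2
  have h3 := negSize_nonneg u
  have h4 := negSize_nonneg (-u)
  rw [Real.norm_eq_abs, abs_le]
  constructor <;> linarith

omit [MeasurableSpace X] [BorelSpace X] in
lemma exists_neg_of_negSize_pos {u : C(X, ℝ)} (h : 0 < negSize u) : ∃ x, u x < 0 := by
  by_contra! h0
  exact h.not_ge (negSize_le le_rfl fun x => by linarith [h0 x])

omit [IsFiniteMeasure μ] [μ.IsOpenPosMeasure] [BorelSpace X] in
lemma negSize_powerStep_le (hpos : ∀ u : C(X, ℝ), 0 ≤ u → 0 ≤ K u) (u : C(X, ℝ)) :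
    negSize (powerStep hp μ K u) ≤ (lpSize μ p u ^ p)⁻¹ * (‖K‖ * negSize u ^ p) := by
  have hb : 0 ≤ (lpSize μ p u ^ p)⁻¹ := inv_nonneg.2 (Real.rpow_nonneg (lpSize_nonneg μ u) _)
  have hm : ∀ x, 0 ≤ ((-u) ⊔ 0 : C(X, ℝ)) x := fun x => le_max_right (-u x) 0
  have hD : ‖oddPowMap p hp ((-u) ⊔ 0)‖ ≤ negSize u ^ p := by
    refine (ContinuousMap.norm_le _ (Real.rpow_nonneg (negSize_nonneg _) _)).2 fun x => ?_
    change |oddPow p _| ≤ _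
    rw [abs_oddPow hp]
    exact Real.rpow_le_rpow (abs_nonneg _) (((-u) ⊔ 0 : C(X, ℝ)).norm_coe_le_norm x) (by linarith)
  refine negSize_le (by have := negSize_nonneg u; positivity) fun x => ?_
  have h1 : 0 ≤ K (oddPowMap p hp u + oddPowMap p hp ((-u) ⊔ 0)) := by
    refine hpos _ fun y => ?_
    change 0 ≤ oddPow p (u y) + oddPow p (max (-u y) 0)
    rcases le_total (u y) 0 with h | h
    · rw [max_eq_left (by linarith), oddPow_neg]; linarith
    · rw [max_eq_right (by linarith)]
      have := oddPow_nonneg (p := p) h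
      have h0 : oddPow p 0 = 0 := by simp [oddPow]
      linarith
  have h2 : 0 ≤ K (oddPowMap p hp u) x + K (oddPowMap p hp ((-u) ⊔ 0)) x := by
    have h := h1 x
    rw [map_add] at h
    exact h
  have h3 : K (oddPowMap p hp ((-u) ⊔ 0)) x ≤ ‖K‖ * negSize u ^ p :=
    (le_abs_self _).trans (((K _).norm_coe_le_norm x).trans ((K.le_opNorm _).trans
      (mul_le_mul_of_nonneg_left hD (norm_nonneg _))))
  have h4 : powerStep hp μ K u x = (lpSize μ p u ^ p)⁻¹ * K (oddPowMap p hp u) x := by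
    unfold powerStep dualMap; rw [map_smul]; rfl
  rw [h4, ← mul_neg]
  exact mul_le_mul_of_nonneg_left (by linarith) hb

end NegPart

/-- Existence of a sign-changing fixed point of `w ↦ K(|w|^{p-1}w)`, by power iteration along a
path joining a positive function to a negative one. -/
theorem exists_signChanging_fixedPoint [Nonempty X] (hcomp : IsCompactOperator K)
    (hpos : ∀ u : C(X, ℝ), 0 ≤ u → 0 ≤ K u)
    (hsymm : ∀ u v, pairing μ u (K v) = pairing μ v (K u))
    (hpsd : ∀ u, 0 ≤ pairing μ u (K u)) (hinj : ∀ u, K u = 0 → u = 0)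
    (hsub : ∀ η > 0, ∃ C, ∀ u : C(X, ℝ), ‖K (oddPowMap p hp u)‖ ≤
      η * ‖u‖ * lpSize μ p u ^ (p - 1) + C * lpSize μ p u ^ p)
    (h : C(X, ℝ)) (hh : ∀ α β : ℝ, (∀ x, α + β * h x = 0) → α = 0 ∧ β = 0) :
    ∃ w : C(X, ℝ), (∃ x, 0 < w x) ∧ (∃ x, w x < 0) ∧ K (oddPowMap p hp w) = w := by
  set F := powerStep hp μ K with hF
  let u : ℕ → ℝ → C(X, ℝ) := fun n θ =>
    F^[n] (ContinuousMap.const X (Real.cos θ) + Real.sin θ • h)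
  have usucc : ∀ n θ, u (n + 1) θ = F (u n θ) := fun n θ => Function.iterate_succ_apply' F n _
  have une : ∀ n θ, u n θ ≠ 0 := by
    intro n θ
    induction n with
    | zero =>
      intro h0
      have := hh (Real.cos θ) (Real.sin θ) fun x => congrArg (fun f : C(X, ℝ) => f x) h0
      have h1 := Real.cos_sq_add_sin_sq θ
      rw [this.1, this.2] at h1; norm_num at h1
    | succ n ih => rw [usucc]; exact powerStep_ne_zero hp μ hinj ih
  have ucont : ∀ n, Continuous (u n) := by
    intro n
    induction n with
    | zero =>
      change Continuous fun θ => ContinuousMap.const X (Real.cos θ) + Real.sin θ • h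
      refine Continuous.add ?_ (by fun_prop)
      exact (ContinuousMap.continuous_const').comp Real.continuous_cos
    | succ n ih =>
      have : u (n + 1) = fun θ => F (u n θ) := funext (usucc n)
      rw [this]
      exact continuous_iff_continuousAt.2 fun θ =>
        (powerStep_continuousAt hp μ K (une n θ)).comp ih.continuousAt
  have Amono : ∀ θ, Monotone fun n => dualEnergy hp μ K (u n θ) := fun θ =>
    monotone_nat_of_le_succ fun n => by
      rw [usucc]
      exact (dualEnergy_le_lpSize hp μ (une n θ)).trans
        (lpSize_le_dualEnergy hp μ hsymm hpsd hinj (une n θ))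
  obtain ⟨L, hL, hLb⟩ : ∃ L > 0, ∀ n, ∀ θ ∈ Set.Icc 0 π, L ≤ lpSize μ p (u n θ) := by
    have hA : Continuous fun θ => min (dualEnergy hp μ K (u 0 θ)) (lpSize μ p (u 0 θ)) := by
      refine Continuous.min ?_ ((lpSize_continuous hp μ).comp (ucont 0))
      exact continuous_iff_continuousAt.2 fun θ =>
        (dualEnergy_continuousAt hp μ K (une 0 θ)).comp (ucont 0).continuousAt
    obtain ⟨θ₀, -, hθ₀⟩ := isCompact_Icc.exists_isMinOn
      (Set.nonempty_Icc.2 Real.pi_pos.le) hA.continuousOn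
    refine ⟨_, lt_min (dualEnergy_pos hp μ hsymm hpsd hinj (une 0 θ₀))
      (lpSize_pos hp μ (une 0 θ₀)), fun n θ hθ => ?_⟩
    refine (hθ₀ hθ).trans ?_
    cases n with
    | zero => exact min_le_right _ _
    | succ n =>
      refine (min_le_left _ _).trans ((Amono θ (Nat.zero_le n)).trans ?_)
      rw [usucc]; exact dualEnergy_le_lpSize hp μ (une n θ)
  obtain ⟨δ, hδ, hδb⟩ : ∃ δ > 0, ∀ v : C(X, ℝ), L ≤ lpSize μ p v → negSize v < δ →
      negSize (F v) ≤ 1 / 2 * negSize v := by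
    have h1 : Tendsto (fun t : ℝ => (L ^ p)⁻¹ * (‖K‖ * t ^ (p - 1))) (nhds 0) (nhds 0) := by
      have : ContinuousAt (fun t : ℝ => (L ^ p)⁻¹ * (‖K‖ * t ^ (p - 1))) 0 :=
        ((continuousAt_id.rpow_const (Or.inr (by linarith))).const_mul _).const_mul _
      have h2 := this.tendsto
      rwa [Real.zero_rpow (by linarith : p - 1 ≠ 0), mul_zero, mul_zero] at h2
    obtain ⟨δ, hδ, hδ'⟩ := Metric.eventually_nhds_iff.1
      (h1.eventually (gt_mem_nhds (by norm_num : (0 : ℝ) < 1 / 2)))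
    refine ⟨δ, hδ, fun v hv hvδ => (negSize_powerStep_le hp μ hpos v).trans ?_⟩
    have h2 := hδ' (y := negSize v) (by
      rw [Real.dist_eq, sub_zero, abs_of_nonneg (negSize_nonneg v)]; exact hvδ)
    have h3 : negSize v ^ p = negSize v ^ (p - 1) * negSize v := by
      rcases (negSize_nonneg v).eq_or_lt with h0 | h0
      · rw [← h0, Real.zero_rpow (by linarith), mul_zero]
      · nth_rw 3 [← Real.rpow_one (negSize v)]
        rw [← Real.rpow_add h0]; congr 1; ring
    have h4 : (lpSize μ p v ^ p)⁻¹ ≤ (L ^ p)⁻¹ := by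
      have := Real.rpow_pos_of_pos hL p
      gcongr
    rw [h3]
    calc (lpSize μ p v ^ p)⁻¹ * (‖K‖ * (negSize v ^ (p - 1) * negSize v))
        ≤ (L ^ p)⁻¹ * (‖K‖ * (negSize v ^ (p - 1) * negSize v)) := by
          have := negSize_nonneg v
          gcongr
      _ = ((L ^ p)⁻¹ * (‖K‖ * negSize v ^ (p - 1))) * negSize v := by ring
      _ ≤ 1 / 2 * negSize v := mul_le_mul_of_nonneg_right h2.le (negSize_nonneg v)
  have hdecay : ∀ v : ℕ → C(X, ℝ), (∀ n, v (n + 1) = F (v n)) → (∀ n, L ≤ lpSize μ p (v n)) →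
      ∀ n, negSize (v n) < δ → Tendsto (fun k => negSize (v (k + n))) atTop (nhds 0) := by
    intro v hv hvL n hn
    have key : ∀ k, negSize (v (k + n)) ≤ (1 / 2) ^ k * negSize (v n) := by
      intro k
      induction k with
      | zero => simp
      | succ k ih =>
        have hlt : negSize (v (k + n)) < δ := by
          refine lt_of_le_of_lt (ih.trans ?_) hn
          exact mul_le_of_le_one_left (negSize_nonneg _) (pow_le_one₀ (by norm_num) (by norm_num))
        have := hδb _ (hvL _) hlt
        rw [show k + 1 + n = (k + n) + 1 by ring, hv, pow_succ]
        linarith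
    refine squeeze_zero (fun k => negSize_nonneg _) key ?_
    simpa using (tendsto_pow_atTop_nhds_zero_of_lt_one (by norm_num : (0 : ℝ) ≤ 1 / 2)
      (by norm_num)).mul_const (negSize (v n))
  have hneg : ∀ n θ, -u (n + 1) θ = F (-u n θ) := fun n θ => by
    rw [usucc, hF, powerStep_neg]
  have hlneg : ∀ v : C(X, ℝ), lpSize μ p (-v) = lpSize μ p v := fun v => by
    unfold lpSize; simp
  have hdisj : ∀ θ ∈ Set.Icc 0 π, (∃ n, negSize (u n θ) < δ) → (∃ n, negSize (-u n θ) < δ) →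
      False := by
    rintro θ hθ ⟨n, hn⟩ ⟨m, hm⟩
    have h1 := hdecay (fun k => u k θ) (fun k => usucc k θ) (fun k => hLb k θ hθ) n hn
    have h2 := hdecay (fun k => -u k θ) (fun k => hneg k θ)
      (fun k => by rw [hlneg]; exact hLb k θ hθ) m hm
    have h3 := ((tendsto_add_atTop_iff_nat (f := fun k => negSize (u k θ)) n).1 h1).add
      ((tendsto_add_atTop_iff_nat (f := fun k => negSize (-u k θ)) m).1 h2)
    have h4 := h3.mul_const ((μ.real Set.univ) ^ (1 / (p + 1)))
    rw [add_zero, zero_mul] at h4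
    refine hL.not_ge (ge_of_tendsto' h4 fun k => (hLb k θ hθ).trans ((lpSize_le μ _ hp).trans ?_))
    exact mul_le_mul_of_nonneg_right (norm_le_negSize _) (by positivity)
  obtain ⟨θ, hθ, hθ1, hθ2⟩ : ∃ θ ∈ Set.Icc 0 π, (∀ n, δ ≤ negSize (u n θ)) ∧
      ∀ n, δ ≤ negSize (-u n θ) := by
    by_contra! hcon
    have hopen1 : IsOpen {θ | ∃ n, negSize (u n θ) < δ} := by
      rw [Set.ofPred_exists]
      exact isOpen_iUnion fun n => isOpen_lt (negSize_continuous.comp (ucont n)) continuous_const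
    have hopen2 : IsOpen {θ | ∃ n, negSize (-u n θ) < δ} := by
      rw [Set.ofPred_exists]
      exact isOpen_iUnion fun n =>
        isOpen_lt (negSize_continuous.comp (ucont n).neg) continuous_const
    obtain ⟨θ, hθ, h1, h2⟩ := isPreconnected_Icc (a := (0 : ℝ)) (b := π) _ _ hopen1 hopen2
      (fun θ hθ => by
        by_cases h1 : ∃ n, negSize (u n θ) < δ
        · exact Or.inl h1
        · push Not at h1
          exact Or.inr (hcon θ hθ h1))
      ⟨0, Set.left_mem_Icc.2 Real.pi_pos.le, 0, by
        refine lt_of_le_of_lt (negSize_le le_rfl fun x => ?_) hδ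
        simp [u]⟩
      ⟨π, Set.right_mem_Icc.2 Real.pi_pos.le, 0, by
        refine lt_of_le_of_lt (negSize_le le_rfl fun x => ?_) hδ
        simp [u]⟩
    exact hdisj θ hθ h1 h2
  -- from here on, the convergence of the iteration at the angle `θ`
  obtain ⟨M, hM⟩ : ∃ M, ∀ n, ‖u n θ‖ ≤ M := by
    obtain ⟨C, hC⟩ := hsub (L / 2) (by positivity)
    refine ⟨max ‖u 0 θ‖ (2 * C), fun n => ?_⟩
    induction n with
    | zero => exact le_max_left _ _
    | succ n ih =>
      have hb := hLb n θ hθ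
      have hb0 : 0 < lpSize μ p (u n θ) := hL.trans_le hb
      have h1 : ‖u (n + 1) θ‖ ≤ 1 / 2 * ‖u n θ‖ + C := by
        rw [usucc, hF, powerStep, dualMap, map_smul, norm_smul, Real.norm_eq_abs,
          abs_of_nonneg (inv_nonneg.2 (Real.rpow_nonneg hb0.le _)),
          inv_mul_le_iff₀ (Real.rpow_pos_of_pos hb0 _)]
        refine (hC _).trans ?_
        have h2 : lpSize μ p (u n θ) ^ p = lpSize μ p (u n θ) ^ (p - 1) * lpSize μ p (u n θ) := by
          nth_rw 3 [← Real.rpow_one (lpSize μ p (u n θ))]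
          rw [← Real.rpow_add hb0]; congr 1; ring
        have h3 := Real.rpow_nonneg hb0.le (p - 1)
        have h4 : L / 2 * ‖u n θ‖ * lpSize μ p (u n θ) ^ (p - 1) ≤
            lpSize μ p (u n θ) ^ p * (1 / 2 * ‖u n θ‖) := by
          rw [h2]
          have : L * (‖u n θ‖ * lpSize μ p (u n θ) ^ (p - 1)) ≤
              lpSize μ p (u n θ) * (‖u n θ‖ * lpSize μ p (u n θ) ^ (p - 1)) := by gcongr
          linarith
        linarith
      have h5 := le_max_right ‖u 0 θ‖ (2 * C)
      linarith
  obtain ⟨w, φ, hφ, hw⟩ : ∃ (w : C(X, ℝ)) (φ : ℕ → ℕ), StrictMono φ ∧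
      Tendsto (fun k => u (φ k + 1) θ) atTop (nhds w) := by
    have hbd : ∀ n, ‖dualMap hp μ (u n θ)‖ ≤ (L ^ p)⁻¹ * M ^ p := by
      intro n
      have hb := hLb n θ hθ
      have hLp := Real.rpow_pos_of_pos hL p
      rw [dualMap, norm_smul, Real.norm_eq_abs,
        abs_of_nonneg (inv_nonneg.2 (Real.rpow_nonneg (lpSize_nonneg μ _) _))]
      have h1 : ‖oddPowMap p hp (u n θ)‖ ≤ M ^ p := by
        refine (ContinuousMap.norm_le _
          (Real.rpow_nonneg ((norm_nonneg _).trans (hM n)) _)).2 fun x => ?_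
        change |oddPow p _| ≤ _
        rw [abs_oddPow hp]
        exact Real.rpow_le_rpow (abs_nonneg _) (((u n θ).norm_coe_le_norm x).trans (hM n))
          (by linarith)
      gcongr
    obtain ⟨w, -, φ, hφ, hw⟩ :=
      (hcomp.isCompact_closure_image_closedBall ((L ^ p)⁻¹ * M ^ p)).tendsto_subseq
      (x := fun n => u (n + 1) θ) fun n => subset_closure
        ⟨dualMap hp μ (u n θ), by simpa using hbd n, by rw [usucc]; rfl⟩
    exact ⟨w, φ, hφ, hw⟩
  have hw0 : w ≠ 0 := by
    intro h0
    have h1 := (lpSize_continuous hp μ).continuousAt.tendsto.comp hw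
    have h2 : L ≤ lpSize μ p w := ge_of_tendsto' h1 fun k => hLb _ θ hθ
    have h3 := lpSize_le μ (0 : C(X, ℝ)) hp
    rw [h0] at h2
    simp at h3
    linarith
  have hFw : Tendsto (fun k => u (φ k + 2) θ) atTop (nhds (F w)) := by
    have h1 := (powerStep_continuousAt hp μ K hw0).tendsto.comp hw
    refine h1.congr fun k => ?_
    rw [Function.comp, ← hF, ← usucc]
  have hfix : F w = w := by
    have hAlim : Tendsto (fun n =>
        dualEnergy hp μ K (u (n + 1) θ) - dualEnergy hp μ K (u n θ)) atTop
        (nhds 0) := by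
      have hbdd : BddAbove (Set.range fun n => dualEnergy hp μ K (u n θ)) := by
        refine ⟨M * (μ.real Set.univ) ^ (1 / (p + 1)), ?_⟩
        rintro _ ⟨n, rfl⟩
        refine (dualEnergy_le_lpSize hp μ (une n θ)).trans ?_
        rw [← hF, ← usucc]
        exact (lpSize_le μ _ hp).trans (mul_le_mul_of_nonneg_right (hM _) (by positivity))
      have h1 := tendsto_atTop_ciSup (Amono θ) hbdd
      have h2 := ((tendsto_add_atTop_iff_nat 1).2 h1).sub h1
      simpa using h2
    have hpair : ∀ ψ : C(X, ℝ), pairing μ ψ (F w - w) = 0 := by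
      intro ψ
      have h1 : Tendsto (fun n => pairing μ ψ (u (n + 2) θ - u (n + 1) θ) ^ 2) atTop (nhds 0) := by
        refine squeeze_zero (fun n => sq_nonneg _) (g := fun n => pairing μ ψ (K ψ) *
          (dualEnergy hp μ K (u (n + 1) θ) - dualEnergy hp μ K (u n θ))) (fun n => ?_) ?_
        · have h2 := pairing_sq_le μ hsymm hpsd ψ (dualMap hp μ (F (u n θ)) - dualMap hp μ (u n θ))
          rw [form_dualMap_sub hp μ hsymm hinj (une n θ)] at h2
          have h3 : u (n + 2) θ - u (n + 1) θ =
              K (dualMap hp μ (F (u n θ)) - dualMap hp μ (u n θ)) := by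
            rw [map_sub, usucc, usucc]; rfl
          rw [h3, usucc]
          refine h2.trans (mul_le_mul_of_nonneg_left ?_ (hpsd ψ))
          have := dualEnergy_le_lpSize hp μ (K := K) (une n θ)
          rw [← hF] at this ⊢
          linarith
        · simpa using hAlim.const_mul (pairing μ ψ (K ψ))
      have h2 : Tendsto (fun k => pairing μ ψ (u (φ k + 2) θ - u (φ k + 1) θ) ^ 2) atTop
          (nhds (pairing μ ψ (F w - w) ^ 2)) :=
        ((((continuous_pairing μ).comp (Continuous.prodMk_right ψ)).continuousAt.tendsto.comp
          (hFw.sub hw))).pow 2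
      exact pow_eq_zero_iff (two_ne_zero) |>.1
        (tendsto_nhds_unique h2 (h1.comp hφ.tendsto_atTop))
    exact sub_eq_zero.1 (pairing_self_eq_zero μ (hpair _))
  have hn1 : ∃ x, w x < 0 := exists_neg_of_negSize_pos (hδ.trans_le
    (ge_of_tendsto' (negSize_continuous.continuousAt.tendsto.comp hw) fun k => hθ1 _))
  have hn2 : ∃ x, (-w) x < 0 := exists_neg_of_negSize_pos (hδ.trans_le
    (ge_of_tendsto' (negSize_continuous.continuousAt.tendsto.comp hw.neg) fun k => hθ2 _))
  have hb := lpSize_pos hp μ hw0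
  set b := lpSize μ p w with hbdef
  have ht : 0 < b ^ (-(p / (p - 1))) := Real.rpow_pos_of_pos hb _
  refine ⟨b ^ (-(p / (p - 1))) • w, ?_, ?_, ?_⟩
  · obtain ⟨x, hx⟩ := hn2
    exact ⟨x, mul_pos ht (by simpa using hx)⟩
  · obtain ⟨x, hx⟩ := hn1
    exact ⟨x, mul_neg_of_pos_of_neg ht hx⟩
  · have h1 : oddPowMap p hp (b ^ (-(p / (p - 1))) • w) =
        (b ^ (-(p / (p - 1)))) ^ p • oddPowMap p hp w := by
      ext x; exact oddPow_smul ht (w x)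
    have h2 : K (oddPowMap p hp w) = b ^ p • w := by
      have h3 : (b ^ p)⁻¹ • K (oddPowMap p hp w) = w := by
        rw [← map_smul]; exact hfix
      nth_rw 2 [← h3]
      rw [smul_smul, mul_inv_cancel₀ (Real.rpow_pos_of_pos hb _).ne', one_smul]
    rw [h1, map_smul, h2, smul_smul, ← Real.rpow_mul hb.le, ← Real.rpow_add hb]
    congr 2
    have : p - 1 ≠ 0 := by linarith
    field_simp
    ring

end PowerIteration

section Stereographic

open Module EuclideanGeometry
open scoped RealInnerProductSpace ENNReal

variable {E : Type*} [NormedAddCommGroup E] [InnerProductSpace ℝ E]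

/-- Inverse stereographic projection onto the unit sphere of `E × ℝ`. -/
def invStereo (x : E) : WithLp 2 (E × ℝ) :=
  WithLp.toLp 2 ((2 / (1 + ‖x‖ ^ 2)) • x, (‖x‖ ^ 2 - 1) / (1 + ‖x‖ ^ 2))

omit [InnerProductSpace ℝ E] in
lemma norm_withLp_sq (v : E) (r : ℝ) : ‖(WithLp.toLp 2 (v, r) : WithLp 2 (E × ℝ))‖ ^ 2 =
    ‖v‖ ^ 2 + r ^ 2 := by
  rw [WithLp.prod_norm_sq_eq_of_L2]
  simp

lemma norm_invStereo (x : E) : ‖invStereo x‖ = 1 := by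
  have h0 : 0 < 1 + ‖x‖ ^ 2 := by positivity
  have : ‖invStereo x‖ ^ 2 = 1 := by
    rw [invStereo, norm_withLp_sq, norm_smul, mul_pow, Real.norm_eq_abs, sq_abs]
    field_simp
    ring
  exact (pow_eq_one_iff_of_nonneg (norm_nonneg _) two_ne_zero).1 this

lemma norm_invStereo_sub_sq (x y : E) : ‖invStereo x - invStereo y‖ ^ 2 =
    4 * ‖x - y‖ ^ 2 / ((1 + ‖x‖ ^ 2) * (1 + ‖y‖ ^ 2)) := by
  have h1 : 0 < 1 + ‖x‖ ^ 2 := by positivity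
  have h2 : 0 < 1 + ‖y‖ ^ 2 := by positivity
  have h3 : ⟪invStereo x, invStereo y⟫ = 2 / (1 + ‖x‖ ^ 2) * (2 / (1 + ‖y‖ ^ 2)) * ⟪x, y⟫ +
      (‖x‖ ^ 2 - 1) / (1 + ‖x‖ ^ 2) * ((‖y‖ ^ 2 - 1) / (1 + ‖y‖ ^ 2)) := by
    rw [WithLp.prod_inner_apply]
    simp only [invStereo, real_inner_smul_left, real_inner_smul_right, RCLike.inner_apply,
      conj_trivial]
    ring
  rw [norm_sub_sq_real, norm_sub_sq_real, norm_invStereo, norm_invStereo, h3]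
  field_simp
  ring

lemma continuous_invStereo : Continuous (invStereo (E := E)) := by
  unfold invStereo
  refine (WithLp.prod_continuous_toLp 2 E ℝ).comp (Continuous.prodMk ?_ ?_)
  · exact (continuous_const.div (by fun_prop) fun x => by positivity).smul continuous_id
  · exact Continuous.div (by fun_prop) (by fun_prop) fun x => by positivity

lemma exists_invStereo_eq {ξ : WithLp 2 (E × ℝ)} (h : ‖ξ‖ = 1) (h1 : ξ.snd ≠ 1) :
    ∃ x, invStereo x = ξ := by
  obtain ⟨⟨v, r⟩⟩ := ξ
  have h2 : ‖v‖ ^ 2 + r ^ 2 = 1 := by rw [← norm_withLp_sq, h, one_pow]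
  change r ≠ 1 at h1
  have h3 : 1 - r ≠ 0 := sub_ne_zero.2 (Ne.symm h1)
  refine ⟨(1 - r)⁻¹ • v, ?_⟩
  have h4 : ‖(1 - r)⁻¹ • v‖ ^ 2 = (1 + r) / (1 - r) := by
    rw [norm_smul, mul_pow, Real.norm_eq_abs, sq_abs, eq_sub_of_add_eq h2]
    field_simp
    ring
  have h5 : 1 + (1 + r) / (1 - r) = 2 / (1 - r) := by field_simp; ring
  unfold invStereo
  rw [h4, h5, smul_smul]
  congr 2
  · rw [div_div_eq_mul_div, mul_div_cancel_left₀ _ two_ne_zero, mul_inv_cancel₀ h3, one_smul]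
  · field_simp
    ring

lemma norm_sub_pole_sq (x : E) :
    ‖(WithLp.toLp 2 (0, 1) : WithLp 2 (E × ℝ)) - invStereo x‖ ^ 2 = 4 / (1 + ‖x‖ ^ 2) := by
  have h1 : 0 < 1 + ‖x‖ ^ 2 := by positivity
  rw [invStereo, ← WithLp.toLp_sub, Prod.mk_sub_mk, norm_withLp_sq, zero_sub, norm_neg, norm_smul,
    mul_pow, Real.norm_eq_abs, sq_abs]
  field_simp
  ring

/-- The linear reflection with normal vector `ν`. -/
abbrev mirror {F : Type*} [NormedAddCommGroup F] [InnerProductSpace ℝ F] (ν : F) : F ≃ₗᵢ[ℝ] F :=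
  (ℝ ∙ ν)ᗮ.reflection

lemma mirror_apply {F : Type*} [NormedAddCommGroup F] [InnerProductSpace ℝ F] (ν v : F) :
    mirror ν v = v - (2 * (⟪ν, v⟫ / ‖ν‖ ^ 2)) • ν := by
  rw [Submodule.reflection_orthogonal_apply, Submodule.reflection_singleton_apply, neg_sub,
    mul_smul,
    two_smul ℕ, two_smul ℝ]
  rfl

lemma mirror_smul {F : Type*} [NormedAddCommGroup F] [InnerProductSpace ℝ F] (ν : F) {r : ℝ}
    (hr : r ≠ 0) : mirror (r • ν) = mirror ν := by
  unfold mirror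
  congr 2
  exact Submodule.span_singleton_smul_eq (IsUnit.mk0 r hr) ν

lemma mirror_invStereo_horizontal (n x : E) :
    mirror (WithLp.toLp 2 (n, 0)) (invStereo x) = invStereo (mirror n x) := by
  rw [mirror_apply, norm_withLp_sq, WithLp.prod_inner_apply]
  unfold invStereo
  rw [LinearIsometryEquiv.norm_map, mirror_apply, ← WithLp.toLp_smul, ← WithLp.toLp_sub,
    Prod.smul_mk, Prod.mk_sub_mk]
  simp only [real_inner_smul_right, smul_sub, smul_smul]
  simp
  congr 1
  ring

lemma one_add_norm_inversion_sq {c x : E} (hx : x ≠ c) :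
    1 + ‖inversion c √(1 + ‖c‖ ^ 2) x‖ ^ 2 =
      (1 + ‖c‖ ^ 2) * (1 + ‖x‖ ^ 2) / ‖x - c‖ ^ 2 := by
  have h0 : ‖x - c‖ ≠ 0 := by simpa [sub_eq_zero] using hx
  have h1 : ‖x‖ ^ 2 = ‖x - c‖ ^ 2 + 2 * ⟪x - c, c⟫ + ‖c‖ ^ 2 := by
    rw [← norm_add_sq_real, sub_add_cancel]
  rw [inversion, vsub_eq_sub, vadd_eq_add, dist_eq_norm, norm_add_sq_real, norm_smul,
    real_inner_smul_left, div_pow, Real.sq_sqrt (by positivity), mul_pow, Real.norm_eq_abs, sq_abs,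
    h1]
  field_simp
  ring

lemma mirror_invStereo_inversion {c x : E} (hx : x ≠ c) :
    mirror (WithLp.toLp 2 (c, -1)) (invStereo x) = invStereo (inversion c √(1 + ‖c‖ ^ 2) x) := by
  have h0 : ‖x - c‖ ≠ 0 := by simpa [sub_eq_zero] using hx
  have hc : 0 < 1 + ‖c‖ ^ 2 := by positivity
  have hx' : 0 < 1 + ‖x‖ ^ 2 := by positivity
  have h2 := one_add_norm_inversion_sq hx
  have h3 := eq_sub_of_add_eq' h2
  have h4 : ‖x‖ ^ 2 = ‖x - c‖ ^ 2 + 2 * ⟪x, c⟫ - ‖c‖ ^ 2 := by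
    rw [norm_sub_sq_real]; ring
  have h5 : ⟪(WithLp.toLp 2 (c, -1) : WithLp 2 (E × ℝ)), invStereo x⟫ =
      (1 + ‖c‖ ^ 2 - ‖x - c‖ ^ 2) / (1 + ‖x‖ ^ 2) := by
    rw [WithLp.prod_inner_apply]
    simp only [invStereo, real_inner_smul_right, RCLike.inner_apply, conj_trivial]
    rw [h4, real_inner_comm c x]
    field_simp
    ring
  rw [mirror_apply, norm_withLp_sq, h5]
  unfold invStereo
  rw [h2, h3, ← WithLp.toLp_smul, ← WithLp.toLp_sub, Prod.smul_mk, Prod.mk_sub_mk]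
  congr 2
  · rw [inversion, vsub_eq_sub, vadd_eq_add, dist_eq_norm, div_pow, Real.sq_sqrt (by positivity),
      neg_one_sq]
    have h6 : 2 / ((1 + ‖c‖ ^ 2) * (1 + ‖x‖ ^ 2) / ‖x - c‖ ^ 2) * ((1 + ‖c‖ ^ 2) / ‖x - c‖ ^ 2) =
      2 / (1 + ‖x‖ ^ 2) := by field_simp
    have h7 : 2 * ((1 + ‖c‖ ^ 2 - ‖x - c‖ ^ 2) / (1 + ‖x‖ ^ 2) / (‖c‖ ^ 2 + 1)) =
        2 / (1 + ‖x‖ ^ 2) - 2 / ((1 + ‖c‖ ^ 2) * (1 + ‖x‖ ^ 2) / ‖x - c‖ ^ 2) := by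
      field_simp
      ring
    rw [smul_add, smul_smul, h6, h7]
    module
  · rw [smul_eq_mul]
    field_simp
    ring

end Stereographic

section SphereMeasure

open Module EuclideanGeometry
open scoped RealInnerProductSpace ENNReal

variable (E : Type*) [NormedAddCommGroup E] [InnerProductSpace ℝ E] [FiniteDimensional ℝ E]
  [MeasurableSpace E] [BorelSpace E]

/-- The density of the conformal measure of the sphere in stereographic coordinates. -/
def sphereDensity (x : E) : ℝ := (1 + ‖x‖ ^ 2) ^ (-(finrank ℝ E : ℝ))

/-- The rotation invariant measure of the unit sphere of `E × ℝ`. -/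
def sphereMeasure : Measure (WithLp 2 (E × ℝ)) :=
  (volume.withDensity fun x : E => ENNReal.ofReal (sphereDensity E x)).map invStereo

variable {E}

omit [FiniteDimensional ℝ E] [MeasurableSpace E] [BorelSpace E] in
lemma sphereDensity_pos (x : E) : 0 < sphereDensity E x := by
  unfold sphereDensity; positivity

omit [FiniteDimensional ℝ E] [MeasurableSpace E] [BorelSpace E] in
lemma continuous_sphereDensity : Continuous (sphereDensity E) := by
  unfold sphereDensity
  exact Continuous.rpow_const (by fun_prop) fun x => Or.inl (by positivity)

lemma lintegral_sphereMeasure {F : WithLp 2 (E × ℝ) → ℝ≥0∞} (hF : Measurable F) :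
    ∫⁻ ξ, F ξ ∂sphereMeasure E =
      ∫⁻ x : E, ENNReal.ofReal (sphereDensity E x) * F (invStereo x) := by
  rw [sphereMeasure, lintegral_map hF continuous_invStereo.measurable]
  exact lintegral_withDensity_eq_lintegral_mul _
    (continuous_sphereDensity.measurable.ennreal_ofReal) (hF.comp continuous_invStereo.measurable)

lemma integral_sphereMeasure {F : WithLp 2 (E × ℝ) → ℝ} (hF : Measurable F) :
    ∫ ξ, F ξ ∂sphereMeasure E = ∫ x : E, sphereDensity E x * F (invStereo x) := by
  rw [sphereMeasure, integral_map continuous_invStereo.aemeasurable hF.aestronglyMeasurable,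
    integral_withDensity_eq_integral_toReal_smul
      (continuous_sphereDensity.measurable.ennreal_ofReal) (by simp)]
  simp only [ENNReal.toReal_ofReal (sphereDensity_pos _).le, smul_eq_mul]

lemma integrable_sphereMeasure {F : WithLp 2 (E × ℝ) → ℝ} (hF : Measurable F) :
    Integrable F (sphereMeasure E) ↔
      Integrable fun x : E => sphereDensity E x * F (invStereo x) := by
  rw [sphereMeasure, integrable_map_measure hF.aestronglyMeasurable
    continuous_invStereo.aemeasurable, integrable_withDensity_iff
      (continuous_sphereDensity.measurable.ennreal_ofReal) (by simp)]
  simp only [ENNReal.toReal_ofReal (sphereDensity_pos _).le, Function.comp_def, mul_comm]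

lemma ae_norm_eq_one : ∀ᵐ ξ ∂sphereMeasure E, ‖ξ‖ = 1 := by
  rw [sphereMeasure, ae_map_iff continuous_invStereo.aemeasurable
    (measurableSet_eq_fun measurable_norm measurable_const)]
  exact Eventually.of_forall norm_invStereo

variable [Nontrivial E]

lemma lintegral_mirror_invStereo (ν : WithLp 2 (E × ℝ)) (F : WithLp 2 (E × ℝ) → ℝ≥0∞) :
    ∫⁻ x : E, ENNReal.ofReal (sphereDensity E x) * F (mirror ν (invStereo x)) =
      ∫⁻ x : E, ENNReal.ofReal (sphereDensity E x) * F (invStereo x) := by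
  obtain ⟨⟨n, r⟩⟩ := ν
  rcases eq_or_ne r 0 with rfl | hr
  · simp_rw [mirror_invStereo_horizontal]
    have h := (mirror n).measurePreserving.lintegral_comp_emb
      (mirror n).toHomeomorph.measurableEmbedding
      (fun x => ENNReal.ofReal (sphereDensity E x) * F (invStereo x))
    rw [← h]
    simp only [sphereDensity, LinearIsometryEquiv.norm_map]
  · have h1 : (WithLp.toLp 2 (n, r) : WithLp 2 (E × ℝ)) =
        (-r) • WithLp.toLp 2 ((-r)⁻¹ • n, -1) := by
      rw [← WithLp.toLp_smul, Prod.smul_mk, smul_smul, mul_inv_cancel₀ (neg_ne_zero.2 hr), one_smul]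
      simp
    rw [h1, mirror_smul _ (neg_ne_zero.2 hr)]
    set c := (-r)⁻¹ • n
    have hR : √(1 + ‖c‖ ^ 2) ≠ 0 := by positivity
    have hcompl : ∀ G : E → ℝ≥0∞, ∫⁻ x, G x = ∫⁻ x in {c}ᶜ, G x := fun G => by
      rw [restrict_compl_singleton]
    have himg : inversion c √(1 + ‖c‖ ^ 2) '' {c}ᶜ = {c}ᶜ := by
      rw [Set.image_compl_eq (inversion_bijective c hR), Set.image_singleton, inversion_self]
    rw [hcompl, hcompl fun x => ENNReal.ofReal (sphereDensity E x) * F (invStereo x)]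
    conv_rhs => rw [← himg]
    rw [lintegral_image_eq_lintegral_abs_det_fderiv_mul volume (measurableSet_singleton c).compl
      (fun x hx => (hasFDerivAt_inversion hx).hasFDerivWithinAt) (inversion_injective c hR).injOn]
    refine setLIntegral_congr_fun (measurableSet_singleton c).compl fun x hx => ?_
    have hx : x ≠ c := hx
    have h0 : 0 < ‖x - c‖ := by simpa [sub_eq_zero] using hx
    rw [mirror_invStereo_inversion hx, ← mul_assoc, ← ENNReal.ofReal_mul (abs_nonneg _)]
    congr 2
    rw [sphereDensity, sphereDensity, one_add_norm_inversion_sq hx, ContinuousLinearMap.det,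
      ContinuousLinearMap.toLinearMap_smul, LinearMap.det_smul, dist_eq_norm]
    have h2 : |LinearMap.det ((((ℝ ∙ (x - c))ᗮ.reflection : E →L[ℝ] E)) : E →ₗ[ℝ] E)| = 1 := by
      refine Eq.trans (congrArg abs (ℝ ∙ (x - c))ᗮ.det_reflection) ?_
      rw [abs_pow, abs_neg, abs_one, one_pow]
    rw [abs_mul, h2, mul_one, abs_of_nonneg (by positivity), div_pow, Real.sq_sqrt (by positivity),
      Real.rpow_neg (by positivity), Real.rpow_neg (by positivity), Real.rpow_natCast,
      Real.rpow_natCast, div_pow, div_pow, mul_pow]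
    field_simp

lemma measurePreserving_mirror (ν : WithLp 2 (E × ℝ)) :
    MeasurePreserving (mirror ν) (sphereMeasure E) (sphereMeasure E) := by
  have hm : Measurable (mirror ν) := (mirror ν).continuous.measurable
  refine ⟨hm, Measure.ext fun s hs => ?_⟩
  rw [Measure.map_apply hm hs, ← lintegral_indicator_one hs, ← lintegral_indicator_one (hm hs),
    lintegral_sphereMeasure (measurable_one.indicator hs),
    lintegral_sphereMeasure (measurable_one.indicator (hm hs)),
    ← lintegral_mirror_invStereo ν (s.indicator 1)]
  rfl

end SphereMeasure

section KernelOperator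

variable {X : Type*} [MetricSpace X] [CompactSpace X] [MeasurableSpace X] [BorelSpace X]
  {Y : Type*} [MeasurableSpace Y] {μ : Measure Y} {k : X → Y → ℝ}

omit [CompactSpace X] [MeasurableSpace X] [BorelSpace X] in
lemma tendsto_integral_abs_sub (hm : ∀ x, Measurable (k x)) (h0 : ∀ x y, 0 ≤ k x y)
    (hi : ∀ x, Integrable (k x) μ) (hc : ∀ x x', ∫ y, k x y ∂μ = ∫ y, k x' y ∂μ)
    (hae : ∀ x, ∀ᵐ y ∂μ, ContinuousAt (fun x' => k x' y) x) (x : X) :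
    Tendsto (fun x' => ∫ y, |k x y - k x' y| ∂μ) (nhds x) (nhds 0) := by
  have h1 : ∀ x', ∫ y, |k x y - k x' y| ∂μ =
      2 * ∫ y, k x y ∂μ - 2 * ∫ y, min (k x y) (k x' y) ∂μ := fun x' => by
    have h2 : ∀ y, |k x y - k x' y| = (k x y + k x' y) - 2 * min (k x y) (k x' y) := fun y => by
      rcases le_total (k x y) (k x' y) with h | h
      · rw [min_eq_left h, abs_of_nonpos (sub_nonpos.2 h)]; ring
      · rw [min_eq_right h, abs_of_nonneg (sub_nonneg.2 h)]; ring
    simp_rw [h2]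
    have hmin : Integrable (fun y => min (k x y) (k x' y)) μ := (hi x).inf (hi x')
    have hadd : Integrable (fun y => k x y + k x' y) μ := (hi x).add (hi x')
    rw [integral_sub hadd (hmin.const_mul 2), integral_add (hi x) (hi x'), hc x' x,
      integral_const_mul]
    ring
  simp_rw [h1]
  have h3 : Tendsto (fun x' => ∫ y, min (k x y) (k x' y) ∂μ) (nhds x)
      (nhds (∫ y, k x y ∂μ)) := by
    refine tendsto_integral_filter_of_dominated_convergence (k x)
      (Eventually.of_forall fun x' => ((hm x).min (hm x')).aestronglyMeasurable)
      (Eventually.of_forall fun x' => Eventually.of_forall fun y => ?_) (hi x) ?_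
    · rw [Real.norm_eq_abs, abs_of_nonneg (le_min (h0 _ _) (h0 _ _))]
      exact min_le_left _ _
    · filter_upwards [hae x] with y hy
      have := (tendsto_const_nhds (x := k x y)).min hy.tendsto
      rwa [min_self] at this
  have := (tendsto_const_nhds (x := 2 * ∫ y, k x y ∂μ)).sub (h3.const_mul 2)
  rwa [sub_self] at this

/-- The integral operator with kernel `k`, acting on functions of `lev y`. -/
def kernelFun (μ : Measure Y) (k : X → Y → ℝ) (lev : Y → X) (w : C(X, ℝ)) (x : X) : ℝ :=
  ∫ y, k x y * w (lev y) ∂μ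

variable {lev : Y → X}

omit [MeasurableSpace X] [BorelSpace X] [MeasurableSpace Y] in
lemma abs_comp_le (w : C(X, ℝ)) (y : Y) : ‖w (lev y)‖ ≤ ‖w‖ := w.norm_coe_le_norm _

lemma integrable_kernel_mul (hlev : Measurable lev) {f : Y → ℝ} (hf : Integrable f μ)
    (w : C(X, ℝ)) :
    Integrable (fun y => f y * w (lev y)) μ :=
  hf.mul_bdd (w.continuous.measurable.comp hlev).aestronglyMeasurable
    (Eventually.of_forall (abs_comp_le w))

lemma abs_kernelFun_sub_le (hlev : Measurable lev) (hi : ∀ x, Integrable (k x) μ) (w : C(X, ℝ))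
    (x x' : X) : |kernelFun μ k lev w x - kernelFun μ k lev w x'| ≤
      ‖w‖ * ∫ y, |k x y - k x' y| ∂μ := by
  unfold kernelFun
  rw [← integral_sub (integrable_kernel_mul hlev (hi x) w) (integrable_kernel_mul hlev (hi x') w),
    ← integral_const_mul]
  refine (abs_integral_le_integral_abs).trans (integral_mono_of_nonneg
    (Eventually.of_forall fun y => abs_nonneg _) (((hi x).sub (hi x')).abs.const_mul _)
    (Eventually.of_forall fun y => ?_))
  change |k x y * w (lev y) - k x' y * w (lev y)| ≤ ‖w‖ * |k x y - k x' y|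
  rw [← sub_mul, abs_mul, mul_comm]
  exact mul_le_mul_of_nonneg_right (abs_comp_le w y) (abs_nonneg _)

omit [MeasurableSpace X] [BorelSpace X] in
lemma abs_kernelFun_le (h0 : ∀ x y, 0 ≤ k x y)
    (hi : ∀ x, Integrable (k x) μ) (w : C(X, ℝ)) (x : X) :
    |kernelFun μ k lev w x| ≤ (∫ y, k x y ∂μ) * ‖w‖ := by
  unfold kernelFun
  rw [← integral_mul_const]
  refine (abs_integral_le_integral_abs).trans (integral_mono_of_nonneg
    (Eventually.of_forall fun y => abs_nonneg _) ((hi x).mul_const _)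
    (Eventually.of_forall fun y => ?_))
  change |k x y * w (lev y)| ≤ k x y * ‖w‖
  rw [abs_mul, abs_of_nonneg (h0 _ _)]
  exact mul_le_mul_of_nonneg_left (abs_comp_le w y) (h0 _ _)

theorem exists_kernelOperator (hlev : Measurable lev) (hm : ∀ x, Measurable (k x))
    (h0 : ∀ x y, 0 ≤ k x y)
    (hi : ∀ x, Integrable (k x) μ) (hc : ∀ x x', ∫ y, k x y ∂μ = ∫ y, k x' y ∂μ)
    (hae : ∀ x, ∀ᵐ y ∂μ, ContinuousAt (fun x' => k x' y) x) :
    ∃ K : C(X, ℝ) →L[ℝ] C(X, ℝ), IsCompactOperator K ∧ (∀ u, 0 ≤ u → 0 ≤ K u) ∧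
      ∀ u x, K u x = kernelFun μ k lev u x := by
  rcases isEmpty_or_nonempty X with hX | ⟨⟨x₀⟩⟩
  · refine ⟨0, isCompactOperator_zero, fun u _ => le_rfl, fun u x => (hX.false x).elim⟩
  have hL := tendsto_integral_abs_sub hm h0 hi hc hae
  have hcont : ∀ f : X → ℝ, (∃ C : ℝ, ∀ x x', |f x - f x'| ≤ C * ∫ y, |k x y - k x' y| ∂μ) →
      Continuous f := by
    rintro f ⟨C, hC⟩
    refine continuous_iff_continuousAt.2 fun x => ?_
    rw [ContinuousAt, tendsto_iff_dist_tendsto_zero]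
    refine squeeze_zero (fun _ => dist_nonneg) (fun x' => ?_) (by simpa using (hL x).const_mul C)
    rw [dist_comm]
    exact hC x x'
  let T : C(X, ℝ) →ₗ[ℝ] C(X, ℝ) :=
    { toFun := fun w => ⟨kernelFun μ k lev w, hcont _ ⟨_, abs_kernelFun_sub_le hlev hi w⟩⟩
      map_add' := fun u v => by
        ext x
        change ∫ y, k x y * (u (lev y) + v (lev y)) ∂μ = _
        simp_rw [mul_add]
        exact integral_add (integrable_kernel_mul hlev (hi x) u)
          (integrable_kernel_mul hlev (hi x) v)
      map_smul' := fun r u => by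
        ext x
        change ∫ y, k x y * (r * u (lev y)) ∂μ = r * ∫ y, k x y * u (lev y) ∂μ
        simp_rw [mul_left_comm _ r]
        exact integral_const_mul _ _ }
  have hT : ∀ u x, T u x = kernelFun μ k lev u x := fun _ _ => rfl
  set M := ∫ y, k x₀ y ∂μ
  have hM : 0 ≤ M := integral_nonneg (h0 x₀)
  have hb : ∀ u, ‖T u‖ ≤ M * ‖u‖ := fun u =>
    (ContinuousMap.norm_le _ (by positivity)).2 fun x => by
      rw [hT]; exact (abs_kernelFun_le h0 hi u x).trans_eq (by rw [hc x x₀])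
  refine ⟨T.mkContinuous M hb, ?_, fun u hu x => integral_nonneg fun y =>
    mul_nonneg (h0 _ _) (hu (lev y)), fun u x => rfl⟩
  let S : Set C(X, ℝ) := {f | (∀ x, |f x| ≤ M) ∧
    ∀ x x', |f x - f x'| ≤ 1 * ∫ y, |k x y - k x' y| ∂μ}
  refine ⟨S, ArzelaAscoli.isCompact_of_equicontinuous S ?_ ?_, ?_⟩
  · have h1 : ContinuousMap.toFun '' S = (Set.univ.pi fun _ : X => Set.Icc (-M) M) ∩
        {f | ∀ x x', |f x - f x'| ≤ 1 * ∫ y, |k x y - k x' y| ∂μ} := by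
      ext f
      constructor
      · rintro ⟨f, ⟨h1, h2⟩, rfl⟩
        exact ⟨fun x _ => abs_le.1 (h1 x), h2⟩
      · rintro ⟨h1, h2⟩
        exact ⟨⟨f, hcont f ⟨1, h2⟩⟩, ⟨fun x => abs_le.2 (h1 x trivial), h2⟩, rfl⟩
    rw [h1]
    refine (isCompact_univ_pi fun _ => isCompact_Icc).inter_right ?_
    simp only [Set.ofPred_forall]
    refine isClosed_iInter fun x => isClosed_iInter fun x' => isClosed_le ?_ continuous_const
    exact ((continuous_apply x).sub (continuous_apply x')).abs
  · intro x
    rw [Metric.equicontinuousAt_iff]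
    intro ε hε
    obtain ⟨δ, hδ, h⟩ := Metric.eventually_nhds_iff.1 ((hL x).eventually (gt_mem_nhds hε))
    refine ⟨δ, hδ, fun x' hx' f => ?_⟩
    refine (f.2.2 x x').trans_lt ?_
    rw [one_mul]
    exact h hx'
  · filter_upwards [Metric.closedBall_mem_nhds (0 : C(X, ℝ)) one_pos] with u hu
    have hu : ‖u‖ ≤ 1 := by simpa using hu
    refine ⟨fun x => ((T u).norm_coe_le_norm x).trans ((hb u).trans (by nlinarith)), fun x x' => ?_⟩
    refine (abs_kernelFun_sub_le hlev hi u x x').trans ?_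
    exact mul_le_mul_of_nonneg_right hu (integral_nonneg fun y => abs_nonneg _)

end KernelOperator

section Chord

open Module
open scoped RealInnerProductSpace ENNReal

variable {E : Type*} [NormedAddCommGroup E] [InnerProductSpace ℝ E] [FiniteDimensional ℝ E]
  [MeasurableSpace E] [BorelSpace E]

lemma integrable_pole {b : ℝ} (hb : b < finrank ℝ E) :
    Integrable (fun η => ‖(WithLp.toLp 2 (0, 1) : WithLp 2 (E × ℝ)) - η‖ ^ (-b))
      (sphereMeasure E) := by
  rw [integrable_sphereMeasure (by fun_prop)]
  have h := (integrable_rpow_neg_one_add_norm_sq (E := E) (μ := volume)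
    (r := 2 * finrank ℝ E - b) (by linarith)).const_mul (4 ^ (-b / 2))
  refine h.congr (Eventually.of_forall fun x => ?_)
  have hx : (0 : ℝ) < 1 + ‖x‖ ^ 2 := by positivity
  have h2 : ‖(WithLp.toLp 2 (0, 1) : WithLp 2 (E × ℝ)) - invStereo x‖ ^ (-b) =
      (4 / (1 + ‖x‖ ^ 2)) ^ (-b / 2) := by
    rw [← norm_sub_pole_sq, ← Real.rpow_natCast, ← Real.rpow_mul (norm_nonneg _)]
    congr 1
    push_cast
    ring
  beta_reduce
  rw [h2, sphereDensity, Real.div_rpow (by norm_num) hx.le, mul_div_left_comm, ← Real.rpow_sub hx]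
  congr 2
  ring

variable [Nontrivial E]

instance : IsFiniteMeasure (sphereMeasure E) := by
  have h := integrable_pole (E := E) (b := 0) (by exact_mod_cast finrank_pos)
  simp only [neg_zero, Real.rpow_zero] at h
  exact (integrable_const_iff_isFiniteMeasure one_ne_zero).1 h

lemma sphereMeasure_singleton (ξ : WithLp 2 (E × ℝ)) : sphereMeasure E {ξ} = 0 := by
  rw [sphereMeasure, Measure.map_apply continuous_invStereo.measurable (measurableSet_singleton ξ)]
  refine withDensity_absolutelyContinuous _ _ (Set.Subsingleton.measure_zero ?_ _)
  intro x hx y hy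
  have h := norm_invStereo_sub_sq x y
  rw [Set.mem_singleton_iff.1 hx, Set.mem_singleton_iff.1 hy, sub_self, norm_zero] at h
  have h1 : 0 < 1 + ‖x‖ ^ 2 := by positivity
  have h2 : 0 < 1 + ‖y‖ ^ 2 := by positivity
  have h3 : ‖x - y‖ ^ 2 = 0 := by
    field_simp at h
    linarith
  exact sub_eq_zero.1 (norm_eq_zero.1 (pow_eq_zero_iff two_ne_zero |>.1 h3))

lemma ae_ne (ξ : WithLp 2 (E × ℝ)) : ∀ᵐ η ∂sphereMeasure E, η ≠ ξ :=
  compl_mem_ae_iff.2 (sphereMeasure_singleton ξ)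

lemma integral_norm_sub_eq (G : ℝ → ℝ) {ξ ζ : WithLp 2 (E × ℝ)} (h : ‖ξ‖ = ‖ζ‖) :
    ∫ η, G ‖ξ - η‖ ∂sphereMeasure E = ∫ η, G ‖ζ - η‖ ∂sphereMeasure E := by
  rw [← (measurePreserving_mirror (ζ - ξ)).integral_comp
    (mirror (ζ - ξ)).toHomeomorph.measurableEmbedding (fun η => G ‖ξ - η‖)]
  refine integral_congr_ae (Eventually.of_forall fun η => ?_)
  have h1 : mirror (ζ - ξ) ζ = ξ := Submodule.reflection_sub h.symm
  beta_reduce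
  rw [← LinearIsometryEquiv.norm_map (mirror (ζ - ξ)) (ζ - η), map_sub, h1]

lemma integrable_chord {b : ℝ} (hb : b < finrank ℝ E) {ξ : WithLp 2 (E × ℝ)} (hξ : ‖ξ‖ = 1) :
    Integrable (fun η => ‖ξ - η‖ ^ (-b)) (sphereMeasure E) := by
  have hp : ‖(WithLp.toLp 2 (0, 1) : WithLp 2 (E × ℝ))‖ = 1 := by
    have h := norm_withLp_sq (0 : E) 1
    rw [norm_zero] at h
    exact (pow_eq_one_iff_of_nonneg (norm_nonneg _) two_ne_zero).1 (by rw [h]; norm_num)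
  set ζ : WithLp 2 (E × ℝ) := WithLp.toLp 2 (0, 1)
  have h1 : mirror (ζ - ξ) ζ = ξ := Submodule.reflection_sub (by rw [hp, hξ])
  have h := integrable_pole hb
  rw [← (measurePreserving_mirror (ζ - ξ)).integrable_comp_emb
    (mirror (ζ - ξ)).toHomeomorph.measurableEmbedding]
  refine h.congr (Eventually.of_forall fun η => ?_)
  change ‖ζ - η‖ ^ (-b) = ‖ξ - mirror (ζ - ξ) η‖ ^ (-b)
  rw [← LinearIsometryEquiv.norm_map (mirror (ζ - ξ)) (ζ - η), map_sub, h1]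

lemma exists_small_cap {b : ℝ} (hb : b < finrank ℝ E) {δ : ℝ} (hδ : 0 < δ) :
    ∃ ε : ℝ, 0 < ε ∧ ∀ ξ : WithLp 2 (E × ℝ), ‖ξ‖ = 1 →
      ∫ η, (if ‖ξ - η‖ < ε then ‖ξ - η‖ ^ (-b) else 0) ∂sphereMeasure E < δ := by
  obtain ⟨x₀⟩ : Nonempty E := inferInstance
  set ζ := invStereo x₀
  have hζ : ‖ζ‖ = 1 := norm_invStereo x₀
  have h : Tendsto (fun ε : ℝ => ∫ η, (if ‖ζ - η‖ < ε then ‖ζ - η‖ ^ (-b) else 0) ∂sphereMeasure E)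
      (nhdsWithin 0 (Set.Ioi 0)) (nhds (∫ η, 0 ∂sphereMeasure E)) := by
    refine tendsto_integral_filter_of_dominated_convergence (fun η => ‖ζ - η‖ ^ (-b))
      (Eventually.of_forall fun ε => ?_) (Eventually.of_forall fun ε => Eventually.of_forall
        fun η => ?_) (integrable_chord hb hζ) ?_
    · exact (Measurable.ite (measurableSet_lt (by fun_prop) measurable_const) (by fun_prop)
        measurable_const).aestronglyMeasurable
    · have : 0 ≤ ‖ζ - η‖ ^ (-b) := by positivity
      split_ifs
      · rw [Real.norm_eq_abs, abs_of_nonneg this]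
      · rwa [norm_zero]
    · filter_upwards [ae_ne ζ] with η hη
      have h0 : 0 < ‖ζ - η‖ := norm_pos_iff.2 (sub_ne_zero.2 (Ne.symm hη))
      refine tendsto_const_nhds.congr' ?_
      filter_upwards [mem_nhdsWithin_of_mem_nhds (gt_mem_nhds h0)] with ε hε
      rw [if_neg (not_lt.2 (le_of_lt hε))]
  rw [integral_zero] at h
  obtain ⟨ε, h1, h2⟩ := ((h.eventually (gt_mem_nhds hδ)).and self_mem_nhdsWithin).exists
  refine ⟨ε, h2, fun ξ hξ => ?_⟩
  rwa [integral_norm_sub_eq (fun r => if r < ε then r ^ (-b) else 0) (hξ.trans hζ.symm)]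

end Chord

section Level

open scoped RealInnerProductSpace

variable {V : Type*} [NormedAddCommGroup V] [InnerProductSpace ℝ V] {e : Fin 4 → V}

/-- The squared length of the projection of `η` to the plane of `e 0` and `e 1`, truncated to
`[0, 1]`. -/
def level (e : Fin 4 → V) (η : V) : Set.Icc (0 : ℝ) 1 :=
  Set.projIcc 0 1 zero_le_one (⟪e 0, η⟫ ^ 2 + ⟪e 1, η⟫ ^ 2)

/-- A section of `level`. -/
def levelPoint (e : Fin 4 → V) (τ : Set.Icc (0 : ℝ) 1) : V :=
  √(τ : ℝ) • e 0 + √(1 - (τ : ℝ)) • e 2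

lemma continuous_level : Continuous (level e) := by
  unfold level
  exact continuous_projIcc.comp (by fun_prop)

lemma continuous_levelPoint : Continuous (levelPoint e) := by
  unfold levelPoint
  fun_prop

lemma inner_basis (he : Orthonormal ℝ e) (i j : Fin 4) : ⟪e i, e j⟫ = if i = j then 1 else 0 :=
  orthonormal_iff_ite.1 he i j

lemma bessel (he : Orthonormal ℝ e) (η : V) :
    ⟪e 0, η⟫ ^ 2 + ⟪e 1, η⟫ ^ 2 + ⟪e 2, η⟫ ^ 2 + ⟪e 3, η⟫ ^ 2 ≤ ‖η‖ ^ 2 := by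
  have h := he.sum_inner_products_le (x := η) (s := Finset.univ)
  simp only [Fin.sum_univ_four, Real.norm_eq_abs, sq_abs] at h
  exact h

lemma coe_level (he : Orthonormal ℝ e) {η : V} (hη : ‖η‖ = 1) :
    (level e η : ℝ) = ⟪e 0, η⟫ ^ 2 + ⟪e 1, η⟫ ^ 2 := by
  have h := bessel he η
  rw [hη, one_pow] at h
  rw [level, Set.projIcc_of_mem zero_le_one (x := ⟪e 0, η⟫ ^ 2 + ⟪e 1, η⟫ ^ 2)
    ⟨by positivity, by nlinarith [sq_nonneg ⟪e 2, η⟫, sq_nonneg ⟪e 3, η⟫]⟩]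

lemma norm_levelPoint (he : Orthonormal ℝ e) (τ : Set.Icc (0 : ℝ) 1) : ‖levelPoint e τ‖ = 1 := by
  have h : ‖levelPoint e τ‖ ^ 2 = 1 := by
    rw [← real_inner_self_eq_norm_sq, levelPoint]
    simp only [inner_add_left, inner_add_right, real_inner_smul_left, real_inner_smul_right,
      inner_basis he]
    have h1 := Real.mul_self_sqrt τ.2.1
    have h2 := Real.mul_self_sqrt (sub_nonneg.2 τ.2.2)
    simp only [Fin.isValue, ↓reduceIte, mul_one, Fin.reduceEq, mul_zero]
    linarith
  exact (pow_eq_one_iff_of_nonneg (norm_nonneg _) two_ne_zero).1 h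

lemma level_levelPoint (he : Orthonormal ℝ e) (τ : Set.Icc (0 : ℝ) 1) :
    level e (levelPoint e τ) = τ := by
  apply Subtype.ext
  rw [coe_level he (norm_levelPoint he τ), levelPoint]
  simp only [inner_add_right, real_inner_smul_right, inner_basis he]
  simp [Real.sq_sqrt τ.2.1]

lemma mirror_of_inner_eq_zero {ν v : V} (h : ⟪ν, v⟫ = 0) : mirror ν v = v := by
  rw [mirror_apply, h]
  simp

lemma inner_mirror_of_inner_eq_zero {ν v : V} (h : ⟪ν, v⟫ = 0) (w : V) :
    ⟪v, mirror ν w⟫ = ⟪v, w⟫ := by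
  conv_lhs => rw [← mirror_of_inner_eq_zero h, LinearIsometryEquiv.inner_map_map]

lemma level_mirror_of_orthogonal {ν : V} (h0 : ⟪ν, e 0⟫ = 0) (h1 : ⟪ν, e 1⟫ = 0) (η : V) :
    level e (mirror ν η) = level e η := by
  rw [level, level, inner_mirror_of_inner_eq_zero h0, inner_mirror_of_inner_eq_zero h1]

lemma level_mirror_of_mem (he : Orthonormal ℝ e) {ν : V} (α β : ℝ) (hν : ν = α • e 0 + β • e 1)
    (η : V) : level e (mirror ν η) = level e η := by
  have hn : ‖ν‖ ^ 2 = α ^ 2 + β ^ 2 := by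
    rw [← real_inner_self_eq_norm_sq, hν]
    simp only [inner_add_left, inner_add_right, real_inner_smul_left, real_inner_smul_right,
      inner_basis he]
    simp
    ring
  by_cases h0 : ν = 0
  · rw [mirror_of_inner_eq_zero (by rw [h0, inner_zero_left])]
  have hpos : 0 < α ^ 2 + β ^ 2 := by rw [← hn]; positivity
  rw [level, level]
  congr 1
  rw [mirror_apply]
  have h3 : ⟪ν, η⟫ = α * ⟪e 0, η⟫ + β * ⟪e 1, η⟫ := by
    rw [hν, inner_add_left, real_inner_smul_left, real_inner_smul_left]
  have h4 : ⟪e 0, ν⟫ = α := by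
    rw [hν, inner_add_right, real_inner_smul_right, real_inner_smul_right, inner_basis he,
      inner_basis he]
    simp
  have h5 : ⟪e 1, ν⟫ = β := by
    rw [hν, inner_add_right, real_inner_smul_right, real_inner_smul_right, inner_basis he,
      inner_basis he]
    simp
  rw [inner_sub_right, inner_sub_right, real_inner_smul_right, real_inner_smul_right, h3, h4, h5,
    hn]
  field_simp
  ring

lemma exists_mirror_levelPoint (he : Orthonormal ℝ e) {ξ : V} (hξ : ‖ξ‖ = 1) :
    ∃ ν₁ ν₂ : V, mirror ν₂ (mirror ν₁ ξ) = levelPoint e (level e ξ) ∧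
      (∀ η, level e (mirror ν₁ η) = level e η) ∧ ∀ η, level e (mirror ν₂ η) = level e η := by
  set τ := level e ξ
  have hτ : (τ : ℝ) = ⟪e 0, ξ⟫ ^ 2 + ⟪e 1, ξ⟫ ^ 2 := coe_level he hξ
  set q : V := ⟪e 0, ξ⟫ • e 0 + ⟪e 1, ξ⟫ • e 1 with hq
  set r : V := ξ - q with hr
  have hrq : ξ = q + r := by rw [hr]; abel
  have h0 : ⟪e 0, r⟫ = 0 := by
    rw [hr, hq, inner_sub_right, inner_add_right, real_inner_smul_right, real_inner_smul_right,
      inner_basis he, inner_basis he]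
    simp
  have h1 : ⟪e 1, r⟫ = 0 := by
    rw [hr, hq, inner_sub_right, inner_add_right, real_inner_smul_right, real_inner_smul_right,
      inner_basis he, inner_basis he]
    simp
  have hqq : ‖q‖ ^ 2 = τ := by
    rw [← real_inner_self_eq_norm_sq, hq]
    simp only [inner_add_left, inner_add_right, real_inner_smul_left, real_inner_smul_right,
      inner_basis he]
    simp
    rw [hτ]
    ring
  have hqr : ⟪q, r⟫ = 0 := by
    rw [hq, inner_add_left, real_inner_smul_left, real_inner_smul_left, h0, h1]
    simp
  have hrr : ‖r‖ ^ 2 = 1 - τ := by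
    have h := norm_add_sq_real q r
    rw [← hrq, hξ, hqr, hqq] at h
    linarith
  have hnq : ‖q‖ = ‖√(τ : ℝ) • e 0‖ := by
    rw [norm_smul, he.1 0, mul_one, Real.norm_of_nonneg (Real.sqrt_nonneg _), ← hqq,
      Real.sqrt_sq (norm_nonneg _)]
  have hnr : ‖r‖ = ‖√(1 - (τ : ℝ)) • e 2‖ := by
    rw [norm_smul, he.1 2, mul_one, Real.norm_of_nonneg (Real.sqrt_nonneg _), ← hrr,
      Real.sqrt_sq (norm_nonneg _)]
  refine ⟨q - √(τ : ℝ) • e 0, r - √(1 - (τ : ℝ)) • e 2, ?_, fun η => ?_, fun η => ?_⟩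
  · have h2 : mirror (q - √(τ : ℝ) • e 0) q = √(τ : ℝ) • e 0 := Submodule.reflection_sub hnq
    have h3 : mirror (q - √(τ : ℝ) • e 0) r = r := mirror_of_inner_eq_zero (by
      rw [inner_sub_left, real_inner_smul_left, hqr, h0, mul_zero, sub_zero])
    have h4 : mirror (r - √(1 - (τ : ℝ)) • e 2) r = √(1 - (τ : ℝ)) • e 2 :=
      Submodule.reflection_sub hnr
    have h5 : mirror (r - √(1 - (τ : ℝ)) • e 2) (√(τ : ℝ) • e 0) = √(τ : ℝ) • e 0 :=
      mirror_of_inner_eq_zero (by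
        rw [inner_sub_left, real_inner_smul_left, real_inner_smul_right, real_inner_smul_right,
          real_inner_comm, h0, inner_basis he]
        simp)
    rw [hrq, map_add, h2, h3, map_add, h4, h5, levelPoint]
  · exact level_mirror_of_mem he (⟪e 0, ξ⟫ - √(τ : ℝ)) ⟪e 1, ξ⟫ (by rw [hq, sub_smul]; abel) η
  · refine level_mirror_of_orthogonal ?_ ?_ η
    · rw [inner_sub_left, real_inner_smul_left, real_inner_comm, h0, inner_basis he]
      simp
    · rw [inner_sub_left, real_inner_smul_left, real_inner_comm, h1, inner_basis he]
      simp

end Level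

section LevelIntegral

open Module
open scoped RealInnerProductSpace ENNReal

variable {E : Type*} [NormedAddCommGroup E] [InnerProductSpace ℝ E] [FiniteDimensional ℝ E]
  [MeasurableSpace E] [BorelSpace E] [Nontrivial E] {e : Fin 4 → WithLp 2 (E × ℝ)}

lemma integral_chord_level (he : Orthonormal ℝ e) (g w : _ → ℝ) {ξ : WithLp 2 (E × ℝ)}
    (hξ : ‖ξ‖ = 1) :
    ∫ η, g ‖ξ - η‖ * w (level e η) ∂sphereMeasure E =
      ∫ η, g ‖levelPoint e (level e ξ) - η‖ * w (level e η) ∂sphereMeasure E := by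
  obtain ⟨ν₁, ν₂, h, h1, h2⟩ := exists_mirror_levelPoint he hξ
  rw [← h, ← (measurePreserving_mirror ν₂).integral_comp
      (mirror ν₂).toHomeomorph.measurableEmbedding
      (fun η => g ‖mirror ν₂ (mirror ν₁ ξ) - η‖ * w (level e η)),
    ← (measurePreserving_mirror ν₁).integral_comp
      (mirror ν₁).toHomeomorph.measurableEmbedding]
  refine integral_congr_ae (Eventually.of_forall fun η => ?_)
  beta_reduce
  rw [← map_sub, LinearIsometryEquiv.norm_map, h2, h1,
    ← LinearIsometryEquiv.norm_map (mirror ν₁) (ξ - mirror ν₁ η), map_sub,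
    Submodule.reflection_reflection]

lemma sphereMeasure_pos {O : Set (WithLp 2 (E × ℝ))} (hO : IsOpen O) {ξ : WithLp 2 (E × ℝ)}
    (hξ : ‖ξ‖ = 1) (hm : ξ ∈ O) : 0 < sphereMeasure E O := by
  obtain ⟨x₀⟩ : Nonempty E := inferInstance
  set ζ := invStereo x₀
  have h1 : mirror (ζ - ξ) ζ = ξ := Submodule.reflection_sub (by rw [hξ, norm_invStereo])
  rw [← (measurePreserving_mirror (ζ - ξ)).measure_preimage hO.measurableSet.nullMeasurableSet,
    sphereMeasure, Measure.map_apply continuous_invStereo.measurable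
      (hO.preimage (mirror (ζ - ξ)).continuous).measurableSet,
    withDensity_apply _ ((hO.preimage (mirror (ζ - ξ)).continuous).preimage
      continuous_invStereo).measurableSet, pos_iff_ne_zero, Ne, setLIntegral_eq_zero_iff
      ((hO.preimage (mirror (ζ - ξ)).continuous).preimage continuous_invStereo).measurableSet
      (by have := continuous_sphereDensity (E := E); fun_prop)]
  intro h
  have h3 : volume (invStereo ⁻¹' (mirror (ζ - ξ) ⁻¹' O) : Set E) = 0 := by
    refine measure_mono_null ?_ (ae_iff.1 h)
    intro x hx
    simpa using And.intro hx (sphereDensity_pos x)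
  exact (((hO.preimage (mirror (ζ - ξ)).continuous).preimage continuous_invStereo).measure_pos
    volume ⟨x₀, by change mirror (ζ - ξ) ζ ∈ O; rwa [h1]⟩).ne' h3

/-- The law of `level e` under `sphereMeasure E`. -/
def levelMeasure (e : Fin 4 → WithLp 2 (E × ℝ)) : Measure (Set.Icc (0 : ℝ) 1) :=
  (sphereMeasure E).map (level e)

instance : IsFiniteMeasure (levelMeasure e) := by unfold levelMeasure; infer_instance

lemma isOpenPosMeasure_levelMeasure (he : Orthonormal ℝ e) :
    (levelMeasure e).IsOpenPosMeasure := by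
  refine ⟨fun O hO ⟨τ, hτ⟩ => ?_⟩
  rw [levelMeasure, Measure.map_apply continuous_level.measurable hO.measurableSet]
  exact (sphereMeasure_pos (hO.preimage continuous_level) (norm_levelPoint he τ)
    (by rwa [Set.mem_preimage, level_levelPoint he])).ne'

omit [Nontrivial E] in
lemma integral_levelMeasure {f : Set.Icc (0 : ℝ) 1 → ℝ} (hf : Continuous f) :
    ∫ τ, f τ ∂levelMeasure e = ∫ η, f (level e η) ∂sphereMeasure E :=
  integral_map continuous_level.measurable.aemeasurable hf.aestronglyMeasurable

end LevelIntegral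

section SinIntegral

open scoped ENNReal

lemma abs_sin_rpow_le {x : ℝ} (h0 : 0 < x) (h1 : x < π) :
    |sin x| ^ (-(1 / 2) : ℝ) ≤
      (2 / π) ^ (-(1 / 2) : ℝ) * (x ^ (-(1 / 2) : ℝ) + (π - x) ^ (-(1 / 2) : ℝ)) := by
  have hs : 0 < sin x := sin_pos_of_pos_of_lt_pi h0 h1
  rw [abs_of_pos hs]
  have hc : (0 : ℝ) < 2 / π := by positivity
  have h3 : (0 : ℝ) ≤ (2 / π) ^ (-(1 / 2) : ℝ) := by positivity
  rcases le_total x (π / 2) with h | h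
  · have h2 := mul_le_sin h0.le h
    refine (Real.rpow_le_rpow_of_nonpos (by positivity) h2 (by norm_num)).trans ?_
    rw [Real.mul_rpow hc.le h0.le]
    refine mul_le_mul_of_nonneg_left (le_add_of_nonneg_right ?_) h3
    exact Real.rpow_nonneg (sub_nonneg.2 h1.le) _
  · have h2 := mul_le_sin (x := π - x) (by linarith) (by linarith)
    rw [sin_pi_sub] at h2
    have h4 : 0 < π - x := sub_pos.2 h1
    refine (Real.rpow_le_rpow_of_nonpos (by positivity) h2 (by norm_num)).trans ?_
    rw [Real.mul_rpow hc.le h4.le]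
    exact mul_le_mul_of_nonneg_left (le_add_of_nonneg_left (by positivity)) h3

lemma intervalIntegrable_abs_sin_rpow (a b : ℝ) :
    IntervalIntegrable (fun x => |sin x| ^ (-(1 / 2) : ℝ)) volume a b := by
  have hper : Function.Periodic (fun x => |sin x| ^ (-(1 / 2) : ℝ)) π := fun x => by
    simp only [sin_add_pi, abs_neg]
  refine hper.intervalIntegrable₀ pi_pos.ne' ?_ a b
  have h1 : IntervalIntegrable (fun x : ℝ => x ^ (-(1 / 2) : ℝ)) volume 0 π :=
    intervalIntegral.intervalIntegrable_rpow' (by norm_num)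
  have h2 : IntervalIntegrable (fun x : ℝ => (π - x) ^ (-(1 / 2) : ℝ)) volume 0 π := by
    have := (h1.comp_sub_left π).symm
    simpa using this
  have h3 := (h1.add h2).const_mul ((2 / π) ^ (-(1 / 2) : ℝ))
  rw [intervalIntegrable_iff_integrableOn_Ioo_of_le pi_pos.le] at h3 ⊢
  refine Integrable.mono' h3 (Measurable.aestronglyMeasurable (by fun_prop)) ?_
  filter_upwards [ae_restrict_mem measurableSet_Ioo] with x hx
  rw [Real.norm_of_nonneg (by positivity)]
  exact abs_sin_rpow_le hx.1 hx.2

lemma lintegral_abs_sin_rpow (ψ : ℝ) :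
    ∫⁻ φ in Set.Ioc 0 π, ENNReal.ofReal (|sin (2 * φ - ψ)| ^ (-(1 / 2) : ℝ)) =
      ENNReal.ofReal (∫ x in 0..π, |sin x| ^ (-(1 / 2) : ℝ)) := by
  have hper : Function.Periodic (fun x => |sin x| ^ (-(1 / 2) : ℝ)) π := fun x => by
    simp only [sin_add_pi, abs_neg]
  have h1 : ∫ φ in 0..π, |sin (2 * φ - ψ)| ^ (-(1 / 2) : ℝ) =
      ∫ x in 0..π, |sin x| ^ (-(1 / 2) : ℝ) := by
    rw [intervalIntegral.integral_comp_mul_sub (fun x => |sin x| ^ (-(1 / 2) : ℝ)) two_ne_zero ψ]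
    rw [← intervalIntegral.integral_add_adjacent_intervals
      (intervalIntegrable_abs_sin_rpow (2 * 0 - ψ) (-ψ + π))
      (intervalIntegrable_abs_sin_rpow (-ψ + π) _)]
    have h2 := hper.intervalIntegral_add_eq (-ψ) 0
    have h3 := hper.intervalIntegral_add_eq (-ψ + π) 0
    rw [zero_add] at h2 h3
    rw [show 2 * 0 - ψ = -ψ by ring, h2, show 2 * π - ψ = -ψ + π + π by ring, h3, smul_eq_mul]
    ring
  rw [← h1, intervalIntegral.integral_of_le pi_pos.le, ofReal_integral_eq_lintegral_ofReal]
  · have h3 := ((intervalIntegrable_abs_sin_rpow (-ψ) (2 * π - ψ)).comp_sub_right ψ).comp_mul_left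
      (c := 2)
    simp only [neg_add_cancel, zero_div, sub_add_cancel, mul_div_cancel_left₀ π two_ne_zero] at h3
    exact (intervalIntegrable_iff_integrableOn_Ioc_of_le pi_pos.le).1 h3
  · exact Eventually.of_forall fun x => by positivity

end SinIntegral

section Averaging

open Module
open scoped RealInnerProductSpace ENNReal

lemma exists_abs_sin_le_norm_sub {V : Type*} [NormedAddCommGroup V] [InnerProductSpace ℝ V]
    {f₀ f₁ ξ : V} (h0 : ‖f₀‖ = 1) (h1 : ‖f₁‖ = 1) (h01 : ⟪f₀, f₁⟫ = 0) {ρ : ℝ} (hρ : 0 ≤ ρ)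
    (hξ0 : ⟪f₀, ξ⟫ = ρ) (hξ1 : ⟪f₁, ξ⟫ = 0) (η : V) :
    ∃ ψ : ℝ, ∀ φ : ℝ, ρ * |sin (2 * φ - ψ)| ≤ ‖mirror (cos φ • f₀ + sin φ • f₁) ξ - η‖ := by
  set z : ℂ := ⟨⟪f₀, η⟫, ⟪f₁, η⟫⟩
  have hre : ‖z‖ * cos z.arg = ⟪f₀, η⟫ := Complex.norm_mul_cos_arg z
  have him : ‖z‖ * sin z.arg = ⟪f₁, η⟫ := Complex.norm_mul_sin_arg z
  refine ⟨z.arg, fun φ => ?_⟩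
  set ψ := z.arg
  have h10 : ⟪f₁, f₀⟫ = 0 := by rw [real_inner_comm, h01]
  have h00 : ⟪f₀, f₀⟫ = 1 := by rw [real_inner_self_eq_norm_sq, h0, one_pow]
  have h11 : ⟪f₁, f₁⟫ = 1 := by rw [real_inner_self_eq_norm_sq, h1, one_pow]
  have hunit : ∀ a b : ℝ, a ^ 2 + b ^ 2 = 1 → ‖a • f₀ + b • f₁‖ ^ 2 = 1 := fun a b hab => by
    rw [← real_inner_self_eq_norm_sq]
    simp only [inner_add_left, inner_add_right, real_inner_smul_left, real_inner_smul_right,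
      h10, h00, h11, h01]
    linarith
  set t : V := (-sin ψ) • f₀ + cos ψ • f₁ with ht
  have htn : ‖t‖ = 1 := (pow_eq_one_iff_of_nonneg (norm_nonneg _) two_ne_zero).1
    (hunit _ _ (by rw [neg_sq, sin_sq_add_cos_sq]))
  have h2 : ⟪t, mirror (cos φ • f₀ + sin φ • f₁) ξ - η⟫ = -(ρ * sin (2 * φ - ψ)) := by
    rw [mirror_apply, hunit _ _ (cos_sq_add_sin_sq φ), ht]
    simp only [inner_add_left, inner_add_right, inner_sub_right, real_inner_smul_left,
      real_inner_smul_right, h10, h00, h11, h01, hξ0, hξ1, ← hre, ← him]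
    rw [sin_sub, sin_two_mul, cos_two_mul]
    ring
  have h3 := abs_real_inner_le_norm t (mirror (cos φ • f₀ + sin φ • f₁) ξ - η)
  rwa [h2, htn, one_mul, abs_neg, abs_mul, abs_of_nonneg hρ] at h3

lemma inner_levelPoint {V : Type*} [NormedAddCommGroup V] [InnerProductSpace ℝ V] {e : Fin 4 → V}
    (he : Orthonormal ℝ e) (i : Fin 4) (τ : Set.Icc (0 : ℝ) 1) :
    ⟪e i, levelPoint e τ⟫ = √(τ : ℝ) * (if i = 0 then 1 else 0) +
      √(1 - (τ : ℝ)) * (if i = 2 then 1 else 0) := by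
  rw [levelPoint, inner_add_right, real_inner_smul_right, real_inner_smul_right, inner_basis he,
    inner_basis he]

lemma ae_sin_ne_zero (ψ : ℝ) : ∀ᵐ φ : ℝ, sin (2 * φ - ψ) ≠ 0 := by
  refine compl_mem_ae_iff.2 (Set.Countable.measure_zero ((Set.countable_range
    fun n : ℤ => (n * π + ψ) / 2).mono fun φ hφ => ?_) _)
  obtain ⟨n, hn⟩ := sin_eq_zero_iff.1 (hφ : sin (2 * φ - ψ) = 0)
  exact ⟨n, by simp only [hn]; ring⟩

variable {E : Type*} [NormedAddCommGroup E] [InnerProductSpace ℝ E] [FiniteDimensional ℝ E]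
  [MeasurableSpace E] [BorelSpace E] [Nontrivial E] {e : Fin 4 → WithLp 2 (E × ℝ)}

lemma lintegral_chord_le_of_mirror {f₀ f₁ ξ : WithLp 2 (E × ℝ)} (h0 : ‖f₀‖ = 1) (h1 : ‖f₁‖ = 1)
    (h01 : ⟪f₀, f₁⟫ = 0) {ρ : ℝ} (hρ : 1 / 2 ≤ ρ) (hξ0 : ⟪f₀, ξ⟫ = ρ) (hξ1 : ⟪f₁, ξ⟫ = 0)
    (hlev : ∀ φ η, level e (mirror (cos φ • f₀ + sin φ • f₁) η) = level e η)
    {G : Set.Icc (0 : ℝ) 1 → ℝ≥0∞} (hG : Measurable G) :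
    ENNReal.ofReal π * ∫⁻ η, ENNReal.ofReal (‖ξ - η‖ ^ (-(1 / 2) : ℝ)) * G (level e η)
        ∂sphereMeasure E ≤
      ENNReal.ofReal ((1 / 2) ^ (-(1 / 2) : ℝ) * ∫ x in 0..π, |sin x| ^ (-(1 / 2) : ℝ)) *
        ∫⁻ η, G (level e η) ∂sphereMeasure E := by
  have hρ0 : 0 < ρ := by linarith
  have hunit : ∀ φ : ℝ, ‖cos φ • f₀ + sin φ • f₁‖ ^ 2 = 1 := fun φ => by
    rw [← real_inner_self_eq_norm_sq]
    simp only [inner_add_left, inner_add_right, real_inner_smul_left, real_inner_smul_right]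
    rw [real_inner_self_eq_norm_sq, real_inner_self_eq_norm_sq, h0, h1, real_inner_comm, h01]
    nlinarith [cos_sq_add_sin_sq φ]
  have hmirror : ∀ φ : ℝ, mirror (cos φ • f₀ + sin φ • f₁) ξ =
      ξ - (2 * ⟪cos φ • f₀ + sin φ • f₁, ξ⟫) • (cos φ • f₀ + sin φ • f₁) := fun φ => by
    rw [mirror_apply, hunit, div_one]
  have hle : Measurable fun η => G (level e η) := hG.comp continuous_level.measurable
  have hmeas : Measurable fun q : ℝ × WithLp 2 (E × ℝ) =>
      ENNReal.ofReal (‖mirror (cos q.1 • f₀ + sin q.1 • f₁) ξ - q.2‖ ^ (-(1 / 2) : ℝ)) *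
        G (level e q.2) := by
    simp_rw [hmirror]
    have : Continuous fun q : ℝ × WithLp 2 (E × ℝ) =>
        ‖ξ - (2 * ⟪cos q.1 • f₀ + sin q.1 • f₁, ξ⟫) • (cos q.1 • f₀ + sin q.1 • f₁) - q.2‖ := by
      fun_prop
    exact ((this.measurable.pow_const _).ennreal_ofReal).mul (hle.comp measurable_snd)
  have hinv : ∀ φ : ℝ, ∫⁻ η, ENNReal.ofReal (‖ξ - η‖ ^ (-(1 / 2) : ℝ)) * G (level e η)
        ∂sphereMeasure E = ∫⁻ η, ENNReal.ofReal
        (‖mirror (cos φ • f₀ + sin φ • f₁) ξ - η‖ ^ (-(1 / 2) : ℝ)) * G (level e η)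
        ∂sphereMeasure E := fun φ => by
    rw [← (measurePreserving_mirror (cos φ • f₀ + sin φ • f₁)).lintegral_comp_emb
      (mirror (cos φ • f₀ + sin φ • f₁)).toHomeomorph.measurableEmbedding (fun η => ENNReal.ofReal
        (‖mirror (cos φ • f₀ + sin φ • f₁) ξ - η‖ ^ (-(1 / 2) : ℝ)) * G (level e η))]
    refine lintegral_congr fun η => ?_
    rw [← map_sub, LinearIsometryEquiv.norm_map, hlev]
  have h2 : ENNReal.ofReal π * ∫⁻ η, ENNReal.ofReal (‖ξ - η‖ ^ (-(1 / 2) : ℝ)) * G (level e η)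
        ∂sphereMeasure E = ∫⁻ φ in Set.Ioc 0 π, ∫⁻ η, ENNReal.ofReal
        (‖mirror (cos φ • f₀ + sin φ • f₁) ξ - η‖ ^ (-(1 / 2) : ℝ)) * G (level e η)
        ∂sphereMeasure E := by
    simp_rw [← hinv]
    rw [lintegral_const, Measure.restrict_apply_univ, Real.volume_Ioc, sub_zero, mul_comm]
  rw [h2, lintegral_lintegral_swap hmeas.aemeasurable, ← lintegral_const_mul _ hle]
  refine lintegral_mono fun η => ?_
  rw [lintegral_mul_const _ (Measurable.ennreal_ofReal (Measurable.pow_const (by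
    simp_rw [hmirror]
    exact Continuous.measurable (by fun_prop)) _))]
  refine mul_le_mul_left ?_ _
  obtain ⟨ψ, hψ⟩ := exists_abs_sin_le_norm_sub h0 h1 h01 hρ0.le hξ0 hξ1 η
  rw [ENNReal.ofReal_mul (by positivity), ← lintegral_abs_sin_rpow ψ,
    ← lintegral_const_mul _ (by fun_prop)]
  refine lintegral_mono_ae ?_
  filter_upwards [ae_restrict_of_ae (ae_sin_ne_zero ψ)] with φ hφ
  rw [← ENNReal.ofReal_mul (by positivity), ← Real.mul_rpow (by norm_num) (abs_nonneg _)]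
  have h5 : 0 < |sin (2 * φ - ψ)| := abs_pos.2 hφ
  refine ENNReal.ofReal_le_ofReal (Real.rpow_le_rpow_of_nonpos (by positivity)
    ((mul_le_mul_of_nonneg_right hρ h5.le).trans (hψ φ)) (by norm_num))

lemma exists_lintegral_chord_level_le (he : Orthonormal ℝ e) :
    ∃ C : ℝ, 0 < C ∧ ∀ (τ : Set.Icc (0 : ℝ) 1) (G : Set.Icc (0 : ℝ) 1 → ℝ≥0∞), Measurable G →
      ∫⁻ η, ENNReal.ofReal (‖levelPoint e τ - η‖ ^ (-(1 / 2) : ℝ)) * G (level e η)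
        ∂sphereMeasure E ≤ ENNReal.ofReal C * ∫⁻ η, G (level e η) ∂sphereMeasure E := by
  set I : ℝ := (1 / 2) ^ (-(1 / 2) : ℝ) * ∫ x in 0..π, |sin x| ^ (-(1 / 2) : ℝ)
  have hI : 0 ≤ I := mul_nonneg (by positivity) (intervalIntegral.integral_nonneg pi_pos.le
    fun x _ => by positivity)
  refine ⟨(I + 1) / π, by positivity, fun τ G hG => ?_⟩
  have key : ENNReal.ofReal π * ∫⁻ η, ENNReal.ofReal (‖levelPoint e τ - η‖ ^ (-(1 / 2) : ℝ)) *
      G (level e η) ∂sphereMeasure E ≤ ENNReal.ofReal I *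
        ∫⁻ η, G (level e η) ∂sphereMeasure E := by
    have hhalf : ∀ x : ℝ, 1 / 2 ≤ x → 1 / 2 ≤ √x := fun x hx =>
      Real.le_sqrt_of_sq_le (by nlinarith)
    rcases le_total (1 / 2 : ℝ) τ with h | h
    · refine lintegral_chord_le_of_mirror (he.1 0) (he.1 1) (by simp [inner_basis he])
        (hhalf _ h) ?_ ?_ (fun φ η => level_mirror_of_mem he _ _ rfl η) hG
      · rw [inner_levelPoint he]; simp
      · rw [inner_levelPoint he]; simp
    · refine lintegral_chord_le_of_mirror (he.1 2) (he.1 3) (by simp [inner_basis he])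
        (hhalf (1 - τ) (by linarith)) ?_ ?_ (fun φ η => level_mirror_of_orthogonal ?_ ?_ η) hG
      · rw [inner_levelPoint he]; simp
      · rw [inner_levelPoint he]; simp
      · simp only [inner_add_left, real_inner_smul_left, inner_basis he]; simp
      · simp only [inner_add_left, real_inner_smul_left, inner_basis he]; simp
  have hπ : ENNReal.ofReal π ≠ 0 := by simp [pi_pos]
  rw [← ENNReal.mul_le_mul_iff_right hπ ENNReal.ofReal_ne_top, ← mul_assoc,
    ← ENNReal.ofReal_mul pi_pos.le, mul_div_cancel₀ _ pi_pos.ne']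
  refine key.trans (mul_le_mul_left (ENNReal.ofReal_le_ofReal (by linarith)) _)

end Averaging

section LevelOperator

open Module
open scoped RealInnerProductSpace ENNReal

variable {E : Type*} [NormedAddCommGroup E] [InnerProductSpace ℝ E] [FiniteDimensional ℝ E]
  [MeasurableSpace E] [BorelSpace E] [Nontrivial E] {e : Fin 4 → WithLp 2 (E × ℝ)}

lemma exists_levelOperator (he : Orthonormal ℝ e) {a : ℝ} (ha : a < finrank ℝ E) :
    ∃ K : C(Set.Icc (0 : ℝ) 1, ℝ) →L[ℝ] C(Set.Icc (0 : ℝ) 1, ℝ), IsCompactOperator K ∧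
      (∀ u, 0 ≤ u → 0 ≤ K u) ∧ ∀ u τ, K u τ =
        ∫ η, ‖levelPoint e τ - η‖ ^ (-a) * u (level e η) ∂sphereMeasure E := by
  refine exists_kernelOperator (k := fun τ η => ‖levelPoint e τ - η‖ ^ (-a)) (lev := level e)
    continuous_level.measurable (fun τ => by fun_prop) (fun τ η => by positivity)
    (fun τ => integrable_chord ha (norm_levelPoint he τ))
    (fun τ τ' => integral_norm_sub_eq (fun r => r ^ (-a))
      ((norm_levelPoint he τ).trans (norm_levelPoint he τ').symm)) (fun τ => ?_)
  filter_upwards [ae_ne (levelPoint e τ)] with η hη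
  refine ContinuousAt.rpow_const ?_ (Or.inl (norm_ne_zero_iff.2 (sub_ne_zero.2 hη.symm)))
  have := continuous_levelPoint (e := e)
  fun_prop

lemma exists_integral_chord_level_le (he : Orthonormal ℝ e) (hn : (1 / 2 : ℝ) < finrank ℝ E) :
    ∃ C : ℝ, 0 < C ∧ ∀ (τ : Set.Icc (0 : ℝ) 1) (v : C(Set.Icc (0 : ℝ) 1, ℝ)), 0 ≤ v →
      ∫ η, ‖levelPoint e τ - η‖ ^ (-(1 / 2) : ℝ) * v (level e η) ∂sphereMeasure E ≤
        C * ∫ τ, v τ ∂levelMeasure e := by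
  obtain ⟨C, hC, h⟩ := exists_lintegral_chord_level_le he
  refine ⟨C, hC, fun τ v hv => ?_⟩
  have hi := integrable_kernel_mul (lev := level e) continuous_level.measurable
    (integrable_chord hn (norm_levelPoint he τ)) v
  have hv' : Integrable (fun η => v (level e η)) (sphereMeasure E) :=
    integrable_of_continuous (levelMeasure e) v.continuous |>.comp_measurable
      continuous_level.measurable
  have h0 : ∀ η, 0 ≤ v (level e η) := fun η => hv _
  have h1 := h τ (fun τ => ENNReal.ofReal (v τ)) (by fun_prop)
  rw [← ofReal_integral_eq_lintegral_ofReal hv' (Eventually.of_forall h0),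
    ← ENNReal.ofReal_mul hC.le] at h1
  simp_rw [← ENNReal.ofReal_mul (Real.rpow_nonneg (norm_nonneg _) _)] at h1
  rw [← ofReal_integral_eq_lintegral_ofReal hi (Eventually.of_forall fun η =>
    mul_nonneg (by positivity) (h0 η)), ENNReal.ofReal_le_ofReal_iff
    (mul_nonneg hC.le (integral_nonneg h0))] at h1
  rwa [integral_levelMeasure v.continuous]

lemma integral_abs_rpow_le {X : Type*} [MetricSpace X] [CompactSpace X] [MeasurableSpace X]
    [BorelSpace X] {p : ℝ} (hp : 1 < p) (μ : Measure X) [IsFiniteMeasure μ] (u : C(X, ℝ)) :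
    ∫ x, |u x| ^ p ∂μ ≤ lpSize μ p 1 * lpSize μ p u ^ p := by
  have h := pairing_oddPow_le hp μ |u| 1
  have h1 : lpSize μ p |u| = lpSize μ p u := by
    simp only [lpSize, ContinuousMap.abs_apply, abs_abs]
  rw [h1, mul_comm] at h
  refine le_trans (le_of_eq (integral_congr_ae (Eventually.of_forall fun x => ?_))) h
  change |u x| ^ p = oddPow p |u x| * 1
  rw [mul_one, ← abs_of_nonneg (oddPow_nonneg (abs_nonneg (u x))), abs_oddPow hp, abs_abs]

lemma exists_near_integral_le (he : Orthonormal ℝ e) {a p : ℝ} (hp : 1 < p)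
    (hap : a * (p + 1) = 2 * finrank ℝ E) {δ : ℝ} (hδ : 0 < δ) :
    ∃ ε : ℝ, 0 < ε ∧ ∀ (τ : Set.Icc (0 : ℝ) 1) (u : C(Set.Icc (0 : ℝ) 1, ℝ)),
      ∫ η, (if ‖levelPoint e τ - η‖ < ε then ‖levelPoint e τ - η‖ ^ (-a) else 0) *
        |u (level e η)| ^ (p - 1) ∂sphereMeasure E ≤ δ * lpSize (levelMeasure e) p u ^ (p - 1) := by
  have hfin : (1 : ℝ) ≤ finrank ℝ E := by exact_mod_cast finrank_pos
  obtain ⟨C, hC, hav⟩ := exists_integral_chord_level_le he (by linarith)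
  set m : ℝ := (p + 1) / (p - 1) with hm
  set m' : ℝ := (p + 1) / 2 with hm'
  have hp1 : 0 < p - 1 := by linarith
  have hp2 : 0 < p + 1 := by linarith
  have hm0 : 0 < m := by positivity
  have hm0' : 0 < m' := by positivity
  have hconj : m.HolderConjugate m' := by
    rw [Real.holderConjugate_iff]
    refine ⟨by rw [hm, one_lt_div hp1]; linarith, ?_⟩
    rw [hm, hm']
    field_simp
    ring
  set b : ℝ := finrank ℝ E - (p - 1) / 4 with hb
  have hbn : b < finrank ℝ E := by linarith
  have hbe : (a - 1 / (2 * m)) * m' = b := by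
    have h2 : (finrank ℝ E : ℝ) = a * (p + 1) / 2 := by linarith
    rw [hb, h2, hm, hm']
    field_simp
    ring
  set D : ℝ := C ^ (1 / m)
  have hD : 0 < D := by positivity
  obtain ⟨ε, hε, hcap⟩ := exists_small_cap (E := E) hbn (δ := (δ / D) ^ m') (by positivity)
  refine ⟨ε, hε, fun τ u => ?_⟩
  set ξ := levelPoint e τ with hξ
  have hξ1 : ‖ξ‖ = 1 := norm_levelPoint he τ
  set F : WithLp 2 (E × ℝ) → ℝ := fun η => ‖ξ - η‖ ^ (-(1 / (2 * m))) *
    |u (level e η)| ^ (p - 1) with hF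
  set G : WithLp 2 (E × ℝ) → ℝ := fun η =>
    if ‖ξ - η‖ < ε then ‖ξ - η‖ ^ (-(a - 1 / (2 * m))) else 0 with hG
  have hF0 : ∀ η, 0 ≤ F η := fun η => by positivity
  have hG0 : ∀ η, 0 ≤ G η := fun η => by
    simp only [hG]
    split_ifs <;> positivity
  have hlm : Measurable (level e) := continuous_level.measurable
  have hFm : Measurable F := by
    have : Measurable fun η => u (level e η) := u.continuous.measurable.comp hlm
    simp only [hF]
    fun_prop
  have hGm : Measurable G := Measurable.ite (measurableSet_lt (by fun_prop) measurable_const)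
    (by fun_prop) measurable_const
  have hFp : ∀ η, F η ^ m = ‖ξ - η‖ ^ (-(1 / 2) : ℝ) * |u (level e η)| ^ (p + 1) := fun η => by
    simp only [hF]
    rw [Real.mul_rpow (by positivity) (by positivity), ← Real.rpow_mul (norm_nonneg _),
      ← Real.rpow_mul (abs_nonneg _)]
    congr 2
    · field_simp
    · rw [hm]; field_simp
  have hGp : ∀ η, G η ^ m' = if ‖ξ - η‖ < ε then ‖ξ - η‖ ^ (-b) else 0 := fun η => by
    simp only [hG]
    split_ifs
    · rw [← Real.rpow_mul (norm_nonneg _), neg_mul, hbe]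
    · exact Real.zero_rpow hm0'.ne'
  set v : C(Set.Icc (0 : ℝ) 1, ℝ) := ⟨fun τ => |u τ| ^ (p + 1), by
    have := u.continuous
    fun_prop (disch := linarith)⟩
  have hFi : Integrable (fun η => F η ^ m) (sphereMeasure E) := by
    simp_rw [hFp]
    exact integrable_kernel_mul hlm (integrable_chord (by linarith) hξ1) v
  have hGi : Integrable (fun η => G η ^ m') (sphereMeasure E) := by
    simp_rw [hGp]
    refine (integrable_chord hbn hξ1).mono' (Measurable.ite (measurableSet_lt (by fun_prop)
      measurable_const) (by fun_prop) measurable_const).aestronglyMeasurable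
      (Eventually.of_forall fun η => ?_)
    have : 0 ≤ ‖ξ - η‖ ^ (-b) := by positivity
    split_ifs
    · rw [Real.norm_of_nonneg this]
    · rwa [norm_zero]
  have hFL : MemLp F (ENNReal.ofReal m) (sphereMeasure E) := by
    rw [← integrable_norm_rpow_iff hFm.aestronglyMeasurable (by simpa using hm0)
      ENNReal.ofReal_ne_top, ENNReal.toReal_ofReal hm0.le]
    simpa only [Real.norm_of_nonneg (hF0 _)] using hFi
  have hGL : MemLp G (ENNReal.ofReal m') (sphereMeasure E) := by
    rw [← integrable_norm_rpow_iff hGm.aestronglyMeasurable (by simpa using hm0')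
      ENNReal.ofReal_ne_top, ENNReal.toReal_ofReal hm0'.le]
    simpa only [Real.norm_of_nonneg (hG0 _)] using hGi
  have hH := integral_mul_le_Lp_mul_Lq_of_nonneg hconj (Eventually.of_forall hF0)
    (Eventually.of_forall hG0) hFL hGL
  have h1 : ∫ η, (if ‖ξ - η‖ < ε then ‖ξ - η‖ ^ (-a) else 0) * |u (level e η)| ^ (p - 1)
      ∂sphereMeasure E = ∫ η, F η * G η ∂sphereMeasure E := by
    refine integral_congr_ae ?_
    filter_upwards [ae_ne ξ] with η hη
    have hd : 0 < ‖ξ - η‖ := norm_pos_iff.2 (sub_ne_zero.2 hη.symm)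
    simp only [hF, hG]
    split_ifs
    · rw [mul_right_comm, ← Real.rpow_add hd]
      congr 2
      ring
    · simp
  have hS := lpSize_nonneg (p := p) (levelMeasure e) u
  have h2 : (∫ η, F η ^ m ∂sphereMeasure E) ^ (1 / m) ≤
      D * lpSize (levelMeasure e) p u ^ (p - 1) := by
    have h3 := hav τ v (fun τ => by change 0 ≤ |u τ| ^ (p + 1); positivity)
    have h4 : ∫ τ, v τ ∂levelMeasure e = lpSize (levelMeasure e) p u ^ (p + 1) :=
      (lpSize_rpow hp (levelMeasure e) u).symm
    rw [h4] at h3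
    have h5 : (lpSize (levelMeasure e) p u ^ (p + 1)) ^ (1 / m) =
        lpSize (levelMeasure e) p u ^ (p - 1) := by
      rw [← Real.rpow_mul hS]
      congr 1
      rw [hm]
      field_simp
    rw [← h5, ← Real.mul_rpow hC.le (by positivity)]
    refine Real.rpow_le_rpow (integral_nonneg fun η => Real.rpow_nonneg (hF0 η) _) ?_
      (by positivity)
    simp_rw [hFp]
    exact h3
  have h3 : (∫ η, G η ^ m' ∂sphereMeasure E) ^ (1 / m') ≤ δ / D := by
    have h4 : ((δ / D) ^ m') ^ (1 / m') = δ / D := by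
      rw [← Real.rpow_mul (by positivity), mul_one_div_cancel hm0'.ne', Real.rpow_one]
    rw [← h4]
    refine Real.rpow_le_rpow (integral_nonneg fun η => Real.rpow_nonneg (hG0 η) _) ?_
      (by positivity)
    simp_rw [hGp]
    exact (hcap ξ hξ1).le
  rw [h1]
  refine hH.trans ((mul_le_mul h2 h3 (Real.rpow_nonneg (integral_nonneg fun η =>
    Real.rpow_nonneg (hG0 η) _) _) (by positivity)).trans (le_of_eq ?_))
  field_simp

lemma exists_norm_levelOperator_oddPow_le (he : Orthonormal ℝ e) {a p : ℝ} (hp : 1 < p)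
    (ha0 : 0 < a) (ha : a < finrank ℝ E) (hap : a * (p + 1) = 2 * finrank ℝ E)
    {K : C(Set.Icc (0 : ℝ) 1, ℝ) →L[ℝ] C(Set.Icc (0 : ℝ) 1, ℝ)}
    (hK : ∀ u τ, K u τ = ∫ η, ‖levelPoint e τ - η‖ ^ (-a) * u (level e η) ∂sphereMeasure E)
    {δ : ℝ} (hδ : 0 < δ) : ∃ C, ∀ u, ‖K (oddPowMap p hp u)‖ ≤
      δ * ‖u‖ * lpSize (levelMeasure e) p u ^ (p - 1) + C * lpSize (levelMeasure e) p u ^ p := by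
  obtain ⟨ε, hε, hnear⟩ := exists_near_integral_le he hp hap hδ
  refine ⟨ε ^ (-a) * lpSize (levelMeasure e) p 1, fun u => ?_⟩
  have hS := lpSize_nonneg (p := p) (levelMeasure e) u
  have hS1 := lpSize_nonneg (p := p) (levelMeasure e) 1
  rw [ContinuousMap.norm_le _ (by positivity)]
  intro τ
  set ξ := levelPoint e τ with hξ
  have hlm : Measurable (level e) := continuous_level.measurable
  have hch := integrable_chord ha (norm_levelPoint he τ)
  have hcut : Integrable (fun η => if ‖ξ - η‖ < ε then ‖ξ - η‖ ^ (-a) else 0)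
      (sphereMeasure E) := by
    refine hch.mono' (Measurable.ite (measurableSet_lt (by fun_prop)
      measurable_const) (by fun_prop) measurable_const).aestronglyMeasurable
      (Eventually.of_forall fun η => ?_)
    have : 0 ≤ ‖ξ - η‖ ^ (-a) := by positivity
    split_ifs
    · rw [Real.norm_of_nonneg this]
    · rwa [norm_zero]
  set v : C(Set.Icc (0 : ℝ) 1, ℝ) := ⟨fun τ => |u τ| ^ (p - 1), by
    have := u.continuous
    fun_prop (disch := linarith)⟩
  set v' : C(Set.Icc (0 : ℝ) 1, ℝ) := ⟨fun τ => |u τ| ^ p, by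
    have := u.continuous
    fun_prop (disch := linarith)⟩
  have hv : Integrable (fun η => (if ‖ξ - η‖ < ε then ‖ξ - η‖ ^ (-a) else 0) *
      |u (level e η)| ^ (p - 1)) (sphereMeasure E) := integrable_kernel_mul hlm hcut v
  have hv' : Integrable (fun η => |u (level e η)| ^ p) (sphereMeasure E) :=
    (integrable_of_continuous (levelMeasure e) v'.continuous).comp_measurable hlm
  have hpt : ∀ η, |‖ξ - η‖ ^ (-a) * oddPow p (u (level e η))| ≤
      ‖u‖ * ((if ‖ξ - η‖ < ε then ‖ξ - η‖ ^ (-a) else 0) * |u (level e η)| ^ (p - 1)) +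
        ε ^ (-a) * |u (level e η)| ^ p := fun η => by
    have h0 : 0 ≤ ‖ξ - η‖ ^ (-a) := by positivity
    have h1 : |u (level e η)| ≤ ‖u‖ := abs_comp_le u η
    have h2 : |u (level e η)| ^ p ≤ ‖u‖ * |u (level e η)| ^ (p - 1) := by
      rw [← abs_oddPow hp, oddPow, abs_mul, abs_of_nonneg (by positivity :
        (0 : ℝ) ≤ |u (level e η)| ^ (p - 1)), mul_comm]
      exact mul_le_mul_of_nonneg_right h1 (by positivity)
    rw [abs_mul, abs_of_nonneg h0, abs_oddPow hp]
    split_ifs with h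
    · have h3 := mul_le_mul_of_nonneg_left h2 h0
      have h4 : 0 ≤ ε ^ (-a) * |u (level e η)| ^ p := by positivity
      linarith
    · have h3 : ‖ξ - η‖ ^ (-a) ≤ ε ^ (-a) :=
        Real.rpow_le_rpow_of_nonpos hε (not_lt.1 h) (by linarith)
      rw [zero_mul, mul_zero, zero_add]
      exact mul_le_mul_of_nonneg_right h3 (by positivity)
  have h1 : |K (oddPowMap p hp u) τ| ≤ ‖u‖ * ∫ η, (if ‖ξ - η‖ < ε then ‖ξ - η‖ ^ (-a) else 0) *
      |u (level e η)| ^ (p - 1) ∂sphereMeasure E +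
        ε ^ (-a) * ∫ η, |u (level e η)| ^ p ∂sphereMeasure E := by
    rw [hK, ← integral_const_mul, ← integral_const_mul,
      ← integral_add (hv.const_mul _) (hv'.const_mul _)]
    exact abs_integral_le_integral_abs.trans (integral_mono_of_nonneg
      (Eventually.of_forall fun η => abs_nonneg _) ((hv.const_mul _).add (hv'.const_mul _))
      (Eventually.of_forall hpt))
  have h2 : ∫ η, |u (level e η)| ^ p ∂sphereMeasure E ≤
      lpSize (levelMeasure e) p 1 * lpSize (levelMeasure e) p u ^ p := by
    rw [← integral_levelMeasure (e := e) (f := fun τ => |u τ| ^ p) v'.continuous]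
    exact integral_abs_rpow_le hp _ u
  have h3 := mul_le_mul_of_nonneg_left (hnear τ u) (norm_nonneg u)
  have h4 := mul_le_mul_of_nonneg_left h2 (by positivity : 0 ≤ ε ^ (-a))
  rw [Real.norm_eq_abs]
  refine h1.trans ((add_le_add h3 h4).trans (le_of_eq ?_))
  ring

lemma pairing_levelOperator_symm (he : Orthonormal ℝ e) {a : ℝ} (ha : a < finrank ℝ E)
    {K : C(Set.Icc (0 : ℝ) 1, ℝ) →L[ℝ] C(Set.Icc (0 : ℝ) 1, ℝ)}
    (hK : ∀ u τ, K u τ = ∫ η, ‖levelPoint e τ - η‖ ^ (-a) * u (level e η) ∂sphereMeasure E)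
    (u v : C(Set.Icc (0 : ℝ) 1, ℝ)) :
    pairing (levelMeasure e) u (K v) = pairing (levelMeasure e) v (K u) := by
  have hlm : Measurable (level e) := continuous_level.measurable
  have hKξ : ∀ (w : C(Set.Icc (0 : ℝ) 1, ℝ)) (ξ : WithLp 2 (E × ℝ)), ‖ξ‖ = 1 →
      K w (level e ξ) = ∫ η, ‖ξ - η‖ ^ (-a) * w (level e η) ∂sphereMeasure E := fun w ξ hξ => by
    rw [hK, integral_chord_level he (fun r => r ^ (-a)) w hξ]
  have h1 : ∀ u v : C(Set.Icc (0 : ℝ) 1, ℝ), pairing (levelMeasure e) u (K v) =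
      ∫ ξ, ∫ η, ‖ξ - η‖ ^ (-a) * (u (level e ξ) * v (level e η)) ∂sphereMeasure E
        ∂sphereMeasure E := fun u v => by
    rw [pairing, integral_levelMeasure (by fun_prop)]
    refine integral_congr_ae ?_
    filter_upwards [ae_norm_eq_one] with ξ hξ
    rw [hKξ v ξ hξ, ← integral_const_mul]
    refine integral_congr_ae (Eventually.of_forall fun η => ?_)
    beta_reduce
    ring
  rw [h1, h1, integral_integral_swap]
  · refine integral_congr_ae (Eventually.of_forall fun η => integral_congr_ae
      (Eventually.of_forall fun ξ => ?_))
    beta_reduce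
    rw [norm_sub_rev]
    ring
  have hum : Measurable fun q : WithLp 2 (E × ℝ) => u (level e q) :=
    u.continuous.measurable.comp hlm
  have hvm : Measurable fun q : WithLp 2 (E × ℝ) => v (level e q) :=
    v.continuous.measurable.comp hlm
  have hm : Measurable (Function.uncurry fun ξ η : WithLp 2 (E × ℝ) =>
      ‖ξ - η‖ ^ (-a) * (u (level e ξ) * v (level e η))) := by
    simp only [Function.uncurry_def]
    have h2 : Measurable fun q : WithLp 2 (E × ℝ) × WithLp 2 (E × ℝ) => ‖q.1 - q.2‖ :=
      Continuous.measurable (by fun_prop)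
    exact (h2.pow_const _).mul ((hum.comp measurable_fst).mul (hvm.comp measurable_snd))
  obtain ⟨x₀⟩ : Nonempty E := inferInstance
  rw [integrable_prod_iff hm.aestronglyMeasurable]
  have hc : ∀ ξ : WithLp 2 (E × ℝ), ‖ξ‖ = 1 → Integrable (fun η => ‖ξ - η‖ ^ (-a) *
      (u (level e ξ) * v (level e η))) (sphereMeasure E) := fun ξ hξ => by
    have := (integrable_kernel_mul hlm (integrable_chord ha hξ) v).const_mul (u (level e ξ))
    refine this.congr (Eventually.of_forall fun η => ?_)
    beta_reduce
    ring
  constructor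
  · filter_upwards [ae_norm_eq_one] with ξ hξ using hc ξ hξ
  · refine Integrable.of_bound (C := ‖u‖ * ‖v‖ *
      ∫ η, ‖invStereo x₀ - η‖ ^ (-a) ∂sphereMeasure E)
      hm.norm.stronglyMeasurable.integral_prod_right'.aestronglyMeasurable ?_
    filter_upwards [ae_norm_eq_one] with ξ hξ
    rw [Real.norm_of_nonneg (integral_nonneg fun η => norm_nonneg _),
      ← integral_norm_sub_eq (fun r => r ^ (-a)) (hξ.trans (norm_invStereo x₀).symm),
      ← integral_const_mul]
    refine integral_mono_of_nonneg (Eventually.of_forall fun η => norm_nonneg _)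
      ((integrable_chord ha hξ).const_mul _) (Eventually.of_forall fun η => ?_)
    change ‖‖ξ - η‖ ^ (-a) * (u (level e ξ) * v (level e η))‖ ≤ ‖u‖ * ‖v‖ * ‖ξ - η‖ ^ (-a)
    have h0 : 0 ≤ ‖ξ - η‖ ^ (-a) := by positivity
    rw [norm_mul, Real.norm_of_nonneg h0, norm_mul, mul_comm]
    exact mul_le_mul_of_nonneg_right (mul_le_mul (abs_comp_le u ξ) (abs_comp_le v η)
      (norm_nonneg _) (norm_nonneg _)) h0

end LevelOperator

section Transfer

open Module
open scoped RealInnerProductSpace ENNReal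

variable {E : Type*} [NormedAddCommGroup E] [InnerProductSpace ℝ E] [FiniteDimensional ℝ E]
  [MeasurableSpace E] [BorelSpace E] {e : Fin 4 → WithLp 2 (E × ℝ)}

/-- The Riesz potential of `f`, up to normalization. -/
def riesz (a : ℝ) (f : E → ℝ) (x : E) : ℝ := ∫ y, ‖x - y‖ ^ (-a) * f y

/-- The function on `E` corresponding to `v ∘ level e` on the sphere, with conformal weight `b`. -/
def weighted (e : Fin 4 → WithLp 2 (E × ℝ)) (b : ℝ) (v : C(Set.Icc (0 : ℝ) 1, ℝ)) (x : E) : ℝ :=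
  (1 + ‖x‖ ^ 2) ^ (-b) * v (level e (invStereo x))

omit [FiniteDimensional ℝ E] [MeasurableSpace E] [BorelSpace E] in
lemma continuous_weighted (b : ℝ) (v : C(Set.Icc (0 : ℝ) 1, ℝ)) : Continuous (weighted e b v) := by
  unfold weighted
  refine Continuous.mul (Continuous.rpow_const (by fun_prop) fun x => Or.inl (by positivity)) ?_
  exact v.continuous.comp (continuous_level.comp continuous_invStereo)

omit [FiniteDimensional ℝ E] [MeasurableSpace E] [BorelSpace E] in
lemma abs_weighted_le (b : ℝ) (v : C(Set.Icc (0 : ℝ) 1, ℝ)) (x : E) :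
    |weighted e b v x| ≤ ‖v‖ * (1 + ‖x‖ ^ 2) ^ (-b) := by
  have : (0 : ℝ) ≤ (1 + ‖x‖ ^ 2) ^ (-b) := by positivity
  rw [weighted, abs_mul, abs_of_nonneg this, mul_comm]
  exact mul_le_mul_of_nonneg_right (abs_comp_le v _) this

lemma integrable_weighted {b : ℝ} (hb : finrank ℝ E < 2 * b) (v : C(Set.Icc (0 : ℝ) 1, ℝ)) :
    Integrable (weighted e b v) := by
  have h := (integrable_rpow_neg_one_add_norm_sq (E := E) (μ := volume) hb).const_mul ‖v‖
  refine h.mono' (continuous_weighted b v).aestronglyMeasurable (Eventually.of_forall fun x => ?_)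
  refine (abs_weighted_le b v x).trans (le_of_eq ?_)
  congr 2
  ring

omit [FiniteDimensional ℝ E] [MeasurableSpace E] [BorelSpace E] in
lemma norm_invStereo_sub_rpow (a : ℝ) (x y : E) : ‖invStereo x - invStereo y‖ ^ (-a) =
    2 ^ (-a) * ((1 + ‖x‖ ^ 2) ^ (a / 2) * (1 + ‖y‖ ^ 2) ^ (a / 2)) * ‖x - y‖ ^ (-a) := by
  have hx : (0 : ℝ) < 1 + ‖x‖ ^ 2 := by positivity
  have hy : (0 : ℝ) < 1 + ‖y‖ ^ 2 := by positivity
  have h1 : ∀ t : ℝ, 0 ≤ t → t ^ (-a) = (t ^ 2) ^ (-a / 2) := fun t ht => by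
    rw [← Real.rpow_natCast, ← Real.rpow_mul ht]
    congr 1
    push_cast
    ring
  rw [h1 _ (norm_nonneg _), norm_invStereo_sub_sq, Real.div_rpow (by positivity) (by positivity),
    Real.mul_rpow (by norm_num) (by positivity), Real.mul_rpow hx.le hy.le, ← h1 _ (norm_nonneg _),
    h1 2 (by norm_num), show (-a / 2 : ℝ) = -(a / 2) by ring, Real.rpow_neg hx.le,
    Real.rpow_neg hy.le]
  norm_num
  field_simp

lemma riesz_weighted (a : ℝ) (v : C(Set.Icc (0 : ℝ) 1, ℝ)) (x : E) :
    riesz a (weighted e (finrank ℝ E - a / 2) v) x = 2 ^ a * ((1 + ‖x‖ ^ 2) ^ (-(a / 2)) *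
      ∫ η, ‖invStereo x - η‖ ^ (-a) * v (level e η) ∂sphereMeasure E) := by
  have hlm : Measurable (level e) := continuous_level.measurable
  have hvm : Measurable fun q : WithLp 2 (E × ℝ) => v (level e q) :=
    v.continuous.measurable.comp hlm
  rw [integral_sphereMeasure (by fun_prop), riesz, ← integral_const_mul, ← integral_const_mul]
  refine integral_congr_ae (Eventually.of_forall fun y => ?_)
  have hx : (0 : ℝ) < 1 + ‖x‖ ^ 2 := by positivity
  have hy : (0 : ℝ) < 1 + ‖y‖ ^ 2 := by positivity
  have h2 : (2 : ℝ) ^ a * 2 ^ (-a) = 1 := by rw [← Real.rpow_add two_pos, add_neg_cancel,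
    Real.rpow_zero]
  have h3 : (1 + ‖x‖ ^ 2) ^ (-(a / 2)) * (1 + ‖x‖ ^ 2) ^ (a / 2) = 1 := by
    rw [← Real.rpow_add hx, neg_add_cancel, Real.rpow_zero]
  have h4 : (1 + ‖y‖ ^ 2) ^ (-((finrank ℝ E : ℝ) - a / 2)) =
      (1 + ‖y‖ ^ 2) ^ (-(finrank ℝ E : ℝ)) * (1 + ‖y‖ ^ 2) ^ (a / 2) := by
    rw [← Real.rpow_add hy]
    congr 1
    ring
  simp only [weighted, sphereDensity]
  rw [norm_invStereo_sub_rpow, h4]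
  calc _ = (2 ^ a * 2 ^ (-a)) * ((1 + ‖x‖ ^ 2) ^ (-(a / 2)) * (1 + ‖x‖ ^ 2) ^ (a / 2)) *
      (‖x - y‖ ^ (-a) * ((1 + ‖y‖ ^ 2) ^ (-(finrank ℝ E : ℝ)) * (1 + ‖y‖ ^ 2) ^ (a / 2) *
        v (level e (invStereo y)))) := by rw [h2, h3]; ring
    _ = _ := by ring

variable [Nontrivial E] {a : ℝ} {K : C(Set.Icc (0 : ℝ) 1, ℝ) →L[ℝ] C(Set.Icc (0 : ℝ) 1, ℝ)}

lemma riesz_weighted_eq (he : Orthonormal ℝ e)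
    (hK : ∀ u τ, K u τ = ∫ η, ‖levelPoint e τ - η‖ ^ (-a) * u (level e η) ∂sphereMeasure E)
    (v : C(Set.Icc (0 : ℝ) 1, ℝ)) :
    riesz a (weighted e (finrank ℝ E - a / 2) v) = fun x => 2 ^ a * weighted e (a / 2) (K v) x := by
  funext x
  rw [riesz_weighted, weighted, hK,
    integral_chord_level he (fun r => r ^ (-a)) v (norm_invStereo x)]

omit [Nontrivial E] in
lemma pairing_eq_integral (b b' : ℝ) (hb : b + b' = finrank ℝ E) (u v : C(Set.Icc (0 : ℝ) 1, ℝ)) :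
    pairing (levelMeasure e) u v = ∫ x, weighted e b u x * weighted e b' v x := by
  have hlm : Measurable (level e) := continuous_level.measurable
  have hm : ∀ w : C(Set.Icc (0 : ℝ) 1, ℝ), Measurable fun q : WithLp 2 (E × ℝ) => w (level e q) :=
    fun w => w.continuous.measurable.comp hlm
  have hu := hm u
  have hv := hm v
  rw [pairing, integral_levelMeasure (by fun_prop), integral_sphereMeasure (by fun_prop)]
  refine integral_congr_ae (Eventually.of_forall fun x => ?_)
  have hx : (0 : ℝ) < 1 + ‖x‖ ^ 2 := by positivity
  simp only [weighted, sphereDensity]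
  rw [← hb, neg_add, Real.rpow_add hx]
  ring

end Transfer

section Truncated

open Module
open scoped ENNReal

variable {N : ℕ} {s : ℝ}

local notation "𝔼" => EuclideanSpace ℝ (Fin N)

/-- The kernel of the fractional Laplacian, truncated to `ε < ‖h‖`. -/
def tailKernel (N : ℕ) (s ε : ℝ) (h : EuclideanSpace ℝ (Fin N)) : ℝ :=
  {h : EuclideanSpace ℝ (Fin N) | ε < ‖h‖}.indicator (fun h => ‖h‖ ^ (-((N : ℝ) + 2 * s))) h

lemma tailKernel_nonneg (ε : ℝ) (h : 𝔼) : 0 ≤ tailKernel N s ε h :=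
  Set.indicator_nonneg (fun h _ => by positivity) h

lemma tailKernel_neg (ε : ℝ) (h : 𝔼) : tailKernel N s ε (-h) = tailKernel N s ε h := by
  simp only [tailKernel, Set.indicator, Set.mem_ofPred_eq, norm_neg]

lemma measurable_tailKernel (ε : ℝ) : Measurable (tailKernel N s ε) := by
  unfold tailKernel
  exact Measurable.indicator (by fun_prop) (measurableSet_lt measurable_const (by fun_prop))

lemma tailKernel_le_one (hs : 0 < s) {ε : ℝ} (hε : 1 ≤ ε) (h : 𝔼) : tailKernel N s ε h ≤ 1 := by
  rw [tailKernel, Set.indicator_apply]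
  split_ifs with hh
  · exact Real.rpow_le_one_of_one_le_of_nonpos (hε.trans (le_of_lt hh)) (by
      have : (0 : ℝ) ≤ N := N.cast_nonneg
      linarith)
  · exact zero_le_one

lemma tailKernel_smul {lam ε : ℝ} (hl : 0 < lam) (h : 𝔼) :
    tailKernel N s (lam * ε) (lam • h) = lam ^ (-((N : ℝ) + 2 * s)) * tailKernel N s ε h := by
  simp only [tailKernel, Set.indicator_apply, Set.mem_ofPred_eq, norm_smul,
    Real.norm_of_nonneg hl.le, mul_lt_mul_iff_right₀ hl]
  split_ifs
  · rw [Real.mul_rpow hl.le (norm_nonneg _)]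
  · rw [mul_zero]

lemma integrable_tailKernel (hs : 0 < s) {ε : ℝ} (hε : 0 < ε) : Integrable (tailKernel N s ε) := by
  have hb := (integrable_rpow_neg_one_add_norm_sq (E := 𝔼) (μ := volume)
    (r := (N : ℝ) + 2 * s) (by simp [hs])).const_mul
      ((1 / ε ^ 2 + 1) ^ (((N : ℝ) + 2 * s) / 2))
  refine hb.mono' (measurable_tailKernel ε).aestronglyMeasurable (Eventually.of_forall fun h => ?_)
  rw [Real.norm_of_nonneg (tailKernel_nonneg ε h), tailKernel, Set.indicator_apply]
  have hσ : 0 < (N : ℝ) + 2 * s := by positivity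
  split_ifs with hh
  · have hh' : ε < ‖h‖ := hh
    have h0 : 0 < ‖h‖ := hε.trans hh'
    have h1 : 1 + ‖h‖ ^ 2 ≤ (1 / ε ^ 2 + 1) * ‖h‖ ^ 2 := by
      have : 1 ≤ 1 / ε ^ 2 * ‖h‖ ^ 2 := by
        rw [div_mul_eq_mul_div, one_mul, one_le_div (by positivity)]
        exact pow_le_pow_left₀ hε.le hh'.le 2
      linarith
    have h2 := Real.rpow_le_rpow_of_nonpos (by positivity) h1
      (by linarith : -((N : ℝ) + 2 * s) / 2 ≤ 0)
    rw [Real.mul_rpow (by positivity) (by positivity), ← Real.rpow_natCast ‖h‖ 2,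
      ← Real.rpow_mul h0.le, show ((2 : ℕ) : ℝ) * (-((N : ℝ) + 2 * s) / 2) = -((N : ℝ) + 2 * s) by
        push_cast; ring] at h2
    have h3 : (1 / ε ^ 2 + 1) ^ (((N : ℝ) + 2 * s) / 2) * (1 / ε ^ 2 + 1) ^ (-((N : ℝ) + 2 * s) / 2)
        = 1 := by
      rw [← Real.rpow_add (by positivity), neg_div, add_neg_cancel, Real.rpow_zero]
    have h4 := mul_le_mul_of_nonneg_left h2
      (by positivity : 0 ≤ (1 / ε ^ 2 + 1) ^ (((N : ℝ) + 2 * s) / 2))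
    rw [← mul_assoc, h3, one_mul, Real.rpow_natCast] at h4
    exact h4
  · positivity

lemma pvInt_eq (u : 𝔼 → ℝ) (x : 𝔼) (ε : ℝ) :
    pvInt N s u x ε = ∫ y, (u x - u y) * tailKernel N s ε (x - y) := by
  rw [pvInt, ← integral_indicator (measurableSet_lt measurable_const (by fun_prop))]
  refine integral_congr_ae (Eventually.of_forall fun y => ?_)
  simp only [tailKernel, Set.indicator_apply, Set.mem_ofPred_eq]
  split_ifs
  · rw [Real.rpow_neg (norm_nonneg _), div_eq_mul_inv]
  · rw [mul_zero]

lemma pvInt_eq' (u : 𝔼 → ℝ) (x : 𝔼) (ε : ℝ) :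
    pvInt N s u x ε = ∫ h, (u x - u (x - h)) * tailKernel N s ε h := by
  rw [pvInt_eq, ← integral_sub_left_eq_self _ volume x]
  simp only [sub_sub_cancel]

lemma pvInt_const_mul (θ : ℝ) (u : 𝔼 → ℝ) (x : 𝔼) (ε : ℝ) :
    pvInt N s (fun y => θ * u y) x ε = θ * pvInt N s u x ε := by
  rw [pvInt_eq, pvInt_eq, ← integral_const_mul]
  refine integral_congr_ae (Eventually.of_forall fun y => ?_)
  beta_reduce
  ring

lemma pvInt_comp_sub (u : 𝔼 → ℝ) (v x : 𝔼) (ε : ℝ) :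
    pvInt N s (fun y => u (y - v)) x ε = pvInt N s u (x - v) ε := by
  rw [pvInt_eq', pvInt_eq']
  simp only [sub_right_comm x _ v]

lemma integral_comp_smul_pos {F : Type*} [NormedAddCommGroup F] [NormedSpace ℝ F] {lam : ℝ}
    (hl : 0 < lam) (f : 𝔼 → F) : ∫ h, f h = lam ^ (N : ℝ) • ∫ h, f (lam • h) := by
  rw [Measure.integral_comp_smul_of_nonneg _ _ _ (hR := hl.le), finrank_euclideanSpace_fin,
    smul_smul, Real.rpow_natCast, mul_inv_cancel₀ (by positivity), one_smul]

lemma pvInt_comp_smul {lam : ℝ} (hl : 0 < lam) (u : 𝔼 → ℝ) (x : 𝔼) (ε : ℝ) :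
    pvInt N s (fun y => u (lam • y)) x ε =
      lam ^ (2 * s) * pvInt N s u (lam • x) (lam * ε) := by
  rw [pvInt_eq', pvInt_eq', integral_comp_smul_pos hl
    (fun h => (u (lam • x) - u (lam • x - h)) * tailKernel N s (lam * ε) h),
    smul_eq_mul, ← mul_assoc,
    ← integral_const_mul]
  refine integral_congr_ae (Eventually.of_forall fun h => ?_)
  simp only [tailKernel_smul hl, smul_sub]
  rw [← Real.rpow_add hl]
  have : lam ^ (2 * s + N) * lam ^ (-((N : ℝ) + 2 * s)) = 1 := by
    rw [← Real.rpow_add hl, show 2 * s + N + -((N : ℝ) + 2 * s) = 0 by ring, Real.rpow_zero]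
  calc _ = (lam ^ (2 * s + N) * lam ^ (-((N : ℝ) + 2 * s))) *
      ((u (lam • x) - u (lam • x - lam • h)) * tailKernel N s ε h) := by rw [this, one_mul]
    _ = _ := by ring

variable {a : ℝ}

lemma integrableOn_norm_rpow (hN : 1 ≤ N) (ha : a < N) (r : ℝ) :
    IntegrableOn (fun y : 𝔼 => ‖y‖ ^ (-a)) (Metric.ball 0 r) :=
  integrableOn_ball_of_norm_le_rpow (C := 1) (α := a) (by simpa using hN) (by simpa using ha)
    (Eventually.of_forall fun x => by rw [Real.norm_of_nonneg (by positivity), one_mul])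
    (by fun_prop : Measurable fun y : 𝔼 => ‖y‖ ^ (-a)).aestronglyMeasurable

lemma riesz_dominated (ha0 : 0 < a) {f : 𝔼 → ℝ} {C : ℝ} (hfb : ∀ x, |f x| ≤ C) (x w : 𝔼) :
    ‖x - w‖ ^ (-a) * |f w| ≤
      C * (Metric.ball (0 : 𝔼) 1).indicator (fun y => ‖y‖ ^ (-a)) (x - w) + |f w| := by
  have hC : 0 ≤ C := (abs_nonneg _).trans (hfb 0)
  have h0 : 0 ≤ ‖x - w‖ ^ (-a) := by positivity
  by_cases h : x - w ∈ Metric.ball (0 : 𝔼) 1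
  · rw [Set.indicator_of_mem h]
    have := mul_le_mul_of_nonneg_left (hfb w) h0
    linarith [abs_nonneg (f w)]
  · rw [Set.indicator_of_notMem h, mul_zero, zero_add]
    refine mul_le_of_le_one_left (abs_nonneg _)
      (Real.rpow_le_one_of_one_le_of_nonpos ?_ (by linarith))
    simpa using h

lemma integrable_riesz (hN : 1 ≤ N) (ha0 : 0 < a) (ha : a < N) {f : 𝔼 → ℝ} (hf : Measurable f)
    (hfi : Integrable f) {C : ℝ} (hfb : ∀ x, |f x| ≤ C) (x : 𝔼) :
    Integrable fun w => ‖x - w‖ ^ (-a) * f w := by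
  have h1 := (((integrableOn_norm_rpow hN ha 1).integrable_indicator
    measurableSet_ball).comp_sub_left x).const_mul C |>.add hfi.abs
  refine h1.mono' (by fun_prop : Measurable _).aestronglyMeasurable
    (Eventually.of_forall fun w => ?_)
  rw [norm_mul, Real.norm_of_nonneg (by positivity : 0 ≤ ‖x - w‖ ^ (-a))]
  exact riesz_dominated ha0 hfb x w

lemma riesz_abs_le (hN : 1 ≤ N) (ha0 : 0 < a) (ha : a < N) {f : 𝔼 → ℝ}
    (hfi : Integrable f) {C : ℝ} (hfb : ∀ x, |f x| ≤ C) (x : 𝔼) :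
    riesz a (fun w => |f w|) x ≤ C * (∫ y in Metric.ball (0 : 𝔼) 1, ‖y‖ ^ (-a)) + ∫ w, |f w| := by
  have h1 := (((integrableOn_norm_rpow hN ha 1).integrable_indicator
    measurableSet_ball).comp_sub_left x).const_mul C
  have h2 : ∫ y in Metric.ball (0 : 𝔼) 1, ‖y‖ ^ (-a) =
      ∫ w, (Metric.ball (0 : 𝔼) 1).indicator (fun y => ‖y‖ ^ (-a)) (x - w) := by
    rw [integral_sub_left_eq_self (fun h => (Metric.ball (0 : 𝔼) 1).indicator
      (fun y => ‖y‖ ^ (-a)) h) volume x, integral_indicator measurableSet_ball]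
  rw [riesz, h2, ← integral_const_mul, ← integral_add h1 hfi.abs]
  exact integral_mono_of_nonneg (Eventually.of_forall fun w => by positivity) (h1.add hfi.abs)
    (Eventually.of_forall fun w => riesz_dominated ha0 hfb x w)

end Truncated

section Bubble

open Module
open scoped ENNReal RealInnerProductSpace

lemma rpow_neg_sub_le {β x y : ℝ} (hβ : 0 < β) (hx : 0 < x) (hy : 0 < y) :
    x ^ (-β) - y ^ (-β) ≤ β * x ^ (-β - 1) * (y - x) := by
  have h1 : (y / x) ^ (-β) ≥ 1 - β * (y / x - 1) := by
    rw [Real.rpow_def_of_pos (by positivity)]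
    have h2 := Real.add_one_le_exp (Real.log (y / x) * -β)
    have h3 := mul_le_mul_of_nonneg_left (Real.log_le_sub_one_of_pos (div_pos hy hx)) hβ.le
    linarith
  rw [Real.div_rpow hy.le hx.le, ge_iff_le, le_div_iff₀ (by positivity)] at h1
  have h4 : x ^ (-β - 1) * x = x ^ (-β) := by
    rw [← Real.rpow_add_one hx.ne', sub_add_cancel]
  have h5 : (1 - β * (y / x - 1)) * x ^ (-β) = x ^ (-β) - β * x ^ (-β - 1) * (y - x) := by
    rw [← h4]
    field_simp
  linarith

lemma abs_rpow_neg_sub_le {β m x y : ℝ} (hβ : 0 < β) (hm : 0 < m) (hx : m ≤ x) (hy : m ≤ y) :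
    |x ^ (-β) - y ^ (-β)| ≤ β * m ^ (-β - 1) * |x - y| := by
  have key : ∀ {x y : ℝ}, m ≤ x → m ≤ y → x ^ (-β) - y ^ (-β) ≤ β * m ^ (-β - 1) * |x - y| := by
    intro x y hx hy
    refine (rpow_neg_sub_le hβ (hm.trans_le hx) (hm.trans_le hy)).trans ?_
    have h1 : x ^ (-β - 1) ≤ m ^ (-β - 1) :=
      Real.rpow_le_rpow_of_nonpos hm hx (by linarith)
    have h2 : y - x ≤ |x - y| := by rw [abs_sub_comm]; exact le_abs_self _
    calc β * x ^ (-β - 1) * (y - x) ≤ β * x ^ (-β - 1) * |x - y| :=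
          mul_le_mul_of_nonneg_left h2 (by have := hm.trans_le hx; positivity)
      _ ≤ _ := by gcongr
  rw [abs_le]
  refine ⟨?_, key hx hy⟩
  have := key hy hx
  rw [abs_sub_comm] at this
  linarith

lemma abs_rpow_neg_second_diff_le {β m D r : ℝ} (hβ : 0 < β) (hm : 0 < m) (hD : m ≤ D - |r|) :
    |(D + r) ^ (-β) + (D - r) ^ (-β) - 2 * D ^ (-β)| ≤ 2 * β * (β + 1) * m ^ (-β - 2) * r ^ 2 := by
  have hA : m ≤ D + r := by linarith [neg_abs_le r]
  have hB : m ≤ D - r := by linarith [le_abs_self r]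
  have hD' : 0 < D := by linarith [abs_nonneg r]
  have hA' := hm.trans_le hA
  have hB' := hm.trans_le hB
  have h1 := rpow_neg_sub_le hβ hA' hD'
  have h2 := rpow_neg_sub_le hβ hB' hD'
  have h3 := rpow_neg_sub_le hβ hD' hA'
  have h4 := rpow_neg_sub_le hβ hD' hB'
  have h5 := abs_rpow_neg_sub_le (by linarith : 0 < β + 1) hm hB hA
  have h6 : (D - r) - (D + r) = -2 * r := by ring
  rw [h6, abs_mul, show -(β + 1) = -β - 1 by ring, show -β - 1 - 1 = -β - 2 by ring,
    abs_neg, abs_two] at h5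
  have h7 : r * ((D - r) ^ (-β - 1) - (D + r) ^ (-β - 1)) ≤
      |r| * ((β + 1) * m ^ (-β - 2) * (2 * |r|)) := by
    refine (le_abs_self _).trans ?_
    rw [abs_mul]
    exact mul_le_mul_of_nonneg_left h5 (abs_nonneg r)
  have h8 := mul_le_mul_of_nonneg_left h7 hβ.le
  have h9 : β * (|r| * ((β + 1) * m ^ (-β - 2) * (2 * |r|))) =
      2 * β * (β + 1) * m ^ (-β - 2) * r ^ 2 := by
    rw [← sq_abs r]; ring
  rw [abs_le]
  constructor
  · have : 0 ≤ 2 * β * (β + 1) * m ^ (-β - 2) * r ^ 2 := by positivity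
    linarith
  · linarith

variable {N : ℕ} {s : ℝ}

local notation "𝔼" => EuclideanSpace ℝ (Fin N)

/-- A rescaled bubble of height `lam ^ (-2β)`. -/
def rescaledBubble (β lam : ℝ) (y : 𝔼) : ℝ := (lam ^ 2 + ‖y‖ ^ 2) ^ (-β)

lemma measurable_rescaledBubble (β lam : ℝ) : Measurable (rescaledBubble (N := N) β lam) := by
  unfold rescaledBubble
  fun_prop

lemma rescaledBubble_nonneg (β lam : ℝ) (y : 𝔼) : 0 ≤ rescaledBubble β lam y := by
  unfold rescaledBubble
  positivity

lemma rescaledBubble_second_diff_le {β : ℝ} (hβ : 0 < β) (lam : ℝ) {z h : 𝔼} (hz : 2 ≤ ‖z‖)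
    (hh : ‖h‖ ≤ 1) :
    |rescaledBubble β lam (z + h) + rescaledBubble β lam (z - h) - 2 * rescaledBubble β lam z| ≤
      (32 * β * (β + 1) + 2 * β) * (‖z‖ ^ 2 / 4) ^ (-β - 1) * ‖h‖ ^ 2 := by
  set m := ‖z‖ ^ 2 / 4 with hm
  have hm0 : 0 < m := by
    have : 0 < ‖z‖ := by linarith
    positivity
  set D := lam ^ 2 + ‖z‖ ^ 2 + ‖h‖ ^ 2 with hDdef
  set r := 2 * ⟪z, h⟫ with hr
  have hrle : |r| ≤ 2 * (‖z‖ * ‖h‖) := by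
    rw [hr, abs_mul, abs_two]
    exact mul_le_mul_of_nonneg_left (abs_real_inner_le_norm z h) two_pos.le
  have hD : m ≤ D - |r| := by
    have : ‖z‖ / 2 ≤ ‖z‖ - ‖h‖ := by linarith
    have h2 := pow_le_pow_left₀ (by positivity) this 2
    nlinarith [sq_nonneg lam]
  have h1 : rescaledBubble β lam (z + h) = (D + r) ^ (-β) := by
    rw [rescaledBubble, norm_add_sq_real]; congr 1; rw [hDdef, hr]; ring
  have h2 : rescaledBubble β lam (z - h) = (D - r) ^ (-β) := by
    rw [rescaledBubble, norm_sub_sq_real]; congr 1; rw [hDdef, hr]; ring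
  have h3 := abs_rpow_neg_second_diff_le hβ hm0 hD
  have h4 := abs_rpow_neg_sub_le (x := D) (y := lam ^ 2 + ‖z‖ ^ 2) hβ hm0
    (by linarith [abs_nonneg r]) (by rw [hm]; nlinarith [sq_nonneg lam, sq_nonneg ‖z‖])
  rw [show D - (lam ^ 2 + ‖z‖ ^ 2) = ‖h‖ ^ 2 by rw [hDdef]; ring,
    abs_of_nonneg (by positivity : 0 ≤ ‖h‖ ^ 2)] at h4
  have h5 : 2 * β * (β + 1) * m ^ (-β - 2) * r ^ 2 ≤ 32 * β * (β + 1) * m ^ (-β - 1) * ‖h‖ ^ 2 := by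
    have h6 : r ^ 2 ≤ 16 * m * ‖h‖ ^ 2 := by
      rw [← sq_abs r]
      refine (pow_le_pow_left₀ (abs_nonneg r) hrle 2).trans (le_of_eq ?_)
      rw [hm]; ring
    have h7 : m ^ (-β - 1) = m ^ (-β - 2) * m := by
      rw [← Real.rpow_add_one hm0.ne']; congr 1; ring
    calc _ ≤ 2 * β * (β + 1) * m ^ (-β - 2) * (16 * m * ‖h‖ ^ 2) := by gcongr
      _ = _ := by rw [h7]; ring
  rw [h1, h2]
  calc _ = |((D + r) ^ (-β) + (D - r) ^ (-β) - 2 * D ^ (-β)) +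
        2 * (D ^ (-β) - (lam ^ 2 + ‖z‖ ^ 2) ^ (-β))| := by
        rw [rescaledBubble]; congr 1; ring
    _ ≤ _ := (abs_add_le _ _).trans (by rw [abs_mul, abs_two]; linarith)

lemma bubble_smul_inv {c lam : ℝ} (hl : 0 < lam) (y : 𝔼) : bubble N s c (lam⁻¹ • y) =
    c * (lam ^ ((N : ℝ) - 2 * s) * rescaledBubble (((N : ℝ) - 2 * s) / 2) lam y) := by
  have h1 : 1 / (1 + ‖lam⁻¹ • y‖ ^ 2) = lam ^ 2 * (lam ^ 2 + ‖y‖ ^ 2)⁻¹ := by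
    rw [norm_smul, norm_inv, Real.norm_of_nonneg hl.le]
    field_simp
  rw [bubble, h1, Real.mul_rpow (by positivity) (by positivity), rescaledBubble,
    ← Real.rpow_natCast, ← Real.rpow_mul hl.le, Real.inv_rpow (by positivity),
    Real.rpow_neg (by positivity)]
  congr 3
  push_cast
  ring

end Bubble

section Profile

open Module
open scoped ENNReal RealInnerProductSpace

variable {N : ℕ} {s : ℝ}

local notation "𝔼" => EuclideanSpace ℝ (Fin N)

/-- The fractional Laplacian, truncated at distance one, of the fundamental solution. -/
def profile (N : ℕ) (s : ℝ) (z : EuclideanSpace ℝ (Fin N)) : ℝ :=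
  pvInt N s (fun y => ‖y‖ ^ (-((N : ℝ) - 2 * s))) z 1

lemma pvInt_fundamental {ε : ℝ} (hε : 0 < ε) (z : 𝔼) :
    pvInt N s (fun y => ‖y‖ ^ (-((N : ℝ) - 2 * s))) (ε • z) ε = ε ^ (-(N : ℝ)) * profile N s z := by
  have h := pvInt_comp_smul (s := s) hε (fun y : 𝔼 => ‖y‖ ^ (-((N : ℝ) - 2 * s))) z 1
  simp only [norm_smul, Real.norm_of_nonneg hε.le, Real.mul_rpow hε.le (norm_nonneg _)] at h
  rw [pvInt_const_mul, mul_one] at h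
  rw [profile]
  have h2 : ε ^ (-(2 * s)) * ε ^ (2 * s) = 1 := by
    rw [← Real.rpow_add hε, neg_add_cancel, Real.rpow_zero]
  have h3 : ε ^ (-(N : ℝ)) = ε ^ (-(2 * s)) * ε ^ (-((N : ℝ) - 2 * s)) := by
    rw [← Real.rpow_add hε]; congr 1; ring
  rw [h3, mul_assoc, h, ← mul_assoc, h2, one_mul]

lemma integrable_riesz_tailKernel (hN : 3 ≤ N) (hs : s ∈ Set.Ioo (0 : ℝ) 1) (z : 𝔼) :
    Integrable fun h => ‖z - h‖ ^ (-((N : ℝ) - 2 * s)) * tailKernel N s 1 h := by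
  have hN' : (3 : ℝ) ≤ N := by exact_mod_cast hN
  obtain ⟨hs0, hs1⟩ := hs
  refine integrable_riesz (C := 1) (by omega) (by linarith) (by linarith)
    (measurable_tailKernel 1) (integrable_tailKernel hs0 one_pos) (fun h => ?_) z
  rw [abs_of_nonneg (tailKernel_nonneg _ _)]
  exact tailKernel_le_one hs0 le_rfl h

lemma profile_eq (hN : 3 ≤ N) (hs : s ∈ Set.Ioo (0 : ℝ) 1) (z : 𝔼) :
    profile N s z = ‖z‖ ^ (-((N : ℝ) - 2 * s)) * (∫ h, tailKernel N s 1 h) -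
      riesz ((N : ℝ) - 2 * s) (tailKernel N s 1) z := by
  rw [profile, pvInt_eq', riesz, ← integral_const_mul,
    ← integral_sub ((integrable_tailKernel hs.1 one_pos).const_mul _)
      (integrable_riesz_tailKernel hN hs z)]
  simp only [sub_mul]

lemma measurable_profile (hN : 3 ≤ N) (hs : s ∈ Set.Ioo (0 : ℝ) 1) :
    Measurable (profile N s) := by
  rw [funext (profile_eq hN hs)]
  refine Measurable.sub (by fun_prop) ?_
  have hT : Measurable (tailKernel N s 1) := measurable_tailKernel 1
  refine (StronglyMeasurable.integral_prod_right (ν := volume)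
    (f := fun z h => ‖z - h‖ ^ (-((N : ℝ) - 2 * s)) * tailKernel N s 1 h) ?_).measurable
  refine Measurable.stronglyMeasurable ?_
  simp only [Function.uncurry_def]
  exact Measurable.mul (by fun_prop) (hT.comp measurable_snd)

lemma exists_abs_profile_le (hN : 3 ≤ N) (hs : s ∈ Set.Ioo (0 : ℝ) 1) :
    ∃ A M : ℝ, ∀ z : 𝔼, |profile N s z| ≤ A * ‖z‖ ^ (-((N : ℝ) - 2 * s)) + M := by
  have hN' : (3 : ℝ) ≤ N := by exact_mod_cast hN
  have h1 := fun z : 𝔼 => riesz_abs_le (C := 1) (a := (N : ℝ) - 2 * s) (by omega)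
    (by linarith [hs.2]) (by linarith [hs.1]) (integrable_tailKernel hs.1 one_pos) (fun h => by
      rw [abs_of_nonneg (tailKernel_nonneg _ _)]
      exact tailKernel_le_one hs.1 le_rfl h) z
  simp only [abs_of_nonneg (tailKernel_nonneg _ _)] at h1
  refine ⟨∫ h, tailKernel N s 1 h, (1 * ∫ y in Metric.ball (0 : 𝔼) 1, ‖y‖ ^ (-((N : ℝ) - 2 * s))) +
    ∫ h, tailKernel N s 1 h, fun z => ?_⟩
  rw [profile_eq hN hs]
  refine (abs_sub _ _).trans (add_le_add ?_ ((le_of_eq ?_).trans (h1 z)))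
  · rw [mul_comm, abs_of_nonneg (mul_nonneg (integral_nonneg fun h => tailKernel_nonneg _ _)
      (by positivity))]
  · rw [abs_of_nonneg]
    exact integral_nonneg fun h => mul_nonneg (by positivity) (tailKernel_nonneg _ _)

lemma tendsto_pvInt_rescaledBubble (hN : 3 ≤ N) (hs : s ∈ Set.Ioo (0 : ℝ) 1) {z : 𝔼}
    (hz : z ≠ 0) :
    Tendsto (fun lam => pvInt N s (rescaledBubble (((N : ℝ) - 2 * s) / 2) lam) z 1)
      (nhdsWithin 0 (Set.Ioi 0)) (nhds (profile N s z)) := by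
  have hN' : (3 : ℝ) ≤ N := by exact_mod_cast hN
  have hpow : ∀ y : 𝔼, (‖y‖ ^ 2) ^ (-(((N : ℝ) - 2 * s) / 2)) = ‖y‖ ^ (-((N : ℝ) - 2 * s)) := by
    intro y
    rw [← Real.rpow_natCast, ← Real.rpow_mul (norm_nonneg _)]
    congr 1
    push_cast
    ring
  have hle : ∀ (lam : ℝ) {y : 𝔼}, y ≠ 0 → rescaledBubble (((N : ℝ) - 2 * s) / 2) lam y ≤
      ‖y‖ ^ (-((N : ℝ) - 2 * s)) := by
    intro lam y hy
    rw [← hpow, rescaledBubble]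
    have := norm_pos_iff.2 hy
    exact Real.rpow_le_rpow_of_nonpos (by positivity) (by nlinarith [sq_nonneg lam])
      (by linarith [hs.2])
  have hlim : ∀ {y : 𝔼}, y ≠ 0 → Tendsto
      (fun lam => rescaledBubble (((N : ℝ) - 2 * s) / 2) lam y) (nhdsWithin 0 (Set.Ioi 0))
      (nhds (‖y‖ ^ (-((N : ℝ) - 2 * s)))) := by
    intro y hy
    have hy' := norm_pos_iff.2 hy
    have hc : ContinuousAt (fun lam : ℝ => (lam ^ 2 + ‖y‖ ^ 2) ^ (-(((N : ℝ) - 2 * s) / 2))) 0 :=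
      ContinuousAt.rpow_const (by fun_prop) (Or.inl (by positivity))
    have := hc.tendsto.mono_left (nhdsWithin_le_nhds (s := Set.Ioi 0))
    simp only [ne_eq, OfNat.ofNat_ne_zero, not_false_eq_true, zero_pow, zero_add, hpow] at this
    exact this
  have hne : ∀ᵐ h : 𝔼, z - h ≠ 0 := by
    have : Nonempty (Fin N) := ⟨⟨0, by omega⟩⟩
    filter_upwards [Measure.ae_ne volume z] with h hh h0
    exact hh (sub_eq_zero.1 h0).symm
  rw [profile, pvInt_eq']
  simp only [pvInt_eq']
  have hT : Measurable (tailKernel N s 1) := measurable_tailKernel 1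
  have hb := ((integrable_tailKernel (N := N) hs.1 one_pos).const_mul
    (‖z‖ ^ (-((N : ℝ) - 2 * s)))).add (integrable_riesz_tailKernel hN hs z)
  refine tendsto_integral_filter_of_dominated_convergence _ (Eventually.of_forall fun lam => ?_)
    (Eventually.of_forall fun lam => ?_) hb ?_
  · have := measurable_rescaledBubble (N := N) (((N : ℝ) - 2 * s) / 2) lam
    exact (Measurable.mul (measurable_const.sub (this.comp (by fun_prop))) hT).aestronglyMeasurable
  · filter_upwards [hne] with h hh
    rw [norm_mul, Real.norm_of_nonneg (tailKernel_nonneg _ _), Pi.add_apply, ← add_mul]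
    refine mul_le_mul_of_nonneg_right ((norm_sub_le _ _).trans (add_le_add ?_ ?_))
      (tailKernel_nonneg _ _)
    · rw [Real.norm_of_nonneg (rescaledBubble_nonneg _ _ _)]
      exact hle lam hz
    · rw [Real.norm_of_nonneg (rescaledBubble_nonneg _ _ _)]
      exact hle lam hh
  · filter_upwards [hne] with h hh
    exact ((hlim hz).sub (hlim hh)).mul_const _

end Profile

section ProfileDecay

open Module
open scoped ENNReal RealInnerProductSpace

variable {N : ℕ} {s : ℝ}

local notation "𝔼" => EuclideanSpace ℝ (Fin N)

lemma integrable_mul_tailKernel (hs : 0 < s) {ε : ℝ} (hε : 0 < ε) {u : 𝔼 → ℝ} (hu : Measurable u)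
    {B : ℝ} (hB : ∀ x, |u x| ≤ B) (z : 𝔼) :
    Integrable fun h => (u z - u (z - h)) * tailKernel N s ε h := by
  refine (integrable_tailKernel hs hε).bdd_mul (c := B + B) (by fun_prop :
    Measurable fun h => u z - u (z - h)).aestronglyMeasurable (Eventually.of_forall fun h => ?_)
  exact (norm_sub_le _ _).trans (add_le_add (hB _) (hB _))

lemma abs_pvInt_sub_le (hN : 3 ≤ N) (hs : s ∈ Set.Ioo (0 : ℝ) 1) {u : 𝔼 → ℝ} (hu : Measurable u)
    {B : ℝ} (hB : ∀ x, |u x| ≤ B) {z : 𝔼} {A : ℝ}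
    (hA : ∀ h, ‖h‖ ≤ 1 → |u (z + h) + u (z - h) - 2 * u z| ≤ A * ‖h‖ ^ 2)
    {ε : ℝ} (hε : 0 < ε) (hε1 : ε ≤ 1) :
    |pvInt N s u z ε - pvInt N s u z 1| ≤
      A * ∫ h in Metric.ball (0 : 𝔼) 2, ‖h‖ ^ (-((N : ℝ) + 2 * s - 2)) := by
  have hN' : (3 : ℝ) ≤ N := by exact_mod_cast hN
  have hA0 : 0 ≤ A := by
    obtain ⟨h, hh⟩ : ∃ h : 𝔼, ‖h‖ = 1 :=
      ⟨EuclideanSpace.single ⟨0, by omega⟩ 1, by simp⟩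
    have := (abs_nonneg _).trans (hA h hh.le)
    rw [hh] at this
    linarith
  set k : 𝔼 → ℝ := fun h => tailKernel N s ε h - tailKernel N s 1 h with hk
  have hkneg : ∀ h, k (-h) = k h := fun h => by simp only [hk, tailKernel_neg]
  have hi : Integrable fun h => (u z - u (z - h)) * k h := by
    have := (integrable_mul_tailKernel hs.1 hε hu hB z).sub
      (integrable_mul_tailKernel hs.1 one_pos hu hB z)
    refine this.congr (Eventually.of_forall fun h => ?_)
    simp only [hk, Pi.sub_apply]
    ring
  have hi' : Integrable fun h => (u z - u (z + h)) * k h := by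
    have := hi.comp_neg
    refine this.congr (Eventually.of_forall fun h => ?_)
    simp only [hkneg, sub_neg_eq_add]
  have h1 : pvInt N s u z ε - pvInt N s u z 1 = ∫ h, (u z - u (z - h)) * k h := by
    rw [pvInt_eq', pvInt_eq', ← integral_sub (integrable_mul_tailKernel hs.1 hε hu hB z)
      (integrable_mul_tailKernel hs.1 one_pos hu hB z)]
    simp only [hk, mul_sub]
  have h2 : pvInt N s u z ε - pvInt N s u z 1 = ∫ h, (u z - u (z + h)) * k h := by
    rw [h1, ← integral_neg_eq_self]
    simp only [hkneg, sub_neg_eq_add]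
  have h3 : 2 * (pvInt N s u z ε - pvInt N s u z 1) =
      ∫ h, -((u (z + h) + u (z - h) - 2 * u z) * k h) := by
    rw [two_mul]
    nth_rewrite 1 [h1]
    rw [h2, ← integral_add hi hi']
    congr 1
    funext h
    ring
  have hint : Integrable ((Metric.ball (0 : 𝔼) 2).indicator
      fun h => ‖h‖ ^ (-((N : ℝ) + 2 * s - 2))) :=
    (integrableOn_norm_rpow (by omega) (by linarith [hs.2]) 2).integrable_indicator
      measurableSet_ball
  have h4 : |2 * (pvInt N s u z ε - pvInt N s u z 1)| ≤
      A * ∫ h in Metric.ball (0 : 𝔼) 2, ‖h‖ ^ (-((N : ℝ) + 2 * s - 2)) := by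
    rw [h3, ← integral_indicator measurableSet_ball, ← integral_const_mul, ← Real.norm_eq_abs]
    refine norm_integral_le_of_norm_le (hint.const_mul A) (Eventually.of_forall fun h => ?_)
    rw [norm_neg, norm_mul]
    have hr0 : 0 ≤ A * (Metric.ball (0 : 𝔼) 2).indicator
        (fun h => ‖h‖ ^ (-((N : ℝ) + 2 * s - 2))) h :=
      mul_nonneg hA0 (Set.indicator_nonneg (fun h _ => by positivity) h)
    by_cases hh1 : 1 < ‖h‖
    · have : k h = 0 := by
        simp only [hk, tailKernel]
        rw [Set.indicator_of_mem (show h ∈ {h : 𝔼 | ε < ‖h‖} from hε1.trans_lt hh1),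
          Set.indicator_of_mem (show h ∈ {h : 𝔼 | 1 < ‖h‖} from hh1), sub_self]
      rwa [this, norm_zero, mul_zero]
    by_cases hhe : ε < ‖h‖
    · have hkh : k h = ‖h‖ ^ (-((N : ℝ) + 2 * s)) := by
        simp only [hk, tailKernel]
        rw [Set.indicator_of_mem (show h ∈ {h : 𝔼 | ε < ‖h‖} from hhe),
          Set.indicator_of_notMem (show h ∉ {h : 𝔼 | 1 < ‖h‖} from hh1), sub_zero]
      have hb : h ∈ Metric.ball (0 : 𝔼) 2 := by
        rw [mem_ball_zero_iff]
        linarith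
      have hpos : 0 < ‖h‖ := hε.trans hhe
      have hsplit : ‖h‖ ^ (-((N : ℝ) + 2 * s - 2)) = ‖h‖ ^ 2 * ‖h‖ ^ (-((N : ℝ) + 2 * s)) := by
        rw [← Real.rpow_natCast, ← Real.rpow_add hpos]
        congr 1
        push_cast
        ring
      rw [Set.indicator_of_mem hb, hkh, hsplit, ← mul_assoc,
        Real.norm_of_nonneg (by positivity : 0 ≤ ‖h‖ ^ (-((N : ℝ) + 2 * s)))]
      exact mul_le_mul_of_nonneg_right (hA h (not_lt.1 hh1)) (by positivity)
    · have : k h = 0 := by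
        simp only [hk, tailKernel]
        rw [Set.indicator_of_notMem (show h ∉ {h : 𝔼 | ε < ‖h‖} from hhe),
          Set.indicator_of_notMem (show h ∉ {h : 𝔼 | 1 < ‖h‖} from hh1), sub_zero]
      rwa [this, norm_zero, mul_zero]
  rw [abs_mul, abs_two] at h4
  linarith [abs_nonneg (pvInt N s u z ε - pvInt N s u z 1)]

variable {κ c : ℝ}

/-- The bubble of height `c` solves the equation with normalization `κ`. -/
def BubbleSolves (N : ℕ) (s κ c : ℝ) : Prop :=
  ∀ x : EuclideanSpace ℝ (Fin N), ∃ L : ℝ,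
    Tendsto (pvInt N s (bubble N s c) x) (nhdsWithin 0 (Set.Ioi 0)) (nhds L) ∧
    κ * L = bubble N s c x ^ (((N : ℝ) + 2 * s) / ((N : ℝ) - 2 * s))

lemma exists_tendsto_pvInt_rescaledBubble (hN : 3 ≤ N) (hs : s ∈ Set.Ioo (0 : ℝ) 1) (hκ : 0 < κ)
    (hc : 0 < c) (hU : BubbleSolves N s κ c) :
    ∃ C : ℝ, ∀ lam : ℝ, 0 < lam → ∀ z : 𝔼, 1 ≤ ‖z‖ → ∃ L, |L| ≤ C * lam ^ (2 * s) ∧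
      Tendsto (pvInt N s (rescaledBubble (((N : ℝ) - 2 * s) / 2) lam) z)
        (nhdsWithin 0 (Set.Ioi 0)) (nhds L) := by
  have hN' : (3 : ℝ) ≤ N := by exact_mod_cast hN
  obtain ⟨hs0, hs1⟩ := hs
  have ha : 0 < (N : ℝ) - 2 * s := by linarith
  set a := (N : ℝ) - 2 * s with hadef
  set p := ((N : ℝ) + 2 * s) / a with hp
  have hp0 : 0 < p := by positivity
  refine ⟨c ^ (-1 : ℝ) * κ⁻¹ * c ^ p, fun lam hl z hz => ?_⟩
  obtain ⟨L, hL, hκL⟩ := hU (lam⁻¹ • z)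
  have hli : 0 < lam⁻¹ := inv_pos.2 hl
  have hfun : rescaledBubble (a / 2) lam = fun y : 𝔼 => (c ^ (-1 : ℝ) * lam ^ (-a)) *
      bubble N s c (lam⁻¹ • y) := by
    funext y
    rw [bubble_smul_inv hl]
    have h1 : c ^ (-1 : ℝ) * c = 1 := by rw [Real.rpow_neg_one, inv_mul_cancel₀ hc.ne']
    have h2 : lam ^ (-a) * lam ^ a = 1 := by rw [← Real.rpow_add hl, neg_add_cancel, Real.rpow_zero]
    calc _ = (c ^ (-1 : ℝ) * c) * (lam ^ (-a) * lam ^ a) * rescaledBubble (a / 2) lam y := by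
          rw [h1, h2]; ring
      _ = _ := by ring
  refine ⟨(c ^ (-1 : ℝ) * lam ^ (-a)) * (lam⁻¹ ^ (2 * s) * L), ?_, ?_⟩
  · have hL' : L = κ⁻¹ * bubble N s c (lam⁻¹ • z) ^ p := by
      rw [← hκL, ← mul_assoc, inv_mul_cancel₀ hκ.ne', one_mul]
    have hg1 : rescaledBubble (a / 2) lam z ≤ 1 := by
      refine Real.rpow_le_one_of_one_le_of_nonpos ?_ (by linarith)
      nlinarith [sq_nonneg lam]
    have hg0 := rescaledBubble_nonneg (a / 2) lam z
    rw [hL', bubble_smul_inv hl, ← hadef, Real.mul_rpow hc.le (by positivity),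
      Real.mul_rpow (by positivity) hg0, ← Real.rpow_mul hl.le, abs_of_nonneg (by positivity)]
    have hap : a * p = (N : ℝ) + 2 * s := by rw [hp]; field_simp
    have hg2 : rescaledBubble (a / 2) lam z ^ p ≤ 1 := Real.rpow_le_one hg0 hg1 hp0.le
    have h3 : lam ^ (-a) * lam⁻¹ ^ (2 * s) * lam ^ (a * p) = lam ^ (2 * s) := by
      rw [Real.inv_rpow hl.le, ← Real.rpow_neg hl.le, ← Real.rpow_add hl, ← Real.rpow_add hl, hap,
        hadef]
      congr 1
      ring
    calc _ = (c ^ (-1 : ℝ) * κ⁻¹ * c ^ p) * (lam ^ (-a) * lam⁻¹ ^ (2 * s) * lam ^ (a * p)) *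
          rescaledBubble (a / 2) lam z ^ p := by ring
      _ ≤ (c ^ (-1 : ℝ) * κ⁻¹ * c ^ p) * (lam ^ (-a) * lam⁻¹ ^ (2 * s) * lam ^ (a * p)) * 1 := by
          gcongr
      _ = _ := by rw [h3, mul_one]
  · have h4 : ∀ ε, pvInt N s (rescaledBubble (a / 2) lam) z ε =
        (c ^ (-1 : ℝ) * lam ^ (-a)) * (lam⁻¹ ^ (2 * s) *
          pvInt N s (bubble N s c) (lam⁻¹ • z) (lam⁻¹ * ε)) := fun ε => by
      rw [hfun, pvInt_const_mul, pvInt_comp_smul hli]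
    rw [funext h4]
    refine ((hL.comp ?_).const_mul _).const_mul _
    refine tendsto_nhdsWithin_iff.2 ⟨?_, ?_⟩
    · have : Continuous fun ε : ℝ => lam⁻¹ * ε := by fun_prop
      simpa using (this.tendsto 0).mono_left (nhdsWithin_le_nhds (s := Set.Ioi 0))
    · filter_upwards [self_mem_nhdsWithin] with ε hε
      exact mul_pos hli hε

lemma exists_abs_profile_le_far (hN : 3 ≤ N) (hs : s ∈ Set.Ioo (0 : ℝ) 1) (hκ : 0 < κ)
    (hc : 0 < c) (hU : BubbleSolves N s κ c) :
    ∃ C : ℝ, 0 ≤ C ∧ ∀ z : 𝔼, 2 ≤ ‖z‖ →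
      |profile N s z| ≤ C * (‖z‖ ^ 2 / 4) ^ (-(((N : ℝ) - 2 * s) / 2) - 1) := by
  have hN' : (3 : ℝ) ≤ N := by exact_mod_cast hN
  have hβ : 0 < ((N : ℝ) - 2 * s) / 2 := by linarith [hs.2]
  set β := ((N : ℝ) - 2 * s) / 2
  set J := ∫ h in Metric.ball (0 : 𝔼) 2, ‖h‖ ^ (-((N : ℝ) + 2 * s - 2))
  have hJ : 0 ≤ J := integral_nonneg fun h => by positivity
  refine ⟨(32 * β * (β + 1) + 2 * β) * J, by positivity, fun z hz => ?_⟩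
  obtain ⟨C, hC⟩ := exists_tendsto_pvInt_rescaledBubble hN hs hκ hc hU
  have hz0 : z ≠ 0 := by
    rintro rfl
    rw [norm_zero] at hz
    linarith
  have hlam : ∀ lam : ℝ, 0 < lam → |pvInt N s (rescaledBubble β lam) z 1| ≤
      C * lam ^ (2 * s) + (32 * β * (β + 1) + 2 * β) * J * (‖z‖ ^ 2 / 4) ^ (-β - 1) := by
    intro lam hl
    obtain ⟨L, hLle, hL⟩ := hC lam hl z (by linarith)
    have hB : ∀ x : 𝔼, |rescaledBubble β lam x| ≤ (lam ^ 2) ^ (-β) := fun x => by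
      rw [abs_of_nonneg (rescaledBubble_nonneg _ _ _)]
      exact Real.rpow_le_rpow_of_nonpos (by positivity) (by nlinarith [sq_nonneg ‖x‖])
        (by linarith)
    have h1 := fun ε hε hε1 => abs_pvInt_sub_le (ε := ε) hN hs (measurable_rescaledBubble β lam) hB
      (fun h hh => rescaledBubble_second_diff_le hβ lam hz hh) hε hε1
    have h2 : |L - pvInt N s (rescaledBubble β lam) z 1| ≤
        (32 * β * (β + 1) + 2 * β) * (‖z‖ ^ 2 / 4) ^ (-β - 1) * J := by
      refine le_of_tendsto (hL.sub_const _).abs ?_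
      filter_upwards [Ioc_mem_nhdsGT (one_pos : (0 : ℝ) < 1)] with ε hε
      exact h1 ε hε.1 hε.2
    have h3 := abs_sub_abs_le_abs_sub (pvInt N s (rescaledBubble β lam) z 1) L
    rw [abs_sub_comm] at h3
    linarith
  have h5 := (tendsto_pvInt_rescaledBubble hN hs hz0).abs
  have h6 : Tendsto (fun lam : ℝ => C * lam ^ (2 * s) +
      (32 * β * (β + 1) + 2 * β) * J * (‖z‖ ^ 2 / 4) ^ (-β - 1)) (nhdsWithin 0 (Set.Ioi 0))
      (nhds ((32 * β * (β + 1) + 2 * β) * J * (‖z‖ ^ 2 / 4) ^ (-β - 1))) := by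
    have hcont : Continuous fun lam : ℝ => C * lam ^ (2 * s) +
        (32 * β * (β + 1) + 2 * β) * J * (‖z‖ ^ 2 / 4) ^ (-β - 1) :=
      (continuous_const.mul (Real.continuous_rpow_const (by linarith [hs.1]))).add continuous_const
    have h7 := (hcont.tendsto 0).mono_left (nhdsWithin_le_nhds (s := Set.Ioi 0))
    rwa [Real.zero_rpow (by linarith [hs.1]), mul_zero, zero_add] at h7
  refine le_of_tendsto_of_tendsto h5 h6 ?_
  filter_upwards [self_mem_nhdsWithin] with lam hl
  exact hlam lam hl

lemma integrable_profile (hN : 3 ≤ N) (hs : s ∈ Set.Ioo (0 : ℝ) 1) (hκ : 0 < κ)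
    (hc : 0 < c) (hU : BubbleSolves N s κ c) : Integrable (profile N s) := by
  have hN' : (3 : ℝ) ≤ N := by exact_mod_cast hN
  obtain ⟨A, M, hAM⟩ := exists_abs_profile_le hN hs
  obtain ⟨C, hC0, hC⟩ := exists_abs_profile_le_far hN hs hκ hc hU
  set a := (N : ℝ) - 2 * s with ha
  have h1 : Integrable ((Metric.ball (0 : 𝔼) 2).indicator fun z => A * ‖z‖ ^ (-a) + M) := by
    refine IntegrableOn.integrable_indicator ?_ measurableSet_ball
    exact ((integrableOn_norm_rpow (by omega) (by linarith [hs.1]) 2).const_mul A).add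
      (integrableOn_const measure_ball_lt_top.ne)
  have h2 := (integrable_rpow_neg_one_add_norm_sq (E := 𝔼) (μ := volume) (r := a + 2)
    (by rw [finrank_euclideanSpace_fin]; linarith [hs.2])).const_mul
      (C * (1 / 8) ^ (-(a / 2) - 1))
  refine (h1.norm.add h2).mono' (measurable_profile hN hs).aestronglyMeasurable
    (Eventually.of_forall fun z => ?_)
  rw [Pi.add_apply, Real.norm_eq_abs]
  by_cases hz : z ∈ Metric.ball (0 : 𝔼) 2
  · rw [Set.indicator_of_mem hz]
    have := (hAM z).trans (le_abs_self _)
    have h3 : 0 ≤ C * (1 / 8) ^ (-(a / 2) - 1) * (1 + ‖z‖ ^ 2) ^ (-(a + 2) / 2) := by positivity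
    rw [Real.norm_eq_abs]
    linarith
  · have hz' : 2 ≤ ‖z‖ := by simpa using hz
    refine (hC z hz').trans ?_
    rw [Set.indicator_of_notMem hz, norm_zero, zero_add, mul_assoc]
    refine mul_le_mul_of_nonneg_left ?_ hC0
    rw [show -(a + 2) / 2 = -(a / 2) - 1 by ring, ← Real.mul_rpow (by norm_num) (by positivity)]
    exact Real.rpow_le_rpow_of_nonpos (by positivity) (by nlinarith) (by linarith [hs.2])

end ProfileDecay

section Representation

open Module
open scoped ENNReal RealInnerProductSpace

variable {N : ℕ} {s : ℝ}

local notation "𝔼" => EuclideanSpace ℝ (Fin N)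

lemma integrable_riesz_sub_mul_tailKernel (hN : 3 ≤ N) (hs : s ∈ Set.Ioo (0 : ℝ) 1) {f : 𝔼 → ℝ}
    (hf : Measurable f) (hfi : Integrable f) {B : ℝ} (hfb : ∀ x, |f x| ≤ B) {ε : ℝ} (hε : 0 < ε)
    (x : 𝔼) :
    Integrable fun q : 𝔼 × 𝔼 => ‖x - q.1 - q.2‖ ^ (-((N : ℝ) - 2 * s)) * f q.2 *
      tailKernel N s ε q.1 := by
  have hN' : (3 : ℝ) ≤ N := by exact_mod_cast hN
  have ha0 : 0 < (N : ℝ) - 2 * s := by linarith [hs.2]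
  have ha : (N : ℝ) - 2 * s < N := by linarith [hs.1]
  have hT : Measurable (tailKernel N s ε) := measurable_tailKernel ε
  have hm : Measurable fun q : 𝔼 × 𝔼 => ‖x - q.1 - q.2‖ ^ (-((N : ℝ) - 2 * s)) * f q.2 *
      tailKernel N s ε q.1 :=
    (Measurable.mul (by fun_prop) (hf.comp measurable_snd)).mul (hT.comp measurable_fst)
  rw [Measure.volume_eq_prod] at *
  rw [integrable_prod_iff hm.aestronglyMeasurable]
  refine ⟨Eventually.of_forall fun h =>
    (integrable_riesz (by omega) ha0 ha hf hfi hfb (x - h)).mul_const (tailKernel N s ε h), ?_⟩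
  have h1 : ∀ h : 𝔼, ∫ w, ‖‖x - h - w‖ ^ (-((N : ℝ) - 2 * s)) * f w * tailKernel N s ε h‖ =
      riesz ((N : ℝ) - 2 * s) (fun w => |f w|) (x - h) * tailKernel N s ε h := fun h => by
    rw [riesz, ← integral_mul_const]
    refine integral_congr_ae (Eventually.of_forall fun w => ?_)
    beta_reduce
    rw [norm_mul, norm_mul, Real.norm_of_nonneg (tailKernel_nonneg _ _),
      Real.norm_of_nonneg (by positivity : 0 ≤ ‖x - h - w‖ ^ (-((N : ℝ) - 2 * s))),
      Real.norm_eq_abs]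
  have h2 : AEStronglyMeasurable (fun h : 𝔼 => ∫ w, ‖‖x - h - w‖ ^ (-((N : ℝ) - 2 * s)) * f w *
      tailKernel N s ε h‖) volume :=
    (hm.norm.stronglyMeasurable.integral_prod_right).aestronglyMeasurable
  refine ((integrable_tailKernel hs.1 hε).const_mul
    (B * (∫ y in Metric.ball (0 : 𝔼) 1, ‖y‖ ^ (-((N : ℝ) - 2 * s))) + ∫ w, |f w|)).mono' h2
    (Eventually.of_forall fun h => ?_)
  rw [h1, norm_mul, Real.norm_of_nonneg (tailKernel_nonneg _ _)]
  refine mul_le_mul_of_nonneg_right ?_ (tailKernel_nonneg _ _)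
  rw [riesz, Real.norm_of_nonneg (integral_nonneg fun w => by positivity)]
  exact riesz_abs_le (by omega) ha0 ha hfi hfb (x - h)

lemma pvInt_riesz (hN : 3 ≤ N) (hs : s ∈ Set.Ioo (0 : ℝ) 1) {f : 𝔼 → ℝ}
    (hf : Measurable f) (hfi : Integrable f) {B : ℝ} (hfb : ∀ x, |f x| ≤ B) {ε : ℝ} (hε : 0 < ε)
    (x : 𝔼) :
    pvInt N s (riesz ((N : ℝ) - 2 * s) f) x ε = ∫ v, f (x - ε • v) * profile N s v := by
  have hN' : (3 : ℝ) ≤ N := by exact_mod_cast hN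
  have ha0 : 0 < (N : ℝ) - 2 * s := by linarith [hs.2]
  have ha : (N : ℝ) - 2 * s < N := by linarith [hs.1]
  set F : 𝔼 → 𝔼 → ℝ := fun h w => (‖x - w‖ ^ (-((N : ℝ) - 2 * s)) -
    ‖x - w - h‖ ^ (-((N : ℝ) - 2 * s))) * tailKernel N s ε h * f w with hF
  have hFi : Integrable (Function.uncurry F) (volume.prod volume) := by
    have h1 := (integrable_tailKernel (N := N) hs.1 hε).mul_prod
      (integrable_riesz (by omega) ha0 ha hf hfi hfb x)
    have h2 := integrable_riesz_sub_mul_tailKernel hN hs hf hfi hfb hε x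
    rw [Measure.volume_eq_prod] at h2
    refine (h1.sub h2).congr (Eventually.of_forall fun q => ?_)
    simp only [hF, Pi.sub_apply, Function.uncurry_def, sub_right_comm x q.2 q.1]
    ring
  have h1 : pvInt N s (riesz ((N : ℝ) - 2 * s) f) x ε = ∫ h, ∫ w, F h w := by
    rw [pvInt_eq']
    refine integral_congr_ae (Eventually.of_forall fun h => ?_)
    beta_reduce
    rw [riesz, riesz, ← integral_sub (integrable_riesz (by omega) ha0 ha hf hfi hfb x)
      (integrable_riesz (by omega) ha0 ha hf hfi hfb (x - h)), ← integral_mul_const]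
    refine integral_congr_ae (Eventually.of_forall fun w => ?_)
    simp only [hF, sub_right_comm x w h]
    ring
  rw [h1, integral_integral_swap hFi]
  have h2 : ∀ w, ∫ h, F h w =
      pvInt N s (fun y => ‖y‖ ^ (-((N : ℝ) - 2 * s))) (x - w) ε * f w := fun w => by
    rw [pvInt_eq', ← integral_mul_const]
  simp only [h2]
  rw [← integral_sub_left_eq_self _ volume x,
    integral_comp_smul_pos hε, ← integral_smul]
  refine integral_congr_ae (Eventually.of_forall fun v => ?_)
  simp only [sub_sub_cancel, pvInt_fundamental hε, smul_eq_mul]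
  have h3 : ε ^ (N : ℝ) * ε ^ (-(N : ℝ)) = 1 := by
    rw [← Real.rpow_add hε, add_neg_cancel, Real.rpow_zero]
  calc _ = (ε ^ (N : ℝ) * ε ^ (-(N : ℝ))) * (f (x - ε • v) * profile N s v) := by ring
    _ = _ := by rw [h3, one_mul]

lemma tendsto_pvInt_riesz (hN : 3 ≤ N) (hs : s ∈ Set.Ioo (0 : ℝ) 1)
    (hΦ : Integrable (profile N s)) {f : 𝔼 → ℝ} (hf : Continuous f) (hfi : Integrable f) {B : ℝ}
    (hfb : ∀ x, |f x| ≤ B) (x : 𝔼) :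
    Tendsto (pvInt N s (riesz ((N : ℝ) - 2 * s) f) x) (nhdsWithin 0 (Set.Ioi 0))
      (nhds (f x * ∫ v, profile N s v)) := by
  have h1 : Tendsto (fun ε : ℝ => ∫ v, f (x - ε • v) * profile N s v)
      (nhdsWithin 0 (Set.Ioi 0)) (nhds (f x * ∫ v, profile N s v)) := by
    rw [← integral_const_mul]
    refine tendsto_integral_filter_of_dominated_convergence (fun v => B * ‖profile N s v‖)
      (Eventually.of_forall fun ε => ?_) (Eventually.of_forall fun ε => ?_) (hΦ.norm.const_mul B) ?_
    · exact (hf.measurable.comp (by fun_prop : Measurable fun v : 𝔼 => x - ε • v)).mul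
        (measurable_profile hN hs) |>.aestronglyMeasurable
    · refine Eventually.of_forall fun v => ?_
      rw [norm_mul]
      exact mul_le_mul_of_nonneg_right (hfb _) (norm_nonneg _)
    · refine Eventually.of_forall fun v => Tendsto.mul_const _ ?_
      have : Continuous fun ε : ℝ => f (x - ε • v) := by fun_prop
      simpa using (this.tendsto 0).mono_left (nhdsWithin_le_nhds (s := Set.Ioi 0))
  refine h1.congr' ?_
  filter_upwards [self_mem_nhdsWithin] with ε hε
  exact (pvInt_riesz hN hs hf.measurable hfi hfb hε x).symm

lemma abs_weighted_le_norm {E : Type*} [NormedAddCommGroup E] [InnerProductSpace ℝ E]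
    {e : Fin 4 → WithLp 2 (E × ℝ)} {b : ℝ} (hb : 0 ≤ b) (v : C(Set.Icc (0 : ℝ) 1, ℝ)) (x : E) :
    |weighted e b v x| ≤ ‖v‖ := by
  refine (abs_weighted_le b v x).trans (mul_le_of_le_one_right (norm_nonneg _) ?_)
  exact Real.rpow_le_one_of_one_le_of_nonpos (by nlinarith [sq_nonneg ‖x‖]) (by linarith)

lemma integral_profile_pos (hN : 3 ≤ N) (hs : s ∈ Set.Ioo (0 : ℝ) 1) {κ c : ℝ} (hκ : 0 < κ)
    (hc : 0 < c) (hU : BubbleSolves N s κ c) : 0 < ∫ v, profile N s v := by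
  have hN' : (3 : ℝ) ≤ N := by exact_mod_cast hN
  have : Nontrivial 𝔼 := by
    have : Nonempty (Fin N) := ⟨⟨0, by omega⟩⟩
    infer_instance
  set a := (N : ℝ) - 2 * s with ha
  have ha0 : 0 < a := by linarith [hs.2]
  have haN : a < N := by linarith [hs.1]
  set e : Fin 4 → WithLp 2 (𝔼 × ℝ) := 0
  set f : 𝔼 → ℝ := weighted e (N - a / 2) 1 with hf
  have hfeq : ∀ x, f x = (1 + ‖x‖ ^ 2) ^ (-((N : ℝ) - a / 2)) := fun x => by
    rw [hf, weighted, ContinuousMap.one_apply, mul_one]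
  have hfc : Continuous f := continuous_weighted _ _
  have hfi : Integrable f := integrable_weighted
    (by rw [finrank_euclideanSpace_fin]; linarith) _
  have hfb : ∀ x, |f x| ≤ ‖(1 : C(Set.Icc (0 : ℝ) 1, ℝ))‖ :=
    abs_weighted_le_norm (by linarith) _
  have hK : ∀ x, riesz a f x = riesz a f 0 * (c⁻¹ * bubble N s c x) := fun x => by
    have h1 : ∀ x : 𝔼, riesz a f x = 2 ^ a * ((1 + ‖x‖ ^ 2) ^ (-(a / 2)) *
        ∫ η, ‖invStereo (0 : 𝔼) - η‖ ^ (-a) ∂sphereMeasure 𝔼) := fun x => by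
      have := riesz_weighted (e := e) a 1 x
      rw [finrank_euclideanSpace_fin] at this
      rw [this]
      simp only [ContinuousMap.one_apply, mul_one]
      rw [integral_norm_sub_eq (fun r => r ^ (-a))
        ((norm_invStereo x).trans (norm_invStereo (0 : 𝔼)).symm)]
    have h2 : c⁻¹ * bubble N s c x = (1 + ‖x‖ ^ 2) ^ (-(a / 2)) := by
      rw [bubble, ← mul_assoc, inv_mul_cancel₀ hc.ne', one_mul, one_div,
        Real.inv_rpow (by positivity), Real.rpow_neg (by positivity)]
    rw [h1 x, h1 0, h2]
    simp
    ring
  have hC1 : 0 < riesz a f 0 := by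
    have h0 : ∀ y : 𝔼, 0 ≤ ‖(0 : 𝔼) - y‖ ^ (-a) * f y := fun y => by rw [hfeq]; positivity
    rw [riesz, integral_pos_iff_support_of_nonneg h0
      (integrable_riesz (by omega) ha0 haN hfc.measurable hfi hfb 0)]
    refine lt_of_lt_of_le (Metric.isOpen_ball.measure_pos volume
      (Metric.nonempty_ball.2 one_pos : (Metric.ball (0 : 𝔼) 1).Nonempty)) ?_
    have hsub : Metric.ball (0 : 𝔼) 1 \ {0} ⊆
        Function.support fun y : 𝔼 => ‖(0 : 𝔼) - y‖ ^ (-a) * f y := by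
      intro y hy
      have : 0 < ‖y‖ := norm_pos_iff.2 hy.2
      rw [Function.mem_support, hfeq, zero_sub, norm_neg]
      positivity
    refine le_trans (le_of_eq ?_) (measure_mono hsub)
    exact (measure_sdiff_null (measure_singleton _)).symm
  obtain ⟨L, hL, hκL⟩ := hU 0
  have h1 := tendsto_pvInt_riesz hN hs (integrable_profile hN hs hκ hc hU) hfc hfi hfb 0
  have h2 : ∀ ε, pvInt N s (riesz a f) 0 ε =
      riesz a f 0 * (c⁻¹ * pvInt N s (bubble N s c) 0 ε) := fun ε => by
    rw [← pvInt_const_mul, ← pvInt_const_mul, ← funext hK]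
  rw [funext h2] at h1
  have h3 := tendsto_nhds_unique h1 ((hL.const_mul _).const_mul _)
  have hLpos : 0 < L := by
    have h4 : 0 < bubble N s c 0 := by unfold bubble; positivity
    have h5 : 0 < κ * L := by rw [hκL]; positivity
    exact pos_of_mul_pos_right h5 hκ.le
  have h6 : 0 < f 0 * ∫ v, profile N s v := by rw [h3]; positivity
  exact pos_of_mul_pos_right h6 (by rw [hfeq]; positivity)

end Representation

section Truncation

/-- Soft thresholding at level `δ`. -/
def softThreshold (δ t : ℝ) : ℝ := t - max (-δ) (min δ t)

lemma continuous_softThreshold (δ : ℝ) : Continuous (softThreshold δ) := by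
  unfold softThreshold
  fun_prop

lemma softThreshold_eq_zero {δ t : ℝ} (h : |t| ≤ δ) : softThreshold δ t = 0 := by
  rw [abs_le] at h
  rw [softThreshold, min_eq_right h.2, max_eq_right h.1, sub_self]

lemma abs_softThreshold_sub_le {δ : ℝ} (hδ : 0 ≤ δ) (t : ℝ) : |softThreshold δ t - t| ≤ δ := by
  rw [softThreshold, sub_sub_cancel_left, abs_neg, abs_le]
  exact ⟨le_max_left _ _, max_le (by linarith) (min_le_left _ _)⟩

lemma abs_softThreshold_le {δ : ℝ} (hδ : 0 ≤ δ) (t : ℝ) : |softThreshold δ t| ≤ |t| := by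
  rw [softThreshold]
  rcases max_cases (-δ) (min δ t) with h | h <;> rcases min_cases δ t with h' | h' <;>
    rcases abs_cases t with h'' | h'' <;> rw [abs_le] <;> constructor <;> linarith

lemma sq_softThreshold_sub_le (δ t r : ℝ) :
    (softThreshold δ t - softThreshold δ r) ^ 2 ≤
      (t - r) * (softThreshold δ t - softThreshold δ r) := by
  have key : ∀ {t r : ℝ}, r ≤ t → (softThreshold δ t - softThreshold δ r) ^ 2 ≤
      (t - r) * (softThreshold δ t - softThreshold δ r) := by
    intro t r h
    have h1 : max (-δ) (min δ r) ≤ max (-δ) (min δ t) := by gcongr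
    have h2 : softThreshold δ r ≤ softThreshold δ t := by
      unfold softThreshold
      rcases max_cases (-δ) (min δ t) with h | h <;> rcases min_cases δ t with h' | h' <;>
        rcases max_cases (-δ) (min δ r) with h'' | h'' <;> rcases min_cases δ r with h3 | h3 <;>
        linarith
    rw [sq]
    refine mul_le_mul_of_nonneg_right ?_ (sub_nonneg.2 h2)
    unfold softThreshold
    linarith
  rcases le_total r t with h | h
  · exact key h
  · have := key h
    nlinarith

end Truncation

section Energy

open Module
open scoped ENNReal RealInnerProductSpace

variable {N : ℕ} {s : ℝ}

local notation "𝔼" => EuclideanSpace ℝ (Fin N)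

lemma integrable_softThreshold {u : 𝔼 → ℝ} (hu : Continuous u)
    (hu0 : Tendsto u (cocompact 𝔼) (nhds 0)) {δ : ℝ} (hδ : 0 < δ) :
    Integrable fun x => softThreshold δ (u x) := by
  refine ((continuous_softThreshold δ).comp hu).integrable_of_hasCompactSupport ?_
  have h1 := hu0 (Metric.closedBall_mem_nhds 0 hδ)
  obtain ⟨S, hS, hS'⟩ := mem_cocompact.1 h1
  refine HasCompactSupport.intro hS fun x hx => softThreshold_eq_zero ?_
  simpa using hS' hx

lemma lintegral_sq_sub_le (hs : 0 < s) {u U : 𝔼 → ℝ} (hu : Continuous u) {B : ℝ}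
    (hB : ∀ x, |u x| ≤ B) (hU : Continuous U) (hUi : Integrable U)
    (hUu : ∀ x y, (U x - U y) ^ 2 ≤ (u x - u y) * (U x - U y)) {ε : ℝ} (hε : 0 < ε) :
    0 ≤ ∫ x, U x * pvInt N s u x ε ∧
    ∫⁻ z : 𝔼 × 𝔼, ENNReal.ofReal ((U z.1 - U z.2) ^ 2 * tailKernel N s ε (z.1 - z.2)) ≤
      ENNReal.ofReal (2 * ∫ x, U x * pvInt N s u x ε) := by
  set T : 𝔼 → ℝ := tailKernel N s ε with hTdef
  have hT : Measurable T := measurable_tailKernel ε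
  have hTi : Integrable T := integrable_tailKernel hs hε
  have hT0 : ∀ h, 0 ≤ T h := tailKernel_nonneg ε
  have hum := hu.measurable
  have hUm := hU.measurable
  have hdiff : Measurable fun q : 𝔼 × 𝔼 => u q.1 - u (q.1 - q.2) :=
    (hum.comp measurable_fst).sub (hum.comp (measurable_fst.sub measurable_snd))
  have hbd : ∀ x y, ‖u x - u y‖ ≤ B + B := fun x y =>
    (norm_sub_le _ _).trans (add_le_add (hB _) (hB _))
  have hG1 : Integrable (fun q : 𝔼 × 𝔼 => (u q.1 - u (q.1 - q.2)) * (U q.1 * T q.2))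
      (volume.prod volume) :=
    (hUi.mul_prod hTi).bdd_mul hdiff.aestronglyMeasurable
      (Eventually.of_forall fun q => hbd _ _)
  have hG2 : Integrable (fun q : 𝔼 × 𝔼 => (u q.1 - u (q.1 - q.2)) * (T q.2 * U (q.1 - q.2)))
      (volume.prod volume) :=
    (hTi.convolution_integrand (ContinuousLinearMap.mul ℝ ℝ) hUi).bdd_mul
      hdiff.aestronglyMeasurable (Eventually.of_forall fun q => hbd _ _)
  have hJ1 : ∫ q : 𝔼 × 𝔼, (u q.1 - u (q.1 - q.2)) * (U q.1 * T q.2) ∂(volume.prod volume) =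
      ∫ x, U x * pvInt N s u x ε := by
    rw [integral_prod _ hG1]
    refine integral_congr_ae (Eventually.of_forall fun x => ?_)
    beta_reduce
    rw [pvInt_eq', ← integral_const_mul]
    refine integral_congr_ae (Eventually.of_forall fun h => ?_)
    simp only [hTdef]
    ring
  have hJ2 : ∫ q : 𝔼 × 𝔼, (u q.1 - u (q.1 - q.2)) * (T q.2 * U (q.1 - q.2))
      ∂(volume.prod volume) = -∫ x, U x * pvInt N s u x ε := by
    rw [← hJ1, integral_prod_symm _ hG2, integral_prod_symm _ hG1, ← integral_neg_eq_self,
      ← integral_neg]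
    refine integral_congr_ae (Eventually.of_forall fun h => ?_)
    beta_reduce
    rw [← integral_neg, ← integral_sub_right_eq_self _ h]
    refine integral_congr_ae (Eventually.of_forall fun x => ?_)
    simp only [hTdef, tailKernel_neg, sub_neg_eq_add, sub_add_cancel]
    ring
  have hG : Integrable (fun q : 𝔼 × 𝔼 => (u q.1 - u (q.1 - q.2)) * (U q.1 - U (q.1 - q.2)) * T q.2)
      (volume.prod volume) := by
    refine (hG1.sub hG2).congr (Eventually.of_forall fun q => ?_)
    simp only [Pi.sub_apply]
    ring
  have hJ : ∫ q : 𝔼 × 𝔼, (u q.1 - u (q.1 - q.2)) * (U q.1 - U (q.1 - q.2)) * T q.2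
      ∂(volume.prod volume) = 2 * ∫ x, U x * pvInt N s u x ε := by
    rw [two_mul]
    nth_rewrite 2 [← neg_neg (∫ x, U x * pvInt N s u x ε)]
    rw [← hJ2, ← hJ1, ← sub_eq_add_neg, ← integral_sub hG1 hG2]
    refine integral_congr_ae (Eventually.of_forall fun q => ?_)
    beta_reduce
    ring
  have hle : ∀ q : 𝔼 × 𝔼, (U q.1 - U (q.1 - q.2)) ^ 2 * T q.2 ≤
      (u q.1 - u (q.1 - q.2)) * (U q.1 - U (q.1 - q.2)) * T q.2 := fun q =>
    mul_le_mul_of_nonneg_right (hUu _ _) (hT0 _)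
  have h0 : ∀ q : 𝔼 × 𝔼, 0 ≤ (u q.1 - u (q.1 - q.2)) * (U q.1 - U (q.1 - q.2)) * T q.2 :=
    fun q => (mul_nonneg (sq_nonneg _) (hT0 _)).trans (hle q)
  refine ⟨?_, ?_⟩
  · have : 0 ≤ ∫ q : 𝔼 × 𝔼, (u q.1 - u (q.1 - q.2)) * (U q.1 - U (q.1 - q.2)) * T q.2
        ∂(volume.prod volume) := integral_nonneg h0
    rw [hJ] at this
    linarith
  · have hm : Measurable fun z : 𝔼 × 𝔼 => ENNReal.ofReal ((U z.1 - U z.2) ^ 2 * T (z.1 - z.2)) :=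
      (Measurable.mul (((hUm.comp measurable_fst).sub (hUm.comp measurable_snd)).pow_const 2)
        (hT.comp (measurable_fst.sub measurable_snd))).ennreal_ofReal
    have hm' : Measurable fun z : 𝔼 × 𝔼 => ENNReal.ofReal ((U z.1 - U (z.1 - z.2)) ^ 2 * T z.2) :=
      (Measurable.mul (((hUm.comp measurable_fst).sub
        (hUm.comp (measurable_fst.sub measurable_snd))).pow_const 2)
        (hT.comp measurable_snd)).ennreal_ofReal
    have h1 : ∫⁻ z : 𝔼 × 𝔼, ENNReal.ofReal ((U z.1 - U z.2) ^ 2 * T (z.1 - z.2)) =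
        ∫⁻ z : 𝔼 × 𝔼, ENNReal.ofReal ((U z.1 - U (z.1 - z.2)) ^ 2 * T z.2)
          ∂(volume.prod volume) := by
      rw [Measure.volume_eq_prod, lintegral_prod _ hm.aemeasurable,
        lintegral_prod _ hm'.aemeasurable]
      refine lintegral_congr fun x => ?_
      rw [← lintegral_sub_left_eq_self _ x]
      simp only [sub_sub_cancel]
    rw [h1, ← hJ, ofReal_integral_eq_lintegral_ofReal hG (Eventually.of_forall h0)]
    exact lintegral_mono fun q => ENNReal.ofReal_le_ofReal (hle q)

lemma integral_mul_pvInt_riesz (hN : 3 ≤ N) (hs : s ∈ Set.Ioo (0 : ℝ) 1)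
    (hΦ : Integrable (profile N s)) {f U : 𝔼 → ℝ} (hf : Continuous f) (hfi : Integrable f) {B : ℝ}
    (hfb : ∀ x, |f x| ≤ B) (hU : Continuous U) (hUi : Integrable U) {B' : ℝ}
    (hUb : ∀ x, |U x| ≤ B') {ε : ℝ} (hε : 0 < ε) :
    ∫ x, U x * pvInt N s (riesz ((N : ℝ) - 2 * s) f) x ε =
      ∫ q : 𝔼 × 𝔼, U (q.2 + ε • q.1) * (profile N s q.1 * f q.2) ∂(volume.prod volume) := by
  have hm := measurable_profile hN hs
  have h1 : Integrable (Function.uncurry fun x v : 𝔼 => f (x - ε • v) * (U x * profile N s v))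
      (volume.prod volume) :=
    (hUi.mul_prod hΦ).bdd_mul (c := B) (hf.measurable.comp (by fun_prop :
      Measurable fun q : 𝔼 × 𝔼 => q.1 - ε • q.2)).aestronglyMeasurable
      (Eventually.of_forall fun q => hfb _)
  have h2 : Integrable (fun q : 𝔼 × 𝔼 => U (q.2 + ε • q.1) * (profile N s q.1 * f q.2))
      (volume.prod volume) :=
    (hΦ.mul_prod hfi).bdd_mul (c := B') (hU.measurable.comp (by fun_prop :
      Measurable fun q : 𝔼 × 𝔼 => q.2 + ε • q.1)).aestronglyMeasurable
      (Eventually.of_forall fun q => hUb _)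
  have h3 : ∀ x, U x * pvInt N s (riesz ((N : ℝ) - 2 * s) f) x ε =
      ∫ v, f (x - ε • v) * (U x * profile N s v) := fun x => by
    rw [pvInt_riesz hN hs hf.measurable hfi hfb hε, ← integral_const_mul]
    congr 1
    funext v
    ring
  simp only [h3]
  rw [integral_integral_swap h1, integral_prod _ h2]
  refine integral_congr_ae (Eventually.of_forall fun v => ?_)
  beta_reduce
  rw [← integral_add_right_eq_self _ (ε • v)]
  refine integral_congr_ae (Eventually.of_forall fun w => ?_)
  simp only [add_sub_cancel_right]
  ring

lemma tendsto_integral_mul_pvInt (hN : 3 ≤ N) (hs : s ∈ Set.Ioo (0 : ℝ) 1)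
    (hΦ : Integrable (profile N s)) {f : 𝔼 → ℝ} (hf : Continuous f) (hfi : Integrable f) {B : ℝ}
    (hfb : ∀ x, |f x| ≤ B) {u : 𝔼 → ℝ} (hu : Continuous u)
    (hu0 : Tendsto u (cocompact 𝔼) (nhds 0)) {B' : ℝ} (hub : ∀ x, |u x| ≤ B')
    (hr : u = riesz ((N : ℝ) - 2 * s) f) :
    Tendsto (fun ε => ∫ x, softThreshold ε (u x) * pvInt N s u x ε) (nhdsWithin 0 (Set.Ioi 0))
      (nhds ((∫ v, profile N s v) * ∫ w, f w * u w)) := by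
  have hm := measurable_profile hN hs
  have hub' : ∀ ε : ℝ, 0 < ε → ∀ x, |softThreshold ε (u x)| ≤ B' := fun ε hε x =>
    (abs_softThreshold_le hε.le _).trans (hub x)
  have h1 : Tendsto (fun ε : ℝ => ∫ q : 𝔼 × 𝔼, softThreshold ε (u (q.2 + ε • q.1)) *
      (profile N s q.1 * f q.2) ∂(volume.prod volume)) (nhdsWithin 0 (Set.Ioi 0))
      (nhds (∫ q : 𝔼 × 𝔼, u q.2 * (profile N s q.1 * f q.2) ∂(volume.prod volume))) := by
    refine tendsto_integral_filter_of_dominated_convergence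
      (fun q : 𝔼 × 𝔼 => B' * ‖profile N s q.1 * f q.2‖) (Eventually.of_forall fun ε => ?_) ?_
      ((hΦ.mul_prod hfi).norm.const_mul B') (Eventually.of_forall fun q => Tendsto.mul_const _ ?_)
    · have := continuous_softThreshold ε
      exact ((by fun_prop : Continuous fun q : 𝔼 × 𝔼 =>
        softThreshold ε (u (q.2 + ε • q.1))).measurable.mul ((hm.comp measurable_fst).mul
        (hf.measurable.comp measurable_snd))).aestronglyMeasurable
    · filter_upwards [self_mem_nhdsWithin] with ε hε
      refine Eventually.of_forall fun q => ?_
      rw [norm_mul]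
      exact mul_le_mul_of_nonneg_right (hub' ε hε _) (norm_nonneg _)
    · have h2 : Tendsto (fun ε : ℝ => ε + |u (q.2 + ε • q.1) - u q.2|) (nhdsWithin 0 (Set.Ioi 0))
          (nhds 0) := by
        have : Continuous fun ε : ℝ => ε + |u (q.2 + ε • q.1) - u q.2| := by fun_prop
        simpa using (this.tendsto 0).mono_left (nhdsWithin_le_nhds (s := Set.Ioi 0))
      rw [tendsto_iff_norm_sub_tendsto_zero]
      refine squeeze_zero' (Eventually.of_forall fun ε => norm_nonneg _) ?_ h2
      filter_upwards [self_mem_nhdsWithin] with ε hε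
      have h3 := abs_softThreshold_sub_le (le_of_lt hε) (u (q.2 + ε • q.1))
      calc ‖softThreshold ε (u (q.2 + ε • q.1)) - u q.2‖ =
          |(softThreshold ε (u (q.2 + ε • q.1)) - u (q.2 + ε • q.1)) +
            (u (q.2 + ε • q.1) - u q.2)| := by rw [Real.norm_eq_abs]; congr 1; ring
        _ ≤ _ := (abs_add_le _ _).trans (by linarith)
  have h4 : ∫ q : 𝔼 × 𝔼, u q.2 * (profile N s q.1 * f q.2) ∂(volume.prod volume) =
      (∫ v, profile N s v) * ∫ w, f w * u w := by
    rw [← integral_prod_mul (fun v => profile N s v) (fun w => f w * u w)]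
    congr 1
    funext q
    ring
  rw [h4] at h1
  refine h1.congr' ?_
  filter_upwards [self_mem_nhdsWithin] with ε hε
  have := integral_mul_pvInt_riesz hN hs hΦ hf hfi hfb ((continuous_softThreshold ε).comp hu)
    (integrable_softThreshold hu hu0 hε) (hub' ε hε) hε
  rw [← hr] at this
  exact this.symm

lemma integral_mul_riesz_nonneg (hN : 3 ≤ N) (hs : s ∈ Set.Ioo (0 : ℝ) 1)
    (hΦ : Integrable (profile N s)) (hm : 0 < ∫ v : 𝔼, profile N s v)
    {f : 𝔼 → ℝ} (hf : Continuous f) (hfi : Integrable f) {B : ℝ}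
    (hfb : ∀ x, |f x| ≤ B) {u : 𝔼 → ℝ} (hu : Continuous u)
    (hu0 : Tendsto u (cocompact 𝔼) (nhds 0)) {B' : ℝ} (hub : ∀ x, |u x| ≤ B')
    (hr : u = riesz ((N : ℝ) - 2 * s) f) : 0 ≤ ∫ w, f w * u w := by
  have h1 := tendsto_integral_mul_pvInt hN hs hΦ hf hfi hfb hu hu0 hub hr
  refine nonneg_of_mul_nonneg_right (ge_of_tendsto h1 ?_) hm
  filter_upwards [self_mem_nhdsWithin] with ε hε
  exact (lintegral_sq_sub_le hs.1 hu hub ((continuous_softThreshold ε).comp hu)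
    (integrable_softThreshold hu hu0 hε) (fun x y => sq_softThreshold_sub_le ε _ _) hε).1

lemma finiteEnergy_riesz (hN : 3 ≤ N) (hs : s ∈ Set.Ioo (0 : ℝ) 1)
    (hΦ : Integrable (profile N s)) {f : 𝔼 → ℝ} (hf : Continuous f) (hfi : Integrable f) {B : ℝ}
    (hfb : ∀ x, |f x| ≤ B) {u : 𝔼 → ℝ} (hu : Continuous u)
    (hu0 : Tendsto u (cocompact 𝔼) (nhds 0)) {B' : ℝ} (hub : ∀ x, |u x| ≤ B')
    (hr : u = riesz ((N : ℝ) - 2 * s) f) : FiniteEnergy N s u := by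
  set ε : ℕ → ℝ := fun j => 1 / (j + 1) with hε
  have hε0 : ∀ j, 0 < ε j := fun j => by positivity
  have hεlim : Tendsto ε atTop (nhdsWithin 0 (Set.Ioi 0)) :=
    tendsto_nhdsWithin_iff.2 ⟨tendsto_one_div_add_atTop_nhds_zero_nat, Eventually.of_forall hε0⟩
  have h1 := (tendsto_integral_mul_pvInt hN hs hΦ hf hfi hfb hu hu0 hub hr).comp hεlim
  have h2 := ENNReal.tendsto_ofReal (h1.const_mul 2)
  have h3 : ∀ j, ∫⁻ z : 𝔼 × 𝔼, ENNReal.ofReal ((softThreshold (ε j) (u z.1) -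
      softThreshold (ε j) (u z.2)) ^ 2 * tailKernel N s (ε j) (z.1 - z.2)) ≤
      ENNReal.ofReal (2 * ∫ x, softThreshold (ε j) (u x) * pvInt N s u x (ε j)) := fun j =>
    (lintegral_sq_sub_le hs.1 hu hub ((continuous_softThreshold _).comp hu)
      (integrable_softThreshold hu hu0 (hε0 j)) (fun x y => sq_softThreshold_sub_le _ _ _)
      (hε0 j)).2
  have hmeas : ∀ j, Measurable fun z : 𝔼 × 𝔼 => ENNReal.ofReal ((softThreshold (ε j) (u z.1) -
      softThreshold (ε j) (u z.2)) ^ 2 * tailKernel N s (ε j) (z.1 - z.2)) := fun j => by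
    have := continuous_softThreshold (ε j)
    have hT : Measurable (tailKernel N s (ε j)) := measurable_tailKernel _
    exact ((by fun_prop : Continuous fun z : 𝔼 × 𝔼 => (softThreshold (ε j) (u z.1) -
      softThreshold (ε j) (u z.2)) ^ 2).measurable.mul
      (hT.comp (measurable_fst.sub measurable_snd))).ennreal_ofReal
  have h4 : ∀ z : 𝔼 × 𝔼, Tendsto (fun j => ENNReal.ofReal ((softThreshold (ε j) (u z.1) -
      softThreshold (ε j) (u z.2)) ^ 2 * tailKernel N s (ε j) (z.1 - z.2))) atTop
      (nhds (ENNReal.ofReal ((u z.1 - u z.2) ^ 2 / ‖z.1 - z.2‖ ^ ((N : ℝ) + 2 * s)))) := by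
    intro z
    refine ENNReal.tendsto_ofReal ?_
    rcases eq_or_ne z.1 z.2 with hz | hz
    · simp [hz]
    have hnorm : 0 < ‖z.1 - z.2‖ := norm_pos_iff.2 (sub_ne_zero.2 hz)
    have hlim : Tendsto ε atTop (nhds 0) := tendsto_one_div_add_atTop_nhds_zero_nat
    have hsoft : ∀ t : ℝ, Tendsto (fun j => softThreshold (ε j) t) atTop (nhds t) := fun t => by
      rw [tendsto_iff_norm_sub_tendsto_zero]
      exact squeeze_zero (fun j => norm_nonneg _)
        (fun j => abs_softThreshold_sub_le (hε0 j).le t) hlim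
    have hT : Tendsto (fun j => tailKernel N s (ε j) (z.1 - z.2)) atTop
        (nhds (‖z.1 - z.2‖ ^ (-((N : ℝ) + 2 * s)))) := by
      refine tendsto_const_nhds.congr' ?_
      filter_upwards [hlim.eventually (gt_mem_nhds hnorm)] with j hj
      rw [tailKernel, Set.indicator_of_mem (show z.1 - z.2 ∈ {h : 𝔼 | ε j < ‖h‖} from hj)]
    rw [div_eq_mul_inv, ← Real.rpow_neg (norm_nonneg _)]
    exact (((hsoft _).sub (hsoft _)).pow 2).mul hT
  rw [FiniteEnergy]
  calc _ = ∫⁻ z : 𝔼 × 𝔼, liminf (fun j => ENNReal.ofReal ((softThreshold (ε j) (u z.1) -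
        softThreshold (ε j) (u z.2)) ^ 2 * tailKernel N s (ε j) (z.1 - z.2))) atTop :=
        lintegral_congr fun z => (h4 z).liminf_eq.symm
    _ ≤ liminf (fun j => ∫⁻ z : 𝔼 × 𝔼, ENNReal.ofReal ((softThreshold (ε j) (u z.1) -
        softThreshold (ε j) (u z.2)) ^ 2 * tailKernel N s (ε j) (z.1 - z.2))) atTop :=
        lintegral_liminf_le hmeas
    _ ≤ liminf (fun j => ENNReal.ofReal (2 * ∫ x, softThreshold (ε j) (u x) *
        pvInt N s u x (ε j))) atTop := liminf_le_liminf (Eventually.of_forall h3)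
    _ = _ := h2.liminf_eq
    _ < ⊤ := ENNReal.ofReal_lt_top

end Energy

section Weighted

open Module InnerProductSpace

variable {E : Type*} [NormedAddCommGroup E] [InnerProductSpace ℝ E] {e : Fin 4 → WithLp 2 (E × ℝ)}

lemma tendsto_weighted [FiniteDimensional ℝ E] {b : ℝ} (hb : 0 < b)
    (v : C(Set.Icc (0 : ℝ) 1, ℝ)) : Tendsto (weighted e b v) (cocompact E) (nhds 0) := by
  have h : Tendsto (fun x : E => 1 + ‖x‖ ^ 2) (cocompact E) atTop :=
    tendsto_atTop_add_const_left _ _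
      ((tendsto_pow_atTop two_ne_zero).comp (tendsto_norm_cocompact_atTop (E := E)))
  have h2 := ((tendsto_rpow_neg_atTop hb).comp h).const_mul ‖v‖
  rw [mul_zero] at h2
  exact squeeze_zero_norm (fun x => abs_weighted_le b v x) h2

lemma level_neg {V : Type*} [NormedAddCommGroup V] [InnerProductSpace ℝ V] (e : Fin 4 → V) (η : V) :
    level e (-η) = level e η := by
  simp only [level, inner_neg_right, neg_sq]

lemma exists_level_invStereo_eq (he : Orthonormal ℝ e) (τ : Set.Icc (0 : ℝ) 1) :
    ∃ x : E, level e (invStereo x) = τ := by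
  by_cases h : (levelPoint e τ).snd = 1
  · obtain ⟨x, hx⟩ := exists_invStereo_eq (ξ := -levelPoint e τ)
      (by rw [norm_neg, norm_levelPoint he]) (by
        rw [WithLp.neg_snd, h]; norm_num)
    refine ⟨x, ?_⟩
    rw [hx, ← level_neg, neg_neg, level_levelPoint he]
  · obtain ⟨x, hx⟩ := exists_invStereo_eq (norm_levelPoint he τ) h
    exact ⟨x, by rw [hx, level_levelPoint he]⟩

lemma weighted_oddPow {p : ℝ} (hp : 1 < p) {b b' : ℝ} (hb : b' = b * p)
    (w : C(Set.Icc (0 : ℝ) 1, ℝ)) (x : E) :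
    oddPow p (weighted e b w x) = weighted e b' (oddPowMap p hp w) x := by
  have h : 0 < 1 + ‖x‖ ^ 2 := by positivity
  rw [weighted, oddPow_smul (Real.rpow_pos_of_pos h _), ← Real.rpow_mul h.le, hb, neg_mul]
  rfl

lemma weighted_eq_zero {b : ℝ} {v : C(Set.Icc (0 : ℝ) 1, ℝ)} (he : Orthonormal ℝ e)
    (h : ∀ x : E, weighted e b v x = 0) : v = 0 := by
  ext τ
  obtain ⟨x, rfl⟩ := exists_level_invStereo_eq he τ
  have h0 : (0 : ℝ) < (1 + ‖x‖ ^ 2) ^ (-b) := Real.rpow_pos_of_pos (by positivity) _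
  exact (mul_eq_zero.1 (h x)).resolve_left h0.ne'

lemma riesz_const_mul {E : Type*} [NormedAddCommGroup E] [InnerProductSpace ℝ E]
    [FiniteDimensional ℝ E] [MeasurableSpace E] [BorelSpace E] (a θ : ℝ) (f : E → ℝ) :
    riesz a (fun y => θ * f y) = fun x => θ * riesz a f x := by
  ext x
  rw [riesz, riesz, ← integral_const_mul]
  simp_rw [mul_left_comm]

end Weighted

section Translation

variable {N : ℕ} {s : ℝ}

local notation "𝔼" => EuclideanSpace ℝ (Fin N)

lemma riesz_comp_sub (a : ℝ) (f : 𝔼 → ℝ) (v : 𝔼) :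
    riesz a (fun y => f (y - v)) = fun x => riesz a f (x - v) := by
  ext x
  rw [riesz, riesz, ← integral_add_right_eq_self _ v]
  simp_rw [add_sub_cancel_right, sub_add_eq_sub_sub_swap]

/-- A function vanishing at infinity with a nonzero period is zero. -/
lemma eq_zero_of_periodic {u : 𝔼 → ℝ} (hu0 : Tendsto u (cocompact 𝔼) (nhds 0)) {d : 𝔼}
    (hd : d ≠ 0) (h : ∀ x, u (x + d) = u x) (x : 𝔼) : u x = 0 := by
  have h1 : ∀ n : ℕ, u (x + n • d) = u x := fun n => by
    induction n with
    | zero => simp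
    | succ n ih => rw [succ_nsmul, ← add_assoc, h, ih]
  have h2 : Tendsto (fun n : ℕ => x + n • d) atTop (cocompact 𝔼) := by
    refine tendsto_cocompact_of_tendsto_dist_comp_atTop x ?_
    have h3 : (fun n : ℕ => dist (x + n • d) x) = fun n : ℕ => (n : ℝ) * ‖d‖ := by
      ext n
      rw [dist_eq_norm, add_sub_cancel_left, ← Nat.cast_smul_eq_nsmul ℝ, norm_smul,
        Real.norm_natCast]
    rw [h3]
    exact tendsto_natCast_atTop_atTop.atTop_mul_const (norm_pos_iff.2 hd)
  refine tendsto_nhds_unique (tendsto_const_nhds.congr fun n => (h1 n).symm) (hu0.comp h2)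

lemma infinite_translates_not_radial [Nonempty (Fin N)] {u : 𝔼 → ℝ}
    (hu0 : Tendsto u (cocompact 𝔼) (nhds 0)) (hne : ∃ x, u x ≠ 0) :
    {g : 𝔼 → ℝ | (∃ v, g = fun x => u (x - v)) ∧ ¬ ∃ f : ℝ → ℝ, ∀ x, g x = f ‖x‖}.Infinite := by
  obtain ⟨x₀, hx₀⟩ := hne
  have hper : ∀ d : 𝔼, (∀ x, u (x + d) = u x) → d = 0 := fun d h => by
    by_contra hd
    exact hx₀ (eq_zero_of_periodic hu0 hd h x₀)
  have hinj : Function.Injective fun v : 𝔼 => fun x => u (x - v) := fun v w h => by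
    refine (sub_eq_zero.1 (hper (v - w) fun x => ?_))
    have := congrFun h (x + v)
    simp only [add_sub_cancel_right] at this
    rw [this, add_sub_assoc]
  have hR : {v : 𝔼 | ∃ f : ℝ → ℝ, ∀ x, u (x - v) = f ‖x‖}.Subsingleton := by
    have hev : ∀ v : 𝔼, (∃ f : ℝ → ℝ, ∀ x, u (x - v) = f ‖x‖) → ∀ y, u (-y - v) = u (y - v) := by
      rintro v ⟨f, hf⟩ y
      rw [hf, hf, norm_neg]
    intro v hv w hw
    have h := hper ((2 : ℝ) • (v - w)) fun x => by
      have h1 := hev v hv (x + v)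
      have h2 := hev w hw (x + (2 : ℝ) • (v - w) + w)
      rw [add_sub_cancel_right] at h1 h2
      rw [← h2, ← h1]
      congr 1
      module
    exact sub_eq_zero.1 ((smul_eq_zero.1 h).resolve_left two_ne_zero)
  have hinf := (hR.finite.infinite_compl).image (hinj.injOn)
  refine hinf.mono ?_
  rintro _ ⟨v, hv, rfl⟩
  exact ⟨⟨v, rfl⟩, hv⟩

lemma SolvesPW.comp_sub {κ : ℝ} {u : 𝔼 → ℝ} (h : SolvesPW N s κ u) (v : 𝔼) :
    SolvesPW N s κ fun x => u (x - v) := fun x => by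
  obtain ⟨L, hL, hL'⟩ := h (x - v)
  exact ⟨L, hL.congr fun ε => (pvInt_comp_sub u v x ε).symm, hL'⟩

end Translation

section Solution

open Module

variable {N : ℕ} {s : ℝ}

local notation "𝔼" => EuclideanSpace ℝ (Fin N)

lemma exists_orthonormal_four (hN : 3 ≤ N) : ∃ e : Fin 4 → WithLp 2 (𝔼 × ℝ), Orthonormal ℝ e := by
  have hdim : finrank ℝ (WithLp 2 (𝔼 × ℝ)) = N + 1 := by
    rw [(WithLp.linearEquiv 2 ℝ (𝔼 × ℝ)).finrank_eq, finrank_prod, finrank_euclideanSpace_fin,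
      finrank_self]
  exact ⟨_, (stdOrthonormalBasis ℝ (WithLp 2 (𝔼 × ℝ))).orthonormal.comp
    (Fin.castLE (by omega)) (Fin.castLE_injective _)⟩

/-- The equation on the sphere, reduced to functions of the level, has a sign-changing solution. -/
lemma exists_weighted_eq_riesz (hN : 3 ≤ N) (hs : s ∈ Set.Ioo (0 : ℝ) 1)
    (hΦ : Integrable (profile N s)) (hm : 0 < ∫ v : 𝔼, profile N s v)
    {e : Fin 4 → WithLp 2 (𝔼 × ℝ)} (he : Orthonormal ℝ e) {p : ℝ} (hp : 1 < p)
    (hap : ((N : ℝ) - 2 * s) * (p + 1) = 2 * N) :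
    ∃ w : C(Set.Icc (0 : ℝ) 1, ℝ), (∃ τ, 0 < w τ) ∧ (∃ τ, w τ < 0) ∧
      riesz ((N : ℝ) - 2 * s)
        (weighted e ((N : ℝ) - ((N : ℝ) - 2 * s) / 2) (oddPowMap p hp w)) =
        fun x => 2 ^ ((N : ℝ) - 2 * s) * weighted e (((N : ℝ) - 2 * s) / 2) w x := by
  have hN' : (3 : ℝ) ≤ N := by exact_mod_cast hN
  obtain ⟨hs0, hs1⟩ := hs
  have : Nonempty (Fin N) := ⟨⟨0, by omega⟩⟩
  have hdim : finrank ℝ 𝔼 = N := finrank_euclideanSpace_fin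
  set a : ℝ := (N : ℝ) - 2 * s with ha
  have ha0 : 0 < a := by linarith
  have haN : a < finrank ℝ 𝔼 := by rw [hdim]; linarith
  have := isOpenPosMeasure_levelMeasure he
  obtain ⟨K, hcomp, hpos, hK⟩ := exists_levelOperator he haN
  have hr : ∀ v : C(Set.Icc (0 : ℝ) 1, ℝ), riesz a (weighted e ((N : ℝ) - a / 2) v) =
      fun x => 2 ^ a * weighted e (a / 2) (K v) x := fun v => by
    have := riesz_weighted_eq he hK v
    rwa [hdim] at this
  have hfi : ∀ v, Integrable (weighted e ((N : ℝ) - a / 2) v) := fun v =>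
    integrable_weighted (by rw [hdim]; linarith) v
  have hfb : ∀ v x, |weighted e ((N : ℝ) - a / 2) v x| ≤ ‖v‖ := fun v =>
    abs_weighted_le_norm (by linarith) v
  have h2 : (0 : ℝ) < 2 ^ a := Real.rpow_pos_of_pos two_pos _
  have hpsd : ∀ u, 0 ≤ pairing (levelMeasure e) u (K u) := fun u => by
    rw [pairing_eq_integral ((N : ℝ) - a / 2) (a / 2) (by rw [hdim]; ring)]
    have := integral_mul_riesz_nonneg hN ⟨hs0, hs1⟩ hΦ hm (continuous_weighted _ u) (hfi u) (hfb u)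
      ((continuous_weighted (a / 2) (K u)).const_mul (2 ^ a))
      (by simpa using (tendsto_weighted (by linarith) (K u)).const_mul (2 ^ a))
      (B' := 2 ^ a * ‖K u‖) (fun x => by
        rw [abs_mul, abs_of_pos h2]
        gcongr
        exact abs_weighted_le_norm (by linarith) _ _) (hr u).symm
    simp_rw [mul_left_comm _ ((2 : ℝ) ^ a)] at this
    rw [integral_const_mul] at this
    exact nonneg_of_mul_nonneg_right this h2
  have hinj : ∀ u, K u = 0 → u = 0 := fun u hu => by
    refine weighted_eq_zero (b := (N : ℝ) - a / 2) he fun x => ?_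
    have h := tendsto_pvInt_riesz hN ⟨hs0, hs1⟩ hΦ (continuous_weighted _ u) (hfi u) (hfb u) x
    rw [hr u, hu] at h
    have h0 : pvInt N s (fun y => 2 ^ a * weighted e (a / 2) (0 : C(Set.Icc (0 : ℝ) 1, ℝ)) y) x =
        fun _ => 0 := by
      ext ε
      simp [pvInt, weighted]
    rw [h0] at h
    exact (mul_eq_zero.1 (tendsto_nhds_unique h tendsto_const_nhds)).resolve_right hm.ne'
  obtain ⟨w, hw1, hw2, hw3⟩ := exists_signChanging_fixedPoint hp (levelMeasure e) (K := K)
    hcomp hpos (pairing_levelOperator_symm he haN hK) hpsd hinj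
    (fun η hη => exists_norm_levelOperator_oddPow_le he hp ha0 haN (by rw [hap, hdim]) hK hη)
    ⟨fun τ => (τ : ℝ), continuous_subtype_val⟩ fun α β h => by
      have h0 : α = 0 := by simpa using h ⟨0, by simp⟩
      have h1 : α + β = 0 := by simpa using h ⟨1, by simp⟩
      exact ⟨h0, by linarith⟩
  exact ⟨w, hw1, hw2, by rw [hr, hw3]⟩

lemma exists_signChanging_riesz_solution (hN : 3 ≤ N) (hs : s ∈ Set.Ioo (0 : ℝ) 1)
    (hΦ : Integrable (profile N s)) (hm : 0 < ∫ v : 𝔼, profile N s v) {κ : ℝ} (hκ : 0 < κ) :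
    ∃ f : 𝔼 → ℝ, Continuous f ∧ Integrable f ∧ (∃ B, ∀ x, |f x| ≤ B) ∧
      ∃ u : 𝔼 → ℝ, u = riesz ((N : ℝ) - 2 * s) f ∧ Continuous u ∧
        Tendsto u (cocompact 𝔼) (nhds 0) ∧ (∃ B, ∀ x, |u x| ≤ B) ∧ SolvesPW N s κ u ∧
        (∃ x, 0 < u x) ∧ ∃ x, u x < 0 := by
  have hN' : (3 : ℝ) ≤ N := by exact_mod_cast hN
  have hs0 := hs.1
  have hs1 := hs.2
  have hdim : finrank ℝ 𝔼 = N := finrank_euclideanSpace_fin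
  obtain ⟨e, he⟩ := exists_orthonormal_four hN
  set a : ℝ := (N : ℝ) - 2 * s with ha
  set p : ℝ := ((N : ℝ) + 2 * s) / a with hpdef
  set m : ℝ := ∫ v : 𝔼, profile N s v with hmdef
  have ha0 : 0 < a := by linarith
  have hp : 1 < p := by rw [hpdef, one_lt_div ha0]; linarith
  have hpa : a * p = (N : ℝ) + 2 * s := mul_div_cancel₀ _ ha0.ne'
  obtain ⟨w, ⟨τ₁, hτ₁⟩, ⟨τ₂, hτ₂⟩, hw⟩ := exists_weighted_eq_riesz hN hs hΦ hm he hp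
    (by rw [← ha]; linarith)
  rw [← ha] at hw
  set f := weighted e ((N : ℝ) - a / 2) (oddPowMap p hp w) with hf
  have h2 : (0 : ℝ) < 2 ^ a := Real.rpow_pos_of_pos two_pos _
  set t : ℝ := (κ * m / 2 ^ a) ^ (1 / (p - 1)) with ht
  have ht0 : 0 < t := Real.rpow_pos_of_pos (by positivity) _
  have htp : t ^ p = κ * m * (t / 2 ^ a) := by
    have h : t ^ (p - 1) = κ * m / 2 ^ a := by
      rw [ht, ← Real.rpow_mul (by positivity), one_div_mul_cancel (by linarith), Real.rpow_one]
    rw [show p = p - 1 + 1 by ring, Real.rpow_add_one ht0.ne', h]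
    ring
  have hu : (fun x => t * weighted e (a / 2) w x) = riesz a fun x => t / 2 ^ a * f x := by
    rw [riesz_const_mul, hw]
    ext x
    field_simp
  have hfc : Continuous f := continuous_weighted _ _
  have hfi : Integrable f := integrable_weighted (by rw [hdim]; linarith) _
  have hfb : ∀ x, |f x| ≤ ‖oddPowMap p hp w‖ := abs_weighted_le_norm (by linarith) _
  have hgb : ∀ x, |t / 2 ^ a * f x| ≤ t / 2 ^ a * ‖oddPowMap p hp w‖ := fun x => by
    rw [abs_mul, abs_of_pos (by positivity)]
    gcongr
    exact hfb x
  refine ⟨fun x => t / 2 ^ a * f x, hfc.const_mul _, hfi.const_mul _, ⟨_, hgb⟩, _, hu,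
    (continuous_weighted _ _).const_mul _, ?_, ⟨t * ‖w‖, fun x => ?_⟩, fun x => ?_, ?_, ?_⟩
  · simpa using (tendsto_weighted (by linarith) w).const_mul t
  · rw [abs_mul, abs_of_pos ht0]
    gcongr
    exact abs_weighted_le_norm (by linarith) _ _
  · refine ⟨t / 2 ^ a * f x * m, ?_, ?_⟩
    · rw [hu]
      exact tendsto_pvInt_riesz hN hs hΦ (hfc.const_mul _) (hfi.const_mul _) hgb x
    · have h := oddPow_smul (p := p) ht0 (weighted e (a / 2) w x)
      rw [weighted_oddPow hp (show (N : ℝ) - a / 2 = a / 2 * p by linarith), ← hf, htp] at h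
      rw [← hpdef]
      refine Eq.trans ?_ h.symm
      ring
  · obtain ⟨x, rfl⟩ := exists_level_invStereo_eq he τ₁
    exact ⟨x, mul_pos ht0 (mul_pos (Real.rpow_pos_of_pos (by positivity) _) hτ₁)⟩
  · obtain ⟨x, rfl⟩ := exists_level_invStereo_eq he τ₂
    exact ⟨x, mul_neg_of_pos_of_neg ht0
      (mul_neg_of_pos_of_neg (Real.rpow_pos_of_pos (by positivity) _) hτ₂)⟩

end Solution

theorem infinitely_many_nonradial_sign_changing_solutions
    (N : ℕ) (hN : 3 ≤ N) (s : ℝ) (hs : s ∈ Set.Ioo (0 : ℝ) 1)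
    (κ : ℝ) (hκ : 0 < κ) (c : ℝ) (hc : 0 < c)
    (hU : ∀ x : EuclideanSpace ℝ (Fin N), ∃ L : ℝ,
      Filter.Tendsto (pvInt N s (bubble N s c) x) (nhdsWithin 0 (Set.Ioi 0)) (nhds L) ∧
      κ * L = bubble N s c x ^ (((N : ℝ) + 2 * s) / ((N : ℝ) - 2 * s))) :
    {u : EuclideanSpace ℝ (Fin N) → ℝ |
      Continuous u ∧ (∃ M : ℝ, ∀ x, |u x| ≤ M) ∧
      SolvesPW N s κ u ∧ FiniteEnergy N s u ∧
      (∃ x, 0 < u x) ∧ (∃ x, u x < 0) ∧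
      ¬ ∃ f : ℝ → ℝ, ∀ x, u x = f ‖x‖}.Infinite := by
  have : Nonempty (Fin N) := ⟨⟨0, by omega⟩⟩
  have hΦ := integrable_profile hN hs hκ hc hU
  obtain ⟨f, hf, hfi, ⟨B, hfb⟩, u, hr, hu, hu0, ⟨B', hub⟩, hsol, ⟨x₁, hx₁⟩, ⟨x₂, hx₂⟩⟩ :=
    exists_signChanging_riesz_solution hN hs hΦ (integral_profile_pos hN hs hκ hc hU) hκ
  refine (infinite_translates_not_radial hu0 ⟨x₁, hx₁.ne'⟩).mono ?_
  rintro _ ⟨⟨v, rfl⟩, hrad⟩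
  have hcont : Continuous fun x => u (x - v) := hu.comp (continuous_id.sub continuous_const)
  refine ⟨hcont, ⟨B', fun x => hub _⟩, hsol.comp_sub v, ?_, ⟨x₁ + v, by simpa using hx₁⟩,
    ⟨x₂ + v, by simpa using hx₂⟩, hrad⟩
  exact finiteEnergy_riesz hN hs hΦ (f := fun x => f (x - v))
    (hf.comp (continuous_id.sub continuous_const)) (hfi.comp_sub_right v) (fun x => hfb _) hcont
    (hu0.comp (Homeomorph.subRight v).isClosedEmbedding.tendsto_cocompact)
    (fun x => hub _) (by rw [riesz_comp_sub, hr])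

end
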